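/- arXiv:1801.07025 — 3 statements merged into one kernel-verified Lean document; each statement's English description precedes it below -/
import Mathlib

section
/- Let G be a finite simple connected triangle-free graph of minimum degree at least 3. If G has a star-cover in which every star has size at least 6, then G has a spanning tree T in which no two vertices of degree 2 (in T) are adjacent (in T). -/
open SimpleGraph

/-- The degree of a vertex `v` in a simple graph `H`. -/
noncomputable def gdeg {V : Type} (H : SimpleGraph V) (v : V) : ℕ :=
  Nat.card (H.neighborSet v)

/-- The degree of a vertex `v` in a subgraph `H` of `G`. -/
noncomputable def subdeg {V : Type} {G : SimpleGraph V} (H : G.Subgraph) (v : V) : ℕ :=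
  Nat.card (H.neighborSet v)

/-- A subgraph is a star if it is a tree with at most one vertex of degree greater than 1. -/
def IsStar {V : Type} {G : SimpleGraph V} (H : G.Subgraph) : Prop :=
  H.coe.IsTree ∧ {v ∈ H.verts | 1 < subdeg H v}.Subsingleton

/-- `G` has a star-cover in which every star has size (number of edges) at least `d`:
a collection of vertex-disjoint stars, each a subgraph of `G`, covering all vertices. -/
def HasStarCover {V : Type} (G : SimpleGraph V) (d : ℕ) : Prop :=
  ∃ (m : ℕ) (S : Fin m → G.Subgraph),
    (∀ i, IsStar (S i)) ∧
    (∀ i, d ≤ (S i).edgeSet.ncard) ∧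
    (∀ i j, i ≠ j → Disjoint (S i).verts (S j).verts) ∧
    (∀ v, ∃ i, v ∈ (S i).verts)

/-- Balanced orientation of a multigraph: signs for the edges such that at every vertex
in-degree and out-degree differ by at most one. -/
lemma balanced_orientation {ι Z : Type} [DecidableEq ι] [DecidableEq Z] (n : ℕ) :
    ∀ (s : Finset ι), s.card = n → ∀ (f g : ι → Z), ∃ ε : ι → ℤ, (∀ i, ε i = 1 ∨ ε i = -1) ∧
      ∀ z, |∑ i ∈ s, ε i * ((if f i = z then 1 else 0) - (if g i = z then 1 else 0))| ≤ 1 := by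
  induction n with
  | zero =>
    intro s hs f g
    refine ⟨fun _ => 1, fun _ => Or.inl rfl, fun z => ?_⟩
    rw [Finset.card_eq_zero.mp hs]; simp
  | succ n ih =>
    intro s hs f g
    by_cases hsh : ∃ i ∈ s, ∃ j ∈ s, i ≠ j ∧ (f i = f j ∨ f i = g j ∨ g i = f j ∨ g i = g j)
    · obtain ⟨i, hi, j, hj, hij, hcase⟩ := hsh
      -- a merged edge and the relative sign of `j`
      have key : ∃ (p q : Z) (δ : ℤ), (δ = 1 ∨ δ = -1) ∧ ∀ z,
          (((if f i = z then 1 else 0) - (if g i = z then 1 else 0) : ℤ)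
            + δ * ((if f j = z then 1 else 0) - (if g j = z then 1 else 0)))
          = (if p = z then 1 else 0) - (if q = z then 1 else 0) := by
        rcases hcase with h | h | h | h
        · exact ⟨g j, g i, -1, Or.inr rfl, fun z => by rw [h]; ring⟩
        · exact ⟨f j, g i, 1, Or.inl rfl, fun z => by rw [h]; ring⟩
        · exact ⟨f i, g j, 1, Or.inl rfl, fun z => by rw [h]; ring⟩
        · exact ⟨f i, f j, -1, Or.inr rfl, fun z => by rw [h]; ring⟩
      obtain ⟨p, q, δ, hδ, hkey⟩ := key
      obtain ⟨ε, hε, hsum⟩ := ih (s.erase j) (by rw [Finset.card_erase_of_mem hj, hs]; rfl)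
        (Function.update f i p) (Function.update g i q)
      refine ⟨Function.update ε j (ε i * δ), fun k => ?_, fun z => ?_⟩
      · by_cases hk : k = j
        · subst hk
          simp only [Function.update_self]
          rcases hε i with h | h <;> rcases hδ with h' | h' <;> simp [h, h']
        · simp only [Function.update_of_ne hk]; exact hε k
      · have hiE : i ∈ s.erase j := Finset.mem_erase.mpr ⟨hij, hi⟩
        have h1 := hsum z
        rw [← Finset.add_sum_erase _ _ hiE] at h1
        rw [← Finset.add_sum_erase _ _ hj, ← Finset.add_sum_erase _ _ hiE]
        simp only [Function.update_self, Function.update_of_ne hij] at h1 ⊢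
        have h2 : ∀ k ∈ (s.erase j).erase i,
            Function.update ε j (ε i * δ) k * ((if f k = z then 1 else 0) - (if g k = z then 1 else 0))
            = ε k * ((if Function.update f i p k = z then 1 else 0)
              - (if Function.update g i q k = z then 1 else 0)) := by
          intro k hk
          simp only [Finset.mem_erase] at hk
          rw [Function.update_of_ne hk.1, Function.update_of_ne hk.1, Function.update_of_ne hk.2.1]
        rw [Finset.sum_congr rfl h2]
        rw [← hkey z] at h1
        convert h1 using 2
        ring
    · push Not at hsh
      refine ⟨fun _ => 1, fun _ => Or.inl rfl, fun z => ?_⟩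
      by_cases hz : ∃ i ∈ s, f i = z ∨ g i = z
      · obtain ⟨i, hi, hiz⟩ := hz
        rw [Finset.sum_eq_single_of_mem i hi]
        · split_ifs <;> simp
        · intro j hj hji
          have := hsh i hi j hj (Ne.symm hji)
          rw [if_neg, if_neg]
          · simp
          · rintro rfl; rcases hiz with h | h
            · exact this.2.1 h
            · exact this.2.2.2 h
          · rintro rfl; rcases hiz with h | h
            · exact this.1 h
            · exact this.2.2.1 h
      · push Not at hz
        rw [Finset.sum_eq_zero]
        · simp
        · intro i hi
          rw [if_neg (hz i hi).1, if_neg (hz i hi).2]; simp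

/-- A star with at least six edges has a center adjacent to all other vertices. -/
lemma star_center {V : Type} [Fintype V] {G : SimpleGraph V} (H : G.Subgraph)
    (hs : IsStar H) (h6 : 6 ≤ H.edgeSet.ncard) :
    ∃ z ∈ H.verts, (∀ w ∈ H.verts, w ≠ z → H.Adj z w) ∧ 7 ≤ H.verts.ncard := by
  classical
  obtain ⟨ht, hsub⟩ := hs
  have hcard := ht.card_edgeFinset
  have h7 : 6 ≤ H.coe.edgeFinset.card := by
    refine h6.trans ?_
    rw [← Subgraph.image_coe_edgeSet_coe]
    refine (Set.ncard_image_le (Set.toFinite _)).trans ?_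
    rw [← coe_edgeFinset, Set.ncard_coe_finset]
  have hsum : ∑ v, H.coe.degree v = 2 * H.coe.edgeFinset.card := by
    convert H.coe.sum_degrees_eq_twice_card_edges
  have hdeg : ∀ v : H.verts, H.coe.degree v = subdeg H v := by
    intro v
    rw [Subgraph.coe_degree, subdeg, Nat.card_eq_fintype_card, Subgraph.degree]
  have hex : ∃ z : H.verts, 1 < H.coe.degree z := by
    by_contra hno
    push Not at hno
    have : ∑ v, H.coe.degree v ≤ ∑ v : H.verts, 1 := Finset.sum_le_sum fun v _ => hno v
    simp only [Finset.sum_const, Finset.card_univ, smul_eq_mul, mul_one] at this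
    omega
  obtain ⟨z, hz⟩ := hex
  have hoth : ∀ w : H.verts, w ≠ z → H.coe.degree w ≤ 1 := by
    intro w hw
    by_contra hlt
    push Not at hlt
    apply hw
    apply Subtype.ext
    exact hsub ⟨w.2, by rw [← hdeg]; exact hlt⟩ ⟨z.2, by rw [← hdeg]; exact hz⟩
  have hzd : Fintype.card H.verts - 1 ≤ H.coe.degree z := by
    rw [← Finset.add_sum_erase _ _ (Finset.mem_univ z)] at hsum
    have : ∑ v ∈ Finset.univ.erase z, H.coe.degree v ≤ ∑ v ∈ Finset.univ.erase z, 1 :=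
      Finset.sum_le_sum fun v hv => hoth v (Finset.ne_of_mem_erase hv)
    simp only [Finset.sum_const, smul_eq_mul, mul_one, Finset.card_erase_of_mem (Finset.mem_univ z),
      Finset.card_univ] at this
    omega
  have hnb : H.coe.neighborFinset z = Finset.univ.erase z := by
    apply Finset.eq_of_subset_of_card_le
    · intro w hw
      rw [mem_neighborFinset] at hw
      exact Finset.mem_erase.mpr ⟨hw.ne', Finset.mem_univ _⟩
    · rw [Finset.card_erase_of_mem (Finset.mem_univ z), Finset.card_univ, card_neighborFinset_eq_degree]
      exact hzd
  refine ⟨z, z.2, ?_, ?_⟩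
  · intro w hw hne
    have : (⟨w, hw⟩ : H.verts) ∈ H.coe.neighborFinset z := by
      rw [hnb]
      exact Finset.mem_erase.mpr ⟨fun h => hne (congrArg Subtype.val h), Finset.mem_univ _⟩
    rw [mem_neighborFinset] at this
    simpa using this
  · rw [← Nat.card_coe_set_eq, Nat.card_eq_fintype_card]
    omega

/-- The star-cover as a function sending every vertex to the center of its star. -/
lemma exists_center_map {V : Type} [Fintype V] (G : SimpleGraph V) (h : HasStarCover G 6) :
    ∃ c : V → V, (∀ v, c (c v) = c v) ∧ (∀ v, v ≠ c v → G.Adj (c v) v) ∧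
      ∀ z, c z = z → 6 ≤ {w | c w = z ∧ w ≠ z}.ncard := by
  obtain ⟨m, S, hstar, hsize, hdisj, hcov⟩ := h
  choose i hi using hcov
  choose z hz hadj hcard using fun j => star_center (S j) (hstar j) (hsize j)
  have huniq : ∀ v j, v ∈ (S j).verts → i v = j := by
    intro v j hv
    by_contra hne
    exact Set.disjoint_left.mp (hdisj _ _ hne) (hi v) hv
  refine ⟨fun v => z (i v), fun v => ?_, fun v hv => ?_, fun y hy => ?_⟩
  · simp only [huniq _ _ (hz (i v))]
  · exact ((hadj (i v)) v (hi v) hv).adj_sub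
  · have : {w | z (i w) = y ∧ w ≠ y} = (S (i y)).verts \ {y} := by
      ext w
      simp only [Set.mem_ofPred_eq, Set.mem_sdiff, Set.mem_singleton_iff]
      constructor
      · rintro ⟨h1, h2⟩
        refine ⟨?_, h2⟩
        have : i y = i w := by rw [← h1]; exact huniq _ _ (hz (i w))
        rw [this]; exact hi w
      · rintro ⟨h1, h2⟩
        refine ⟨?_, h2⟩
        rw [huniq _ _ h1]; exact hy
    rw [this, Set.ncard_sdiff_singleton_of_mem (hi y)]
    have := hcard (i y)
    omega

/-- The growing structure: `W` is a union of stars, `L` the graph of links between stars,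
`t` the time at which a star (given by its center) was added, and `P` a set of triples
`(v, u, x)` where `u`, `x` are two leaves linked to `v` only. -/
structure StarInv {V : Type} (G : SimpleGraph V) (c : V → V) (r : V) (W : Set V)
    (L : SimpleGraph V) (t : V → ℕ) (P : Finset (V × V × V)) : Prop where
  root : c r = r
  rootW : r ∈ W
  closed : ∀ w, w ∈ W ↔ c w ∈ W
  le : ∀ a b, L.Adj a b → G.Adj a b
  memL : ∀ a b, L.Adj a b → a ∈ W
  diff : ∀ a b, L.Adj a b → c a ≠ c b
  entry : ∀ z ∈ W, c z = z → z ≠ r → ∃ e p, c e = z ∧ L.Adj e p ∧ t (c p) < t (c e)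
  cnt : L.edgeSet.ncard + 1 ≤ {z | z ∈ W ∧ c z = z}.ncard + P.card
  pne : ∀ v u x, (v, u, x) ∈ P → u ≠ x
  padj : ∀ v u x, (v, u, x) ∈ P → L.Adj v u ∧ L.Adj v x
  pleaf : ∀ v u x, (v, u, x) ∈ P → c u ≠ u ∧ c x ≠ x
  ptime : ∀ v u x, (v, u, x) ∈ P → t (c u) < t (c v) ∧ t (c x) < t (c v)
  ponly : ∀ v u x, (v, u, x) ∈ P → (∀ y, L.Adj u y → y = v) ∧ (∀ y, L.Adj x y → y = v)
  pout : ∀ v u x, (v, u, x) ∈ P → (∀ y, G.Adj u y → y ∈ W) ∧ (∀ y, G.Adj x y → y ∈ W)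
  puniq : ∀ v u x u' x', (v, u, x) ∈ P → (v, u', x') ∈ P → u = u' ∧ x = x'

/-- No link is an isolated leaf-leaf link. -/
def Good {V : Type} (c : V → V) (L : SimpleGraph V) : Prop :=
  ∀ a b, L.Adj a b → c a ≠ a → c b ≠ b →
    (∃ x, x ≠ b ∧ L.Adj a x) ∨ (∃ y, y ≠ a ∧ L.Adj b y)

lemma sup_edge_adj' {V : Type} (L : SimpleGraph V) {a b : V} (hab : a ≠ b) (x y : V) :
    (L ⊔ SimpleGraph.edge a b).Adj x y ↔ L.Adj x y ∨ (x = a ∧ y = b) ∨ (x = b ∧ y = a) := by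
  rw [sup_adj, edge_adj]
  constructor
  · rintro (h | ⟨h, -⟩)
    · exact Or.inl h
    · tauto
  · rintro (h | ⟨rfl, rfl⟩ | ⟨rfl, rfl⟩)
    · exact Or.inl h
    · exact Or.inr ⟨by tauto, hab⟩
    · exact Or.inr ⟨by tauto, hab.symm⟩

lemma ncard_sup_edge_le {V : Type} [Fintype V] (L : SimpleGraph V) (a b : V) :
    (L ⊔ SimpleGraph.edge a b).edgeSet.ncard ≤ L.edgeSet.ncard + 1 := by
  rw [edgeSet_sup]
  refine (Set.ncard_union_le _ _).trans ?_
  gcongr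
  by_cases h : a = b
  · subst h; simp
  · rw [edgeSet_edge_of_ne h]; simp

lemma StarInv.add {V : Type} [Fintype V] {G : SimpleGraph V} {c : V → V} {r : V} {W : Set V}
    {L : SimpleGraph V} {t : V → ℕ} {P : Finset (V × V × V)} (hcc : ∀ v, c (c v) = c v)
    (h : StarInv G c r W L t P) {a b : V} (ha : a ∈ W) (hb : b ∉ W) (hab : G.Adj a b) :
    ∃ t' : V → ℕ, (∀ w ∈ W, t' (c w) < t' (c b)) ∧
      StarInv G c r (W ∪ {w | c w = c b}) (L ⊔ SimpleGraph.edge a b) t' P := by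
  classical
  have hbc : c b ∉ W := fun hh => hb ((h.closed b).mpr hh)
  have hne : a ≠ b := hab.ne
  have hcW : ∀ w ∈ W, c w ≠ c b := fun w hw e => hbc (e ▸ (h.closed w).mp hw)
  have hadj := sup_edge_adj' L hne
  obtain ⟨N, hN⟩ : ∃ N, ∀ z, t z < N :=
    ⟨Finset.univ.sup t + 1, fun z => Nat.lt_succ_of_le (Finset.le_sup (Finset.mem_univ z))⟩
  set t' : V → ℕ := fun z => if z = c b then N else t z with ht'
  have htW : ∀ w ∈ W, t' (c w) = t (c w) := fun w hw => if_neg (hcW w hw)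
  have htb : t' (c b) = N := if_pos rfl
  have hpm : ∀ v u x, (v, u, x) ∈ P → v ∈ W ∧ u ∈ W ∧ x ∈ W := fun v u x hp =>
    ⟨h.memL _ _ (h.padj v u x hp).1, h.memL _ _ (h.padj v u x hp).1.symm,
      h.memL _ _ (h.padj v u x hp).2.symm⟩
  have hpa : ∀ v u x, (v, u, x) ∈ P → u ≠ a ∧ x ≠ a := fun v u x hp =>
    ⟨fun e => hb ((h.pout v u x hp).1 b (e ▸ hab)), fun e => hb ((h.pout v u x hp).2 b (e ▸ hab))⟩
  refine ⟨t', fun w hw => by rw [htW w hw, htb]; exact hN _, ?_⟩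
  refine ⟨h.root, Or.inl h.rootW, ?_, ?_, ?_, ?_, ?_, ?_, h.pne, ?_, h.pleaf, ?_, ?_, ?_, h.puniq⟩
  · intro w
    simp only [Set.mem_union, Set.mem_ofPred_eq, hcc]
    rw [← h.closed w]
  · intro x y hxy
    rcases (hadj x y).mp hxy with hh | ⟨rfl, rfl⟩ | ⟨rfl, rfl⟩
    · exact h.le _ _ hh
    · exact hab
    · exact hab.symm
  · intro x y hxy
    rcases (hadj x y).mp hxy with hh | ⟨rfl, rfl⟩ | ⟨rfl, rfl⟩
    · exact Or.inl (h.memL _ _ hh)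
    · exact Or.inl ha
    · exact Or.inr rfl
  · intro x y hxy
    rcases (hadj x y).mp hxy with hh | ⟨rfl, rfl⟩ | ⟨rfl, rfl⟩
    · exact h.diff _ _ hh
    · exact hcW _ ha
    · exact (hcW _ ha).symm
  · intro z hz hcz hzr
    rcases hz with hz | hz
    · obtain ⟨e, p, h1, h2, h3⟩ := h.entry z hz hcz hzr
      refine ⟨e, p, h1, (hadj _ _).mpr (Or.inl h2), ?_⟩
      rw [htW p (h.memL _ _ h2.symm), htW e (h.memL _ _ h2)]
      exact h3
    · have hz' : c z = c b := hz
      refine ⟨b, a, by rw [← hz', hcz], (hadj _ _).mpr (by tauto), ?_⟩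
      rw [htb, htW a ha]
      exact hN _
  · have h1 := ncard_sup_edge_le L a b
    have h2 : {z | z ∈ W ∪ {w | c w = c b} ∧ c z = z} = insert (c b) {z | z ∈ W ∧ c z = z} := by
      ext z
      simp only [Set.mem_union, Set.mem_ofPred_eq, Set.mem_insert_iff]
      constructor
      · rintro ⟨h1 | h1, h2⟩
        · exact Or.inr ⟨h1, h2⟩
        · exact Or.inl (h2 ▸ h1)
      · rintro (rfl | ⟨h1, h2⟩)
        · exact ⟨Or.inr (hcc b), hcc b⟩
        · exact ⟨Or.inl h1, h2⟩
    rw [h2, Set.ncard_insert_of_notMem (fun hh => hbc hh.1)]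
    have := h.cnt
    omega
  · intro v u x hp
    exact ⟨(hadj _ _).mpr (Or.inl (h.padj v u x hp).1), (hadj _ _).mpr (Or.inl (h.padj v u x hp).2)⟩
  · intro v u x hp
    obtain ⟨h1, h2, h3⟩ := hpm v u x hp
    rw [htW v h1, htW u h2, htW x h3]
    exact h.ptime v u x hp
  · intro v u x hp
    obtain ⟨h1, h2, h3⟩ := hpm v u x hp
    obtain ⟨h4, h5⟩ := hpa v u x hp
    constructor
    · intro y hy
      rcases (hadj _ _).mp hy with hh | ⟨h6, h7⟩ | ⟨h6, h7⟩
      · exact (h.ponly v u x hp).1 y hh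
      · exact absurd h6 h4
      · exact absurd (h6 ▸ h2) hb
    · intro y hy
      rcases (hadj _ _).mp hy with hh | ⟨h6, h7⟩ | ⟨h6, h7⟩
      · exact (h.ponly v u x hp).2 y hh
      · exact absurd h6 h5
      · exact absurd (h6 ▸ h3) hb
  · intro v u x hp
    exact ⟨fun y hy => Or.inl ((h.pout v u x hp).1 y hy), fun y hy => Or.inl ((h.pout v u x hp).2 y hy)⟩

/-- Adding a second link to a leaf `b` just added, and recording the pair. -/
lemma StarInv.addPair {V : Type} [Fintype V] {G : SimpleGraph V} {c : V → V} {r : V} {W : Set V}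
    {L : SimpleGraph V} {t : V → ℕ} {P : Finset (V × V × V)} (hcc : ∀ v, c (c v) = c v)
    (h : StarInv G c r W L t P) {a b x : V} (ha : a ∈ W) (hx : x ∈ W) (hb : b ∉ W) (hab : G.Adj a b)
    (hxb : G.Adj x b) (hax : a ≠ x) (hca : c a ≠ a) (hcx : c x ≠ x)
    (hLa : ∀ y, ¬ L.Adj a y) (hLx : ∀ y, ¬ L.Adj x y)
    (hoa : ∀ y, G.Adj a y → y ∉ W → c y = c b) (hox : ∀ y, G.Adj x y → y ∉ W → c y = c b) :
    ∃ t' P', StarInv G c r (W ∪ {w | c w = c b}) (L ⊔ SimpleGraph.edge a b ⊔ SimpleGraph.edge x b) t' P' := by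
  classical
  obtain ⟨t', ht', h'⟩ := h.add hcc ha hb hab
  have hadj1 := sup_edge_adj' L hab.ne
  have hadj := sup_edge_adj' (L ⊔ SimpleGraph.edge a b) hxb.ne
  have hcb : ∀ w ∈ W, c w ≠ c b := fun w hw e => hb ((h.closed b).mpr (e ▸ (h.closed w).mp hw))
  have hbP : ∀ u y, (b, u, y) ∉ P := fun u y hp => hb (h.memL _ _ (h.padj _ _ _ hp).1)
  have hLb : ∀ y, ¬ L.Adj b y := fun y hy => hb (h.memL _ _ hy)
  have hab' := hab.ne
  have hxb' := hxb.ne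
  refine ⟨t', insert (b, a, x) P, ?_⟩
  refine ⟨h.root, h'.rootW, h'.closed, ?_, ?_, ?_, ?_, ?_, ?_, ?_, ?_, ?_, ?_, ?_, ?_⟩
  · intro y z hyz
    rcases (hadj y z).mp hyz with hh | ⟨rfl, rfl⟩ | ⟨rfl, rfl⟩
    · exact h'.le _ _ hh
    · exact hxb
    · exact hxb.symm
  · intro y z hyz
    rcases (hadj y z).mp hyz with hh | ⟨rfl, rfl⟩ | ⟨rfl, rfl⟩
    · exact h'.memL _ _ hh
    · exact Or.inl hx
    · exact Or.inr rfl
  · intro y z hyz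
    rcases (hadj y z).mp hyz with hh | ⟨rfl, rfl⟩ | ⟨rfl, rfl⟩
    · exact h'.diff _ _ hh
    · exact hcb _ hx
    · exact (hcb _ hx).symm
  · intro z hz hcz hzr
    obtain ⟨e, p, h1, h2, h3⟩ := h'.entry z hz hcz hzr
    exact ⟨e, p, h1, (hadj _ _).mpr (Or.inl h2), h3⟩
  · have h1 := ncard_sup_edge_le (L ⊔ SimpleGraph.edge a b) x b
    have h2 := h'.cnt
    rw [Finset.card_insert_of_notMem (hbP a x)]
    omega
  · intro v u y hp
    rcases Finset.mem_insert.mp hp with hp | hp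
    · obtain ⟨rfl, rfl, rfl⟩ : v = b ∧ u = a ∧ y = x := by simpa using hp
      exact hax
    · exact h'.pne v u y hp
  · intro v u y hp
    rcases Finset.mem_insert.mp hp with hp | hp
    · obtain ⟨rfl, rfl, rfl⟩ : v = b ∧ u = a ∧ y = x := by simpa using hp
      exact ⟨(hadj _ _).mpr (Or.inl ((hadj1 _ _).mpr (by tauto))), (hadj _ _).mpr (by tauto)⟩
    · exact ⟨(hadj _ _).mpr (Or.inl (h'.padj v u y hp).1), (hadj _ _).mpr (Or.inl (h'.padj v u y hp).2)⟩
  · intro v u y hp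
    rcases Finset.mem_insert.mp hp with hp | hp
    · obtain ⟨rfl, rfl, rfl⟩ : v = b ∧ u = a ∧ y = x := by simpa using hp
      exact ⟨hca, hcx⟩
    · exact h'.pleaf v u y hp
  · intro v u y hp
    rcases Finset.mem_insert.mp hp with hp | hp
    · obtain ⟨rfl, rfl, rfl⟩ : v = b ∧ u = a ∧ y = x := by simpa using hp
      exact ⟨ht' _ ha, ht' _ hx⟩
    · exact h'.ptime v u y hp
  · intro v u y hp
    rcases Finset.mem_insert.mp hp with hp | hp
    · obtain ⟨rfl, rfl, rfl⟩ : v = b ∧ u = a ∧ y = x := by simpa using hp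
      refine ⟨fun w hw => ?_, fun w hw => ?_⟩
      · rw [hadj, hadj1] at hw
        have := hLa w
        tauto
      · rw [hadj, hadj1] at hw
        have := hLx w
        have := hax.symm
        tauto
    · have hux : ∀ s, s ∈ W → (∀ w, G.Adj s w → w ∈ W) → s ≠ x ∧ s ≠ b := fun s hs hh =>
        ⟨fun e => hb (hh b (e ▸ hxb)), fun e => hb (e ▸ hs)⟩
      have h1 := hux u (h.memL _ _ (h.padj v u y hp).1.symm) (h.pout v u y hp).1
      have h2 := hux y (h.memL _ _ (h.padj v u y hp).2.symm) (h.pout v u y hp).2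
      refine ⟨fun w hw => ?_, fun w hw => ?_⟩
      · rcases (hadj _ _).mp hw with hh | ⟨h6, h7⟩ | ⟨h6, h7⟩
        · exact (h'.ponly v u y hp).1 w hh
        · exact absurd h6 h1.1
        · exact absurd h6 h1.2
      · rcases (hadj _ _).mp hw with hh | ⟨h6, h7⟩ | ⟨h6, h7⟩
        · exact (h'.ponly v u y hp).2 w hh
        · exact absurd h6 h2.1
        · exact absurd h6 h2.2
  · intro v u y hp
    rcases Finset.mem_insert.mp hp with hp | hp
    · obtain ⟨rfl, rfl, rfl⟩ : v = b ∧ u = a ∧ y = x := by simpa using hp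
      refine ⟨fun w hw => ?_, fun w hw => ?_⟩
      · by_cases hwW : w ∈ W
        · exact Or.inl hwW
        · exact Or.inr (hoa w hw hwW)
      · by_cases hwW : w ∈ W
        · exact Or.inl hwW
        · exact Or.inr (hox w hw hwW)
    · exact h'.pout v u y hp
  · intro v u y u' y' hp hp'
    rcases Finset.mem_insert.mp hp with hq | hq <;> rcases Finset.mem_insert.mp hp' with hq' | hq'
    · simp only [Prod.mk.injEq] at hq hq'
      exact ⟨hq.2.1.trans hq'.2.1.symm, hq.2.2.trans hq'.2.2.symm⟩
    · simp only [Prod.mk.injEq] at hq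
      exact absurd (hq.1 ▸ hq') (hbP _ _)
    · simp only [Prod.mk.injEq] at hq'
      exact absurd (hq'.1 ▸ hq) (hbP _ _)
    · exact h'.puniq v u y u' y' hq hq'

/-- A good structure that is not everything can be extended. -/
lemma extend_structure {V : Type} [Fintype V] {G : SimpleGraph V} {c : V → V} {r : V} {W : Set V}
    {L : SimpleGraph V} {t : V → ℕ} {P : Finset (V × V × V)} (hcc : ∀ v, c (c v) = c v)
    (hca : ∀ v, v ≠ c v → G.Adj (c v) v)
    (hconn : G.Connected) (htf : G.CliqueFree 3) (hdeg : ∀ v, 3 ≤ gdeg G v)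
    (h : StarInv G c r W L t P) (hg : Good c L) (hW : W ≠ Set.univ) :
    ∃ W' L' t' P', W ⊂ W' ∧ StarInv G c r W' L' t' P' ∧ Good c L' := by
  classical
  have htri : ∀ x y z, G.Adj x y → G.Adj y z → G.Adj x z → False := by
    intro x y z h1 h2 h3
    exact htf {x, y, z} (is3Clique_triple_iff.mpr ⟨h1, h3, h2⟩)
  have hout : ∃ a ∈ W, ∃ b, b ∉ W ∧ G.Adj a b := by
    obtain ⟨q, hq⟩ := (Set.ne_univ_iff_exists_notMem W).mp hW
    obtain ⟨w⟩ := hconn.preconnected r q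
    obtain ⟨d, hd, h1, h2⟩ := w.exists_boundary_dart W h.rootW hq
    exact ⟨d.fst, h1, d.snd, h2, d.adj⟩
  have hss : ∀ b, b ∉ W → W ⊂ W ∪ {w | c w = c b} := fun b hb =>
    Set.ssubset_iff_subset_ne.mpr ⟨Set.subset_union_left, fun e => hb (e ▸ Or.inr rfl)⟩
  by_cases h1 : ∃ a ∈ W, ∃ b, b ∉ W ∧ G.Adj a b ∧ (c a = a ∨ c b = b ∨ ∃ y, L.Adj a y)
  · obtain ⟨a, ha, b, hb, hab, hfree⟩ := h1
    obtain ⟨t', -, h'⟩ := h.add hcc ha hb hab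
    refine ⟨_, _, t', P, hss b hb, h', ?_⟩
    have hadj := sup_edge_adj' L hab.ne
    have hmain : c a ≠ a → c b ≠ b → ∃ x, x ≠ b ∧ L.Adj a x := by
      intro h2 h3
      obtain ⟨y, hy⟩ := (hfree.resolve_left h2).resolve_left h3
      exact ⟨y, fun e => hb (e ▸ h.memL _ _ hy.symm), hy⟩
    intro x y hxy h2 h3
    rcases (hadj x y).mp hxy with hh | ⟨rfl, rfl⟩ | ⟨rfl, rfl⟩
    · rcases hg x y hh h2 h3 with ⟨z, hz, hz'⟩ | ⟨z, hz, hz'⟩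
      · exact Or.inl ⟨z, hz, (hadj _ _).mpr (Or.inl hz')⟩
      · exact Or.inr ⟨z, hz, (hadj _ _).mpr (Or.inl hz')⟩
    · obtain ⟨z, hz, hz'⟩ := hmain h2 h3
      exact Or.inl ⟨z, hz, (hadj _ _).mpr (Or.inl hz')⟩
    · obtain ⟨z, hz, hz'⟩ := hmain h3 h2
      exact Or.inr ⟨z, hz, (hadj _ _).mpr (Or.inl hz')⟩
  -- goodness after adding two links at a common vertex
  have hgood2 : ∀ p q s : V, p ≠ q → p ≠ s → q ≠ s →
      Good c (L ⊔ SimpleGraph.edge p q ⊔ SimpleGraph.edge p s) := by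
    intro p q s hpq hps hqs x y hxy h2 h3
    have hadj1 := sup_edge_adj' L hpq
    have hadj := sup_edge_adj' (L ⊔ SimpleGraph.edge p q) hps
    have e1 : (L ⊔ SimpleGraph.edge p q ⊔ SimpleGraph.edge p s).Adj p q := by
      rw [hadj, hadj1]; tauto
    have e2 : (L ⊔ SimpleGraph.edge p q ⊔ SimpleGraph.edge p s).Adj p s := by
      rw [hadj]; tauto
    rcases (hadj x y).mp hxy with hh | ⟨rfl, rfl⟩ | ⟨rfl, rfl⟩
    · rcases (hadj1 x y).mp hh with hh | ⟨rfl, rfl⟩ | ⟨rfl, rfl⟩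
      · rcases hg x y hh h2 h3 with ⟨z, hz, hz'⟩ | ⟨z, hz, hz'⟩
        · exact Or.inl ⟨z, hz, (hadj _ _).mpr (Or.inl ((hadj1 _ _).mpr (Or.inl hz')))⟩
        · exact Or.inr ⟨z, hz, (hadj _ _).mpr (Or.inl ((hadj1 _ _).mpr (Or.inl hz')))⟩
      · exact Or.inl ⟨s, hqs.symm, e2⟩
      · exact Or.inr ⟨s, hqs.symm, e2⟩
    · exact Or.inl ⟨q, hqs, e1⟩
    · exact Or.inr ⟨q, hqs, e1⟩
  by_cases h2 : ∃ a ∈ W, ∃ b b', b ∉ W ∧ b' ∉ W ∧ G.Adj a b ∧ G.Adj a b' ∧ c b' ≠ c b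
  · obtain ⟨a, ha, b, b', hb, hb', hab, hab', hne⟩ := h2
    obtain ⟨t', -, h'⟩ := h.add hcc ha hb hab
    obtain ⟨t'', -, h''⟩ := h'.add hcc (Or.inl ha) (b := b') (by rintro (hh | hh); exacts [hb' hh, hne hh]) hab'
    exact ⟨_, _, t'', P, (hss b hb).trans_subset Set.subset_union_left, h'',
      hgood2 a b b' hab.ne hab'.ne (fun e => hne (e ▸ rfl))⟩
  by_cases h3 : ∃ a ∈ W, ∃ b x, b ∉ W ∧ x ∉ W ∧ G.Adj a b ∧ G.Adj b x ∧ c x ≠ c b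
  · obtain ⟨a, ha, b, x, hb, hx, hab, hbx, hne⟩ := h3
    obtain ⟨t', -, h'⟩ := h.add hcc ha hb hab
    obtain ⟨t'', -, h''⟩ := h'.add hcc (a := b) (Or.inr rfl) (b := x)
      (by rintro (hh | hh); exacts [hx hh, hne hh]) hbx
    have := hgood2 b a x hab.ne' hbx.ne (fun e => hx (e ▸ ha))
    rw [edge_comm b a] at this
    exact ⟨_, _, t'', P, (hss b hb).trans_subset Set.subset_union_left, h'', this⟩
  push Not at h1 h2 h3
  obtain ⟨a, ha, b, hb, hab⟩ := hout
  obtain ⟨ca, cb, La⟩ := h1 a ha b hb hab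
  -- a third neighbour of `b`
  obtain ⟨x, hbx, hxa, hxc⟩ : ∃ x, G.Adj b x ∧ x ≠ a ∧ x ≠ c b := by
    by_contra hno
    push Not at hno
    have hsub : G.neighborSet b ⊆ {a, c b} := by
      intro x hx
      by_cases hxa : x = a
      · exact Or.inl hxa
      · exact Or.inr (hno x hx hxa)
    have h5 := hdeg b
    rw [gdeg, Nat.card_coe_set_eq] at h5
    have h6 := (Set.ncard_le_ncard hsub (Set.toFinite _)).trans (Set.ncard_insert_le _ _)
    rw [Set.ncard_singleton] at h6
    omega
  have hxW : x ∈ W := by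
    by_contra hxW
    have hcx := h3 a ha b x hb hxW hab hbx
    have k1 := hca b (fun e => cb e.symm)
    have k2 := hca x (by rw [hcx]; exact hxc)
    rw [hcx] at k2
    exact htri _ _ _ k1 hbx k2
  obtain ⟨cx, -, Lx⟩ := h1 x hxW b hb hbx.symm
  obtain ⟨t', P', h'⟩ := h.addPair hcc ha hxW hb hab hbx.symm hxa.symm ca cx La Lx
    (fun y hy hyW => h2 a ha b y hb hyW hab hy) (fun y hy hyW => h2 x hxW b y hb hyW hbx.symm hy)
  have := hgood2 b a x hab.ne' hbx.ne hxa.symm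
  rw [edge_comm b a, edge_comm b x] at this
  exact ⟨_, _, t', P', hss b hb, h', this⟩

/-- The structure can be grown to the whole graph. -/
lemma exists_full {V : Type} [Fintype V] {G : SimpleGraph V} {c : V → V} (hcc : ∀ v, c (c v) = c v)
    (hca : ∀ v, v ≠ c v → G.Adj (c v) v)
    (hconn : G.Connected) (htf : G.CliqueFree 3) (hdeg : ∀ v, 3 ≤ gdeg G v) :
    ∃ r L t P, StarInv G c r Set.univ L t P ∧ Good c L := by
  obtain ⟨v0⟩ := hconn.nonempty
  have hgrow : ∀ n, ∀ (W : Set V) L t P, Wᶜ.ncard = n → StarInv G c (c v0) W L t P → Good c L →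
      ∃ r L t P, StarInv G c r Set.univ L t P ∧ Good c L := by
    intro n
    induction n using Nat.strong_induction_on with
    | _ n ih =>
      intro W L t P hn h hg
      by_cases hW : W = Set.univ
      · subst hW; exact ⟨_, L, t, P, h, hg⟩
      · obtain ⟨W', L', t', P', hss, h', hg'⟩ := extend_structure hcc hca hconn htf hdeg h hg hW
        refine ih _ ?_ W' L' t' P' rfl h' hg'
        rw [← hn]
        exact Set.ncard_lt_ncard (compl_lt_compl_iff_lt.mpr hss) (Set.toFinite _)
  refine hgrow _ {w | c w = c v0} ⊥ (fun _ => 0) ∅ rfl ?_ (fun a b hab => by simp at hab)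
  refine ⟨hcc v0, hcc v0, fun w => by simp [hcc], by simp, by simp, by simp, ?_, ?_,
    by simp, by simp, by simp, by simp, by simp, by simp, by simp⟩
  · intro z hz hcz hzr
    exact absurd (hcz.symm.trans hz) hzr
  · have : 0 < {z | z ∈ {w | c w = c v0} ∧ c z = z}.ncard :=
      (Set.ncard_pos (Set.toFinite _)).mpr ⟨c v0, hcc v0, hcc v0⟩
    simp only [edgeSet_bot, Set.ncard_empty, Finset.card_empty]
    omega

/-- Let `G` be a finite simple connected triangle-free graph of minimum degree at least 3.
If `G` has a star-cover in which every star has size at least 6, then `G` has a spanning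
tree `T` in which no two vertices of degree 2 (in `T`) are adjacent (in `T`). -/
theorem stmt_5 (V : Type) [Fintype V] (G : SimpleGraph V)
    (hconn : G.Connected) (htf : G.CliqueFree 3) (hdeg : ∀ v, 3 ≤ gdeg G v)
    (hcover : HasStarCover G 6) :
    ∃ T : SimpleGraph V, T ≤ G ∧ T.IsTree ∧
      ∀ a b : V, T.Adj a b → ¬(gdeg T a = 2 ∧ gdeg T b = 2) := by
  classical
  obtain ⟨c, hcc, hca, hc6⟩ := exists_center_map G hcover
  obtain ⟨r, L, t, P, h, hg⟩ := exists_full hcc hca hconn htf hdeg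
  obtain ⟨ε, hε, hbal⟩ := balanced_orientation _ P rfl (fun p => c p.2.1) (fun p => c p.2.2)
  -- donors and non-donors
  set d : V × V × V → V := fun p => if ε p = 1 then p.2.1 else p.2.2 with hd
  set o : V × V × V → V := fun p => if ε p = 1 then p.2.2 else p.2.1 with ho
  have hcase : ∀ p, (d p = p.2.1 ∧ o p = p.2.2 ∧ ε p = 1) ∨ (d p = p.2.2 ∧ o p = p.2.1 ∧ ε p = -1) := by
    intro p
    rcases hε p with h1 | h1 <;> simp [hd, ho, h1]
  have hdadj : ∀ p ∈ P, L.Adj p.1 (d p) ∧ L.Adj p.1 (o p) := by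
    rintro ⟨v, u, x⟩ hp
    have := h.padj v u x hp
    rcases hcase (v, u, x) with ⟨h1, h2, -⟩ | ⟨h1, h2, -⟩ <;> rw [h1, h2] <;> tauto
  have hdonly : ∀ p ∈ P, (∀ y, L.Adj (d p) y → y = p.1) ∧ (∀ y, L.Adj (o p) y → y = p.1) := by
    rintro ⟨v, u, x⟩ hp
    have := h.ponly v u x hp
    rcases hcase (v, u, x) with ⟨h1, h2, -⟩ | ⟨h1, h2, -⟩ <;> rw [h1, h2] <;> tauto
  have hdleaf : ∀ p ∈ P, c (d p) ≠ d p ∧ c (o p) ≠ o p := by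
    rintro ⟨v, u, x⟩ hp
    have := h.pleaf v u x hp
    rcases hcase (v, u, x) with ⟨h1, h2, -⟩ | ⟨h1, h2, -⟩ <;> rw [h1, h2] <;> tauto
  have hdtime : ∀ p ∈ P, t (c (d p)) < t (c p.1) ∧ t (c (o p)) < t (c p.1) := by
    rintro ⟨v, u, x⟩ hp
    have := h.ptime v u x hp
    rcases hcase (v, u, x) with ⟨h1, h2, -⟩ | ⟨h1, h2, -⟩ <;> rw [h1, h2] <;> tauto
  have hdo : ∀ p ∈ P, d p ≠ o p := by
    rintro ⟨v, u, x⟩ hp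
    have := h.pne v u x hp
    rcases hcase (v, u, x) with ⟨h1, h2, -⟩ | ⟨h1, h2, -⟩ <;> rw [h1, h2]
    · exact this
    · exact this.symm
  have hinj : ∀ p ∈ P, ∀ q ∈ P, p.1 = q.1 → p = q := by
    rintro ⟨v, u, x⟩ hp ⟨v', u', x'⟩ hq e
    simp only at e
    subst e
    obtain ⟨rfl, rfl⟩ := h.puniq _ _ _ _ _ hp hq
    rfl
  have hdinj : Set.InjOn d (P : Set (V × V × V)) := fun p hp q hq e =>
    hinj p hp q hq ((hdonly q hq).1 _ (e ▸ (hdadj p hp).1.symm))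
  have hoinj : Set.InjOn o (P : Set (V × V × V)) := fun p hp q hq e =>
    hinj p hp q hq ((hdonly q hq).2 _ (e ▸ (hdadj p hp).2.symm))
  have hdo' : ∀ p ∈ P, ∀ q ∈ P, d p ≠ o q := by
    intro p hp q hq e
    have : p = q := hinj p hp q hq ((hdonly q hq).2 _ (e ▸ (hdadj p hp).1.symm))
    subst this
    exact hdo p hp e
  set D : Finset V := P.image d with hD
  have hDcard : D.card = P.card := Finset.card_image_of_injOn hdinj
  have hDone : ∀ a ∈ D, ∀ y y', L.Adj a y → L.Adj a y' → y = y' := by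
    intro a ha y y' h1 h2
    obtain ⟨p, hp, rfl⟩ := Finset.mem_image.mp ha
    rw [(hdonly p hp).1 y h1, (hdonly p hp).1 y' h2]
  have hoD : ∀ p ∈ P, o p ∉ D := by
    intro p hp hh
    obtain ⟨q, hq, e⟩ := Finset.mem_image.mp hh
    exact hdo' q hq p hp e
  have hvD : ∀ p ∈ P, p.1 ∉ D := fun p hp hh =>
    hdo p hp (hDone _ hh _ _ (hdadj p hp).1 (hdadj p hp).2)
  have hDleaf : ∀ a ∈ D, c a ≠ a := by
    intro a ha
    obtain ⟨p, hp, rfl⟩ := Finset.mem_image.mp ha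
    exact (hdleaf p hp).1
  have hcD : ∀ a, c a ∉ D := fun a ha => hDleaf _ ha (hcc a)
  -- each center keeps at least three leaves
  have hkeep : ∀ z, c z = z → 3 ≤ ((Finset.univ.filter fun w => c w = z ∧ w ≠ z) \ D).card := by
    intro z hz
    set A := Finset.univ.filter fun w => c w = z ∧ w ≠ z with hA
    have hA6 : 6 ≤ A.card := by
      have := hc6 z hz
      rw [← Set.ncard_coe_finset]
      convert this using 2
      ext w; simp [hA]
    have hb := hbal z
    have hs : ∑ p ∈ P, ε p * ((if c p.2.1 = z then 1 else 0) - (if c p.2.2 = z then 1 else 0))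
        = ((P.filter fun p => c (d p) = z).card : ℤ) - ((P.filter fun p => c (o p) = z).card : ℤ) := by
      rw [Finset.card_filter, Finset.card_filter]
      push_cast
      rw [← Finset.sum_sub_distrib]
      refine Finset.sum_congr rfl fun p _ => ?_
      rcases hcase p with ⟨h1, h2, h3⟩ | ⟨h1, h2, h3⟩ <;> rw [h1, h2, h3] <;> ring
    rw [hs] at hb
    have hb' := (abs_le.mp hb).2
    have h1 : (A ∩ D).card ≤ (P.filter fun p => c (d p) = z).card := by
      refine (Finset.card_le_card ?_).trans (Finset.card_image_le (f := d))
      intro w hw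
      obtain ⟨hwA, hwD⟩ := Finset.mem_inter.mp hw
      obtain ⟨p, hp, rfl⟩ := Finset.mem_image.mp hwD
      exact Finset.mem_image.mpr ⟨p, Finset.mem_filter.mpr ⟨hp, (Finset.mem_filter.mp hwA).2.1⟩, rfl⟩
    have h2 : (P.filter fun p => c (o p) = z).card ≤ (A \ D).card := by
      rw [← Finset.card_image_of_injOn (f := o) (hoinj.mono (by intro p hp; exact (Finset.mem_filter.mp hp).1))]
      refine Finset.card_le_card ?_
      intro w hw
      obtain ⟨p, hp, rfl⟩ := Finset.mem_image.mp hw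
      obtain ⟨hp, hpz⟩ := Finset.mem_filter.mp hp
      refine Finset.mem_sdiff.mpr ⟨Finset.mem_filter.mpr ⟨Finset.mem_univ _, hpz, ?_⟩, hoD p hp⟩
      intro e
      exact (hdleaf p hp).2 (hpz.trans e.symm)
    have h3 := Finset.card_inter_add_card_sdiff A D
    omega
  -- the tree
  let T : SimpleGraph V :=
    { Adj := fun a b => L.Adj a b ∨ (c a = b ∧ a ≠ b ∧ a ∉ D) ∨ (c b = a ∧ b ≠ a ∧ b ∉ D)
      symm := ⟨fun a b hab => by
        rcases hab with h1 | h1 | h1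
        · exact Or.inl h1.symm
        · exact Or.inr (Or.inr h1)
        · exact Or.inr (Or.inl h1)⟩
      loopless := ⟨fun a ha => by
        rcases ha with h1 | h1 | h1
        · exact L.loopless.irrefl a h1
        · exact h1.2.1 rfl
        · exact h1.2.1 rfl⟩ }
  have hTL : ∀ a b, L.Adj a b → T.Adj a b := fun a b hab => Or.inl hab
  have hTc : ∀ a, a ∉ D → T.Reachable a (c a) := by
    intro a ha
    by_cases e : c a = a
    · rw [e]
    · exact Adj.reachable (Or.inr (Or.inl ⟨rfl, fun e' => e e'.symm, ha⟩))
  have hreach : ∀ n, ∀ a, a ∉ D → t (c a) = n → T.Reachable a r := by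
    intro n
    induction n using Nat.strong_induction_on with
    | _ n ih =>
      intro a ha hn
      refine (hTc a ha).trans ?_
      by_cases hr : c a = r
      · rw [hr]
      obtain ⟨e, p, h1, h2, h3⟩ := h.entry (c a) (Set.mem_univ _) (hcc a) hr
      have heD : e ∉ D := by
        intro heD
        obtain ⟨q, hq, rfl⟩ := Finset.mem_image.mp heD
        have := (hdonly q hq).1 p h2
        subst this
        exact absurd (hdtime q hq).1 (by omega)
      obtain ⟨p', hp', hp'D, hp't⟩ : ∃ p', L.Adj e p' ∧ p' ∉ D ∧ t (c p') < t (c e) := by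
        by_cases hpD : p ∈ D
        · obtain ⟨q, hq, rfl⟩ := Finset.mem_image.mp hpD
          have := (hdonly q hq).1 e h2.symm
          subst this
          exact ⟨o q, (hdadj q hq).2, hoD q hq, (hdtime q hq).2⟩
        · exact ⟨p, h2, hpD, h3⟩
      have h4 := hTc e heD
      rw [h1] at h4
      refine h4.symm.trans ((hTL _ _ hp').reachable.trans (ih _ ?_ p' hp'D rfl))
      rw [← hn, ← h1]
      exact hp't
  have hTconn : T.Connected := by
    rw [connected_iff_exists_forall_reachable]
    refine ⟨r, fun a => Reachable.symm ?_⟩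
    by_cases ha : a ∈ D
    · obtain ⟨p, hp, rfl⟩ := Finset.mem_image.mp ha
      exact (hTL _ _ (hdadj p hp).1.symm).reachable.trans (hreach _ _ (hvD p hp) rfl)
    · exact hreach _ a ha rfl
  have hcount : T.edgeSet.ncard + 1 ≤ Fintype.card V := by
    set B := Finset.univ.filter fun w => c w ≠ w with hB
    have hsub : T.edgeSet ⊆ L.edgeSet ∪ ((fun w => s(w, c w)) '' ((B \ D : Finset V) : Set V)) := by
      intro e
      induction e using Sym2.ind with
      | _ a b =>
        intro hab
        rw [mem_edgeSet] at hab
        rcases hab with h1 | ⟨h1, h2, h3⟩ | ⟨h1, h2, h3⟩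
        · exact Or.inl h1
        · refine Or.inr ⟨a, ?_, by simp [h1]⟩
          simp only [hB, Finset.coe_sdiff, Set.mem_sdiff, Finset.mem_coe, Finset.mem_filter,
            Finset.mem_univ, true_and]
          exact ⟨fun e => h2 (e.symm.trans h1), h3⟩
        · refine Or.inr ⟨b, ?_, by simp [h1, Sym2.eq_swap]⟩
          simp only [hB, Finset.coe_sdiff, Set.mem_sdiff, Finset.mem_coe, Finset.mem_filter,
            Finset.mem_univ, true_and]
          exact ⟨fun e => h2 (e.symm.trans h1), h3⟩
    have h1 := (Set.ncard_le_ncard hsub (Set.toFinite _)).trans (Set.ncard_union_le _ _)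
    have h2 := Set.ncard_image_le (f := fun w => s(w, c w)) (Set.toFinite ((B \ D : Finset V) : Set V))
    rw [Set.ncard_coe_finset] at h2
    have hDB : D ⊆ B := fun a ha => Finset.mem_filter.mpr ⟨Finset.mem_univ _, hDleaf a ha⟩
    have h3 := Finset.card_sdiff_add_card_eq_card hDB
    have h4 := h.cnt
    have h5 : {z | z ∈ Set.univ ∧ c z = z}.ncard = (Finset.univ.filter fun w => c w = w).card := by
      rw [← Set.ncard_coe_finset]
      congr 1
      ext w; simp
    have h6 := Finset.card_filter_add_card_filter_not (s := (Finset.univ : Finset V)) (fun w => c w = w)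
    rw [Finset.card_univ] at h6
    change _ + B.card = _ at h6
    omega
  have hTtree : T.IsTree := by
    rw [isTree_iff_connected_and_card]
    refine ⟨hTconn, ?_⟩
    have h1 := hTconn.card_vert_le_card_edgeSet_add_one
    rw [Nat.card_coe_set_eq, Nat.card_eq_fintype_card] at h1
    rw [Nat.card_coe_set_eq, Nat.card_eq_fintype_card]
    omega
  have hdeg3 : ∀ (a : V) (s : Finset V), 3 ≤ s.card → (∀ w ∈ s, T.Adj a w) → gdeg T a ≠ 2 := by
    intro a s hs hsa
    have : s.card ≤ gdeg T a := by
      rw [gdeg, Nat.card_coe_set_eq, ← Set.ncard_coe_finset]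
      exact Set.ncard_le_ncard (fun w hw => hsa w hw) (Set.toFinite _)
    omega
  have hcenter : ∀ z, c z = z → gdeg T z ≠ 2 := by
    intro z hz
    refine hdeg3 z _ (hkeep z hz) fun w hw => ?_
    obtain ⟨h1, h2⟩ := Finset.mem_sdiff.mp hw
    obtain ⟨-, h3, h4⟩ := Finset.mem_filter.mp h1
    exact Or.inr (Or.inr ⟨h3, h4, h2⟩)
  have hheavy : ∀ a b x, c a ≠ a → L.Adj a b → L.Adj a x → x ≠ b → gdeg T a ≠ 2 := by
    intro a b x hc hab hax hne
    have haD : a ∉ D := fun haD => hne (hDone a haD _ _ hax hab)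
    have hbc : ∀ y, L.Adj a y → c a ≠ y := fun y hy e =>
      h.diff a y hy (by rw [← e, hcc])
    refine hdeg3 a {c a, b, x} ?_ ?_
    · rw [Finset.card_eq_three.mpr ⟨c a, b, x, hbc b hab, hbc x hax, hne.symm, rfl⟩]
    · intro w hw
      simp only [Finset.mem_insert, Finset.mem_singleton] at hw
      rcases hw with rfl | rfl | rfl
      · exact Or.inr (Or.inl ⟨rfl, fun e => hc e.symm, haD⟩)
      · exact Or.inl hab
      · exact Or.inl hax
  refine ⟨T, ?_, hTtree, ?_⟩
  · intro a b hab
    rcases hab with h1 | ⟨h1, h2, -⟩ | ⟨h1, h2, -⟩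
    · exact h.le _ _ h1
    · rw [← h1] at h2 ⊢; exact (hca a h2).symm
    · rw [← h1] at h2 ⊢; exact hca b h2
  · rintro a b hab ⟨ha2, hb2⟩
    have hca' : c a ≠ a := fun e => hcenter a e ha2
    have hcb' : c b ≠ b := fun e => hcenter b e hb2
    rcases hab with h1 | ⟨h1, -, -⟩ | ⟨h1, -, -⟩
    · rcases hg a b h1 hca' hcb' with ⟨x, hx, hax⟩ | ⟨y, hy, hby⟩
      · exact hheavy a b x hca' h1 hax hx ha2
      · exact hheavy b a y hcb' h1.symm hby hy hb2
    · exact hcb' (by rw [← h1, hcc])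
    · exact hca' (by rw [← h1, hcc])
end

section
/- Every finite simple connected graph G has a spanning tree T such that there is no path of length 2 in T all of whose three vertices have degree 2 in T and degree at least 3 in G. -/
open SimpleGraph

/-- Adding to `F` all edges from `v` to `X`. -/
def addStar {V : Type} (F : SimpleGraph V) (v : V) (X : Set V) : SimpleGraph V where
  Adj a b := F.Adj a b ∨ (a ≠ b ∧ ((a = v ∧ b ∈ X) ∨ (b = v ∧ a ∈ X)))
  symm := ⟨by
    intro a b h
    rcases h with h | ⟨h, h2⟩
    · exact Or.inl h.symm
    · exact Or.inr ⟨h.symm, h2.symm⟩⟩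
  loopless := ⟨by
    intro a h
    rcases h with h | ⟨h, _⟩
    · exact F.loopless.irrefl a h
    · exact h rfl⟩

/-- Deleting all edges at `u`. -/
def delV {V : Type} (F : SimpleGraph V) (u : V) : SimpleGraph V where
  Adj a b := F.Adj a b ∧ a ≠ u ∧ b ≠ u
  symm := ⟨by
    intro a b h
    exact ⟨h.1.symm, h.2.2, h.2.1⟩⟩
  loopless := ⟨by
    intro a h
    exact F.loopless.irrefl a h.1⟩

lemma addStar_adj {V : Type} (F : SimpleGraph V) (v : V) (X : Set V) (a b : V) :
    (addStar F v X).Adj a b ↔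
      F.Adj a b ∨ (a ≠ b ∧ ((a = v ∧ b ∈ X) ∨ (b = v ∧ a ∈ X))) := Iff.rfl

lemma delV_adj {V : Type} (F : SimpleGraph V) (u a b : V) :
    (delV F u).Adj a b ↔ F.Adj a b ∧ a ≠ u ∧ b ≠ u := Iff.rfl

/-- `F` is a subtree of `G` with vertex set `W`. -/
structure IsT {V : Type} (G : SimpleGraph V) (W : Set V) (F : SimpleGraph V) : Prop where
  sub : ∀ x y, F.Adj x y → G.Adj x y
  supp : ∀ x y, F.Adj x y → x ∈ W
  conn : ∀ x ∈ W, ∀ y ∈ W, F.Reachable x y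
  acyc : F.IsAcyclic

lemma closed_reach {V : Type} {F : SimpleGraph V} (S : Set V)
    (hS : ∀ x ∈ S, ∀ y, F.Adj x y → y ∈ S) {x y : V} (hx : x ∈ S) (h : F.Reachable x y) :
    y ∈ S := by
  obtain ⟨p⟩ := h
  induction p with
  | nil => exact hx
  | cons hadj _ ih => exact ih (hS _ hx _ hadj)

lemma IsT.leaf {V : Type} {G : SimpleGraph V} {W : Set V} {F : SimpleGraph V}
    (h : IsT G W F) {v x : V} (hv : v ∈ W) (hx : x ∉ W) (hG : G.Adj v x) :
    IsT G (insert x W) (F ⊔ edge v x) := by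
  have hle : F ≤ F ⊔ edge v x := le_sup_left
  have hvx : (F ⊔ edge v x).Adj v x := by
    simp [edge_adj, hG.ne]
  have key : ∀ y ∈ insert x W, (F ⊔ edge v x).Reachable v y := by
    intro y hy
    rcases hy with rfl | hy
    · exact hvx.reachable
    · exact (h.conn v hv y hy).mono hle
  refine ⟨?_, ?_, ?_, ?_⟩
  · intro a b hab
    rw [sup_adj, edge_adj] at hab
    rcases hab with hab | ⟨⟨rfl, rfl⟩ | ⟨rfl, rfl⟩, _⟩
    · exact h.sub _ _ hab
    · exact hG
    · exact hG.symm
  · intro a b hab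
    rw [sup_adj, edge_adj] at hab
    rcases hab with hab | ⟨⟨rfl, rfl⟩ | ⟨rfl, rfl⟩, _⟩
    · exact Or.inr (h.supp _ _ hab)
    · exact Or.inr hv
    · exact Or.inl rfl
  · intro a ha b hb
    exact (key a ha).symm.trans (key b hb)
  · have hnr : ¬ F.Reachable v x := by
      intro hr
      exact hx (closed_reach W (fun a _ b hab => h.supp _ _ hab.symm) hv hr)
    exact h.acyc.sup_edge_of_not_reachable hnr

lemma IsT.star {V : Type} [Fintype V] {G : SimpleGraph V} {W : Set V} {F : SimpleGraph V}
    (h : IsT G W F) {v : V} (hv : v ∈ W) (X : Set V) (hX : ∀ x ∈ X, x ∉ W ∧ G.Adj v x) :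
    IsT G (W ∪ X) (addStar F v X) := by
  classical
  have hfin : X.Finite := Set.toFinite X
  induction X, hfin using Set.Finite.induction_on with
  | empty =>
    have : addStar F v ∅ = F := by
      ext a b
      simp [addStar_adj]
    rw [this, Set.union_empty]
    exact h
  | @insert x X hxX _ ih =>
    have h1 := ih (fun y hy => hX y (Set.mem_insert_of_mem _ hy))
    have hx := hX x (Set.mem_insert _ _)
    have h2 := h1.leaf (v := v) (x := x) (Or.inl hv) (by
      rintro (h' | h')
      · exact hx.1 h'
      · exact hxX h') hx.2
    have e1 : W ∪ insert x X = insert x (W ∪ X) := Set.union_insert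
    have e2 : addStar F v (insert x X) = addStar F v X ⊔ edge v x := by
      ext a b
      simp only [addStar_adj, sup_adj, edge_adj, Set.mem_insert_iff]
      tauto
    rw [e1, e2]
    exact h2

lemma IsT.del {V : Type} {G : SimpleGraph V} {W : Set V} {F : SimpleGraph V}
    (h : IsT G W F) {u v : V} (huv : u ≠ v) (hu : ∀ y, F.Adj u y → y = v) :
    IsT G (W \ {u}) (delV F u) := by
  classical
  refine ⟨fun x y hxy => h.sub _ _ hxy.1, fun x y hxy => ⟨h.supp _ _ hxy.1, hxy.2.1⟩, ?_, ?_⟩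
  · have key : ∀ x y, F.Walk x y →
        (delV F u).Reachable (if x = u then v else x) (if y = u then v else y) := by
      intro x y p
      induction p with
      | nil => exact Reachable.refl _
      | @cons a b c hab _ ih =>
        refine Reachable.trans ?_ ih
        by_cases ha : a = u
        · subst ha
          have := hu b hab
          subst this
          simp [huv.symm]
        · by_cases hb : b = u
          · subst hb
            have := hu a hab.symm
            subst this
            simp [ha]
          · simp only [ha, hb, if_false]
            exact Adj.reachable (G := delV F u) ⟨hab, ha, hb⟩
    intro x hx y hy
    obtain ⟨p⟩ := h.conn x hx.1 y hy.1
    have := key x y p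
    have hx2 : x ≠ u := hx.2
    have hy2 : y ≠ u := hy.2
    simpa [hx2, hy2] using this
  · exact h.acyc.anti (fun x y hxy => hxy.1)

/-- Bad vertices. -/
def Bd {V : Type} (G F : SimpleGraph V) (x : V) : Prop := gdeg F x = 2 ∧ 3 ≤ gdeg G x

/-- Neighbours of `v` outside `W`. -/
def outN {V : Type} (G : SimpleGraph V) (W : Set V) (v : V) : Set V := {y | y ∉ W ∧ G.Adj v y}

/-- The invariant, ignoring the vertex `l`. -/
structure InvEx {V : Type} (G : SimpleGraph V) (l : V) (W : Set V) (F : SimpleGraph V) :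
    Prop where
  tree : IsT G W F
  clos : ∀ x ∈ W, x ≠ l → (outN G W x).Nonempty → gdeg F x ≤ 1
  trip : ∀ a b c, a ≠ l → b ≠ l → c ≠ l → a ≠ c → F.Adj a b → F.Adj b c →
    Bd G F a → Bd G F b → Bd G F c → False
  run : ∀ x ∈ W, x ≠ l → (outN G W x).Nonempty → ∀ b c, b ≠ l → c ≠ l → c ≠ x →
    F.Adj x b → F.Adj b c → Bd G F b → Bd G F c → False

/-- The invariant. -/
structure GInv {V : Type} (G : SimpleGraph V) (r : V) (W : Set V) (F : SimpleGraph V) :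
    Prop where
  tree : IsT G W F
  root : r ∈ W
  rdeg : 3 ≤ gdeg F r
  clos : ∀ x ∈ W, (outN G W x).Nonempty → gdeg F x ≤ 1
  trip : ∀ a b c, a ≠ c → F.Adj a b → F.Adj b c →
    Bd G F a → Bd G F b → Bd G F c → False
  run : ∀ x ∈ W, (outN G W x).Nonempty → ∀ b c, c ≠ x →
    F.Adj x b → F.Adj b c → Bd G F b → Bd G F c → False

lemma GInv.toEx {V : Type} {G : SimpleGraph V} {r : V} {W : Set V} {F : SimpleGraph V}
    (h : GInv G r W F) (l : V) : InvEx G l W F :=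
  ⟨h.tree, fun x hx _ => h.clos x hx, fun a b c _ _ _ => h.trip a b c,
    fun x hx _ ho b c _ _ => h.run x hx ho b c⟩

lemma gdeg_congr {V : Type} {F F' : SimpleGraph V} {x : V}
    (h : ∀ y, F.Adj x y ↔ F'.Adj x y) : gdeg F x = gdeg F' x := by
  have : F.neighborSet x = F'.neighborSet x := by
    ext y
    exact h y
  unfold gdeg
  rw [this]

lemma gdeg_mono {V : Type} [Fintype V] {F F' : SimpleGraph V} {x : V}
    (h : ∀ y, F.Adj x y → F'.Adj x y) : gdeg F x ≤ gdeg F' x :=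
  Set.ncard_le_ncard (s := F.neighborSet x) (t := F'.neighborSet x) h (Set.toFinite _)

lemma gdeg_le_one {V : Type} [Fintype V] {F : SimpleGraph V} {x v : V}
    (h : ∀ y, F.Adj x y → y = v) : gdeg F x ≤ 1 := by
  have h1 : F.neighborSet x ⊆ {v} := fun y hy => h y hy
  have := Set.ncard_le_ncard h1 (Set.toFinite _)
  rw [Set.ncard_singleton] at this
  exact this

lemma uniq_of_le_one {V : Type} [Fintype V] {F : SimpleGraph V} {x v y : V}
    (h : gdeg F x ≤ 1) (hv : F.Adj x v) (hy : F.Adj x y) : y = v :=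
  (Set.ncard_le_one (s := F.neighborSet x) (Set.toFinite _)).1 h y hy v hv

lemma two_of_le_two {V : Type} [Fintype V] {F : SimpleGraph V} {x v w y : V}
    (h : gdeg F x ≤ 2) (hvw : v ≠ w) (hv : F.Adj x v) (hw : F.Adj x w) (hy : F.Adj x y) :
    y = v ∨ y = w := by
  by_contra hc
  push Not at hc
  have h1 : ({y, v, w} : Set V) ⊆ F.neighborSet x := by
    rintro z (rfl | rfl | rfl) <;> assumption
  have h2 := Set.ncard_le_ncard h1 (Set.toFinite _)
  have h3 : ({y, v, w} : Set V).ncard = 3 :=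
    Set.ncard_eq_three.2 ⟨y, v, w, hc.1, hc.2, hvw, rfl⟩
  have h4 : (F.neighborSet x).ncard ≤ 2 := h
  omega

lemma three_le_gdeg {V : Type} [Fintype V] {F : SimpleGraph V} {x v w y : V}
    (hvw : v ≠ w) (hyv : y ≠ v) (hyw : y ≠ w)
    (hv : F.Adj x v) (hw : F.Adj x w) (hy : F.Adj x y) : 3 ≤ gdeg F x := by
  by_contra hc
  rcases two_of_le_two (by omega) hvw hv hw hy with h | h
  · exact hyv h
  · exact hyw h

/-- No path component on three vertices. -/
lemma GInv.no_path {V : Type} [Fintype V] {G : SimpleGraph V} {r : V} {W : Set V}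
    {F : SimpleGraph V} (h : GInv G r W F) {x v u : V} (hxu : x ≠ u) (hx : gdeg F x ≤ 1)
    (hu : gdeg F u ≤ 1) (hv : gdeg F v ≤ 2) (hxv : F.Adj x v) (hvu : F.Adj v u) : False := by
  have hr : r ∈ ({x, v, u} : Set V) := by
    refine closed_reach (F := F) {x, v, u} ?_ (x := x) (by simp)
      (h.tree.conn x (h.tree.supp _ _ hxv) r h.root)
    rintro a (rfl | rfl | rfl) y hy
    · rw [uniq_of_le_one hx hxv hy]; simp
    · rcases two_of_le_two hv hxu hxv.symm hvu hy with rfl | rfl <;> simp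
    · rw [uniq_of_le_one hu hvu.symm hy]; simp
  have := h.rdeg
  rcases hr with rfl | rfl | rfl <;> omega

lemma expand {V : Type} [Fintype V] {G : SimpleGraph V} {r l : V} {W : Set V}
    {F : SimpleGraph V} (h : InvEx G l W F) (hl : l ∈ W) (hr : r ∈ W)
    (hd : 3 ≤ gdeg (addStar F l (outN G W l)) r)
    (hc : ¬ Bd G (addStar F l (outN G W l)) l ∨ ∀ b, F.Adj l b → ¬ Bd G F b) :
    GInv G r (W ∪ outN G W l) (addStar F l (outN G W l)) := by
  set X := outN G W l with hX
  set F' := addStar F l X with hF'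
  have hXW : ∀ x ∈ X, x ∉ W := fun x hx => hx.1
  have hlX : l ∉ X := fun hx => hx.1 hl
  have hold : ∀ a b, a ≠ l → b ≠ l → (F'.Adj a b ↔ F.Adj a b) := by
    intro a b ha hb
    simp [hF', addStar_adj, ha, hb]
  have holdW : ∀ a, a ∈ W → a ≠ l → ∀ b, (F'.Adj a b ↔ F.Adj a b) := by
    intro a ha hal b
    have : a ∉ X := fun hx => hx.1 ha
    simp [hF', addStar_adj, hal, this]
  have hdeg : ∀ a, a ∈ W → a ≠ l → gdeg F' a = gdeg F a := fun a ha hal =>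
    gdeg_congr (holdW a ha hal)
  have hXadj : ∀ x ∈ X, ∀ b, F'.Adj x b → b = l := by
    intro x hx b hxb
    rcases hxb with hxb | ⟨_, ⟨rfl, _⟩ | ⟨hb, _⟩⟩
    · exact absurd (h.tree.supp _ _ hxb) hx.1
    · exact absurd hx hlX
    · exact hb
  have hXdeg : ∀ x ∈ X, gdeg F' x ≤ 1 := fun x hx => gdeg_le_one (hXadj x hx)
  have hBX : ∀ x ∈ X, ¬ Bd G F' x := by
    intro x hx hB
    have := hXdeg x hx
    have := hB.1
    omega
  have htree : IsT G (W ∪ X) F' := h.tree.star hl X (fun x hx => hx)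
  have hmem : ∀ a b, F'.Adj a b → a ∈ W ∨ a ∈ X := fun a b hab => htree.supp _ _ hab
  have hBold : ∀ a, a ≠ l → (a ∈ W ∨ a ∈ X) → Bd G F' a → Bd G F a := by
    intro a hal ha hB
    rcases ha with ha | ha
    · exact ⟨(hdeg a ha hal) ▸ hB.1, hB.2⟩
    · exact absurd hB (hBX a ha)
  -- no two adjacent bad vertices one of which is `l`
  have hno : ∀ b, F'.Adj l b → Bd G F' l → Bd G F' b → False := by
    intro b hlb hBl hBb
    rcases hc with hc | hc
    · exact hc hBl
    · rcases hmem b l hlb.symm with hb | hb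
      · have hbl : b ≠ l := hlb.ne'
        exact hc b ((holdW b hb hbl l).1 hlb.symm).symm (hBold b hbl (Or.inl hb) hBb)
      · exact hBX b hb hBb
  have hact : ∀ x ∈ W, (outN G (W ∪ X) x).Nonempty → (outN G W x).Nonempty := by
    rintro x _ ⟨y, hy1, hy2⟩
    exact ⟨y, fun hy => hy1 (Or.inl hy), hy2⟩
  have hlin : ¬ (outN G (W ∪ X) l).Nonempty := by
    rintro ⟨y, hy1, hy2⟩
    exact hy1 (Or.inr ⟨fun hy => hy1 (Or.inl hy), hy2⟩)
  refine ⟨htree, Or.inl hr, hd, ?_, ?_, ?_⟩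
  · rintro x (hx | hx) ho
    · have hxl : x ≠ l := by
        rintro rfl
        exact hlin ho
      rw [hdeg x hx hxl]
      exact h.clos x hx hxl (hact x hx ho)
    · exact hXdeg x hx
  · intro a b c hac hab hbc ha hb hcB
    by_cases hal : a = l
    · subst hal
      exact hno b hab ha hb
    by_cases hbl : b = l
    · subst hbl
      exact hno c hbc hb hcB
    by_cases hcl : c = l
    · subst hcl
      exact hno b hbc.symm hcB hb
    exact h.trip a b c hal hbl hcl hac ((hold a b hal hbl).1 hab) ((hold b c hbl hcl).1 hbc)
      (hBold a hal (hmem _ _ hab) ha) (hBold b hbl (hmem _ _ hbc) hb)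
      (hBold c hcl (hmem _ _ hbc.symm) hcB)
  · intro x hx ho b c hcx hxb hbc hb hcB
    by_cases hbl : b = l
    · subst hbl
      exact hno c hbc hb hcB
    by_cases hcl : c = l
    · subst hcl
      exact hno b hbc.symm hcB hb
    have hxl : x ≠ l := by
      rintro rfl
      exact hlin ho
    rcases hx with hx | hx
    · exact h.run x hx hxl (hact x hx ho) b c hbl hcl hcx ((hold x b hxl hbl).1 hxb)
        ((hold b c hbl hcl).1 hbc) (hBold b hbl (hmem _ _ hbc) hb)
        (hBold c hcl (hmem _ _ hbc.symm) hcB)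
    · exact hbl (hXadj x hx b hxb)

/-- The generic verification that the invariant holds away from `w`. -/
lemma exceptW {V : Type} [Fintype V] {G : SimpleGraph V} {r u v w : V} {W : Set V}
    {F F' : SimpleGraph V} (h : GInv G r W F) (huW : u ∈ W)
    (hu : gdeg F u ≤ 1) (huv : F.Adj u v) (hv : Bd G F v) (hout : outN G W u = {w})
    (htree : IsT G (insert w W) F')
    (hadj : ∀ a b, a ≠ w → b ≠ w → F'.Adj a b → F.Adj a b)
    (hdeg : ∀ a ∈ W, a ≠ u → gdeg F a ≤ 1 → gdeg F' a ≤ 1)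
    (hB : ∀ a ∈ W, a ≠ u → Bd G F' a → Bd G F a) :
    InvEx G w (insert w W) F' := by
  have hw : w ∈ outN G W u := by rw [hout]; rfl
  have hact : ∀ x, (outN G (insert w W) x).Nonempty → (outN G W x).Nonempty ∧ x ≠ u := by
    rintro x ⟨y, hy1, hy2⟩
    refine ⟨⟨y, fun hy => hy1 (Or.inr hy), hy2⟩, ?_⟩
    rintro rfl
    have : y ∈ outN G W x := ⟨fun hy => hy1 (Or.inr hy), hy2⟩
    rw [hout] at this
    exact hy1 (Or.inl this)
  have hrunu : ∀ c, c ≠ u → F.Adj v c → Bd G F c → False := fun c hcu hvc hc =>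
    h.run u huW ⟨w, hw⟩ v c hcu huv hvc hv hc
  refine ⟨htree, ?_, ?_, ?_⟩
  · rintro x (hx | hx) hxw ho
    · exact absurd hx hxw
    · obtain ⟨ho1, hxu⟩ := hact x ho
      exact hdeg x hx hxu (h.clos x hx ho1)
  · intro a b c haw hbw hcw hac hab hbc ha hb hc
    have hab := hadj a b haw hbw hab
    have hbc := hadj b c hbw hcw hbc
    have haW := h.tree.supp _ _ hab
    have hbW := h.tree.supp _ _ hbc
    have hcW := h.tree.supp _ _ hbc.symm
    by_cases hbu : b = u
    · subst hbu
      exact hac ((uniq_of_le_one hu huv hab.symm).trans (uniq_of_le_one hu huv hbc).symm)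
    by_cases hau : a = u
    · subst hau
      have := uniq_of_le_one hu huv hab
      subst this
      exact hrunu c (Ne.symm hac) hbc (hB c hcW (Ne.symm hac) hc)
    by_cases hcu : c = u
    · subst hcu
      have := uniq_of_le_one hu huv hbc.symm
      subst this
      exact hrunu a hac hab.symm (hB a haW hac ha)
    exact h.trip a b c hac hab hbc (hB a haW hau ha) (hB b hbW hbu hb) (hB c hcW hcu hc)
  · rintro x (hx | hx) hxw ho b c hbw hcw hcx hxb hbc hb hc
    · exact absurd hx hxw
    obtain ⟨ho1, hxu⟩ := hact x ho
    have hx1 := h.clos x hx ho1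
    have hxb := hadj x b hxw hbw hxb
    have hbc := hadj b c hbw hcw hbc
    have hbW := h.tree.supp _ _ hbc
    have hcW := h.tree.supp _ _ hbc.symm
    by_cases hbu : b = u
    · subst hbu
      have := uniq_of_le_one hu huv hxb.symm
      subst this
      have := hv.1
      omega
    by_cases hcu : c = u
    · subst hcu
      have := uniq_of_le_one hu huv hbc.symm
      subst this
      exact h.no_path hxu hx1 hu hv.1.le hxb hbc
    exact h.run x hx ho1 b c hcx hxb hbc (hB b hbW hbu hb) (hB c hcW hcu hc)

lemma step {V : Type} [Fintype V] {G : SimpleGraph V} {r : V} {W : Set V}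
    {F : SimpleGraph V} (hG : G.Connected) (h : GInv G r W F) (hW : ∃ z, z ∉ W) :
    ∃ W' F', GInv G r W' F' ∧ W ⊂ W' := by
  classical
  by_cases hP : ∃ l ∈ W, (outN G W l).Nonempty ∧
      (¬ Bd G (addStar F l (outN G W l)) l ∨ ∀ b, F.Adj l b → ¬ Bd G F b)
  · obtain ⟨l, hl, ⟨y, hy⟩, hc⟩ := hP
    refine ⟨_, _, expand (h.toEx l) hl h.root
      (h.rdeg.trans (gdeg_mono fun y hy => Or.inl hy)) hc, ?_⟩
    exact ⟨Set.subset_union_left, fun hs => hy.1 (hs (Or.inr hy))⟩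
  push Not at hP
  have hact : ∀ l ∈ W, ∀ w ∈ outN G W l,
      (∃ v, F.Adj l v ∧ Bd G F v) ∧ outN G W l = {w} ∧ gdeg F l ≤ 1 := by
    intro l hl w hw
    obtain ⟨hB, b, hlb, hb⟩ := hP l hl ⟨w, hw⟩
    refine ⟨⟨b, hlb, hb⟩, ?_, h.clos l hl ⟨w, hw⟩⟩
    refine Set.eq_singleton_iff_unique_mem.2 ⟨hw, fun y hy => ?_⟩
    by_contra hne
    have hbW : b ∈ W := h.tree.supp _ _ hlb.symm
    have h3 : 3 ≤ gdeg (addStar F l (outN G W l)) l := by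
      refine three_le_gdeg (v := b) (w := w) (y := y) ?_ ?_ hne (Or.inl hlb)
        (Or.inr ⟨hw.2.ne, Or.inl ⟨rfl, hw⟩⟩) (Or.inr ⟨hy.2.ne, Or.inl ⟨rfl, hy⟩⟩)
      · rintro rfl
        exact hw.1 hbW
      · rintro rfl
        exact hy.1 hbW
    have := hB.1
    omega
  obtain ⟨z, hz⟩ := hW
  obtain ⟨p⟩ := hG.preconnected r z
  obtain ⟨d, -, hd1, hd2⟩ := p.exists_boundary_dart W h.root hz
  obtain ⟨u, w, huW, hwW, huwG⟩ : ∃ u w, u ∈ W ∧ w ∉ W ∧ G.Adj u w :=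
    ⟨d.fst, d.snd, hd1, hd2, d.adj⟩
  obtain ⟨⟨v, huv, hv⟩, hout, hu1⟩ := hact u huW w ⟨hwW, huwG⟩
  have hWne : ∀ a ∈ W, a ≠ w := by
    rintro a ha rfl
    exact hwW ha
  have hss : ∀ X, W ⊂ insert w W ∪ X := fun X =>
    ⟨fun a ha => Or.inl (Or.inr ha), fun hs => hwW (hs (Or.inl (Or.inl rfl)))⟩
  have hF1 : ∀ a ∈ W, a ≠ u → ∀ b, (addStar F u {w}).Adj a b ↔ F.Adj a b := by
    intro a ha hau b
    simp [addStar_adj, hau, hWne a ha]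
  have E1 : InvEx G w (insert w W) (addStar F u {w}) := by
    refine exceptW h huW hu1 huv hv hout ?_ ?_ ?_ ?_
    · have := h.tree.star huW {w} (by
        rintro x rfl
        exact ⟨hwW, huwG⟩)
      rwa [Set.union_singleton] at this
    · intro a b ha hb hab
      simpa [addStar_adj, ha, hb] using hab
    · intro a ha hau hd
      rwa [gdeg_congr (hF1 a ha hau)]
    · intro a ha hau hB
      exact ⟨(gdeg_congr (hF1 a ha hau)) ▸ hB.1, hB.2⟩
  set X2 := outN G (insert w W) w with hX2
  by_cases hB2 : Bd G (addStar (addStar F u {w}) w X2) w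
  swap
  · refine ⟨_, _, expand E1 (Or.inl rfl) (Or.inr h.root)
      (h.rdeg.trans (gdeg_mono fun y hy => Or.inl (Or.inl hy))) (Or.inl hB2), hss _⟩
  have hwu : (addStar F u {w}).Adj w u := Or.inr ⟨huwG.ne', Or.inr ⟨rfl, rfl⟩⟩
  -- the further outside neighbour
  obtain ⟨w2, hw2⟩ : X2.Nonempty := by
    by_contra hne
    rw [Set.not_nonempty_iff_eq_empty] at hne
    have : gdeg (addStar (addStar F u {w}) w X2) w ≤ 1 := by
      refine gdeg_le_one (v := u) fun y hy => ?_
      rw [hne] at hy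
      rcases hy with (hy | ⟨_, ⟨hy, _⟩ | ⟨hy, _⟩⟩) | ⟨_, ⟨_, hy⟩ | ⟨_, hy⟩⟩
      · exact absurd (h.tree.supp _ _ hy) hwW
      · exact absurd hy huwG.ne'
      · exact hy
      · exact absurd hy (Set.notMem_empty _)
      · exact absurd hy (Set.notMem_empty _)
    have := hB2.1
    omega
  -- the further inside neighbour
  obtain ⟨u', hu'W, hu'u, hwu'⟩ : ∃ u' ∈ W, u' ≠ u ∧ G.Adj w u' := by
    by_contra hne
    push Not at hne
    have : gdeg G w ≤ gdeg (addStar (addStar F u {w}) w X2) w := by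
      refine gdeg_mono fun y hy => ?_
      by_cases hyu : y = u
      · subst hyu
        exact Or.inl hwu
      · refine Or.inr ⟨hy.ne, Or.inl ⟨rfl, ?_, hy⟩⟩
        rintro (rfl | hyW)
        · exact hy.ne rfl
        · exact hne y hyW hyu hy
    have h1 := hB2.1
    have h2 := hB2.2
    omega
  obtain ⟨⟨v', hu'v', hv'⟩, -, hu'1⟩ := hact u' hu'W w ⟨hwW, hwu'.symm⟩
  have huniq : ∀ y, F.Adj u' y → y = v' := fun y hy => uniq_of_le_one hu'1 hu'v' hy
  set K := addStar (addStar (delV F u') u {w}) w {u'} with hK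
  have hKtree : IsT G (insert w W) K := by
    have t1 := h.tree.del hu'v'.ne huniq
    have t2 := t1.star (v := u) ⟨huW, Ne.symm hu'u⟩ {w} (by
      rintro x rfl
      exact ⟨fun hx => hwW hx.1, huwG⟩)
    have t3 := t2.star (v := w) (Or.inr rfl) {u'} (by
      rintro x rfl
      refine ⟨?_, hwu'⟩
      rintro (hx | hx)
      · exact hx.2 rfl
      · exact hWne _ hu'W hx)
    have e : (W \ {u'} ∪ {w}) ∪ {u'} = insert w W := by
      ext a
      simp only [Set.mem_union, Set.mem_sdiff, Set.mem_singleton_iff, Set.mem_insert_iff]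
      constructor
      · rintro ((ha | ha) | rfl)
        · exact Or.inr ha.1
        · exact Or.inl ha
        · exact Or.inr hu'W
      · rintro (ha | ha)
        · exact Or.inl (Or.inr ha)
        · by_cases hau : a = u'
          · exact Or.inr hau
          · exact Or.inl (Or.inl ⟨ha, hau⟩)
    rwa [e] at t3
  have hKu' : gdeg K u' ≤ 1 := by
    refine gdeg_le_one (v := w) fun y hy => ?_
    have hne := hWne u' hu'W
    have hy2 : ¬ u' = y ∧ y = w := by
      simpa [hK, addStar_adj, delV_adj, hu'u, hne, hwu'.ne'] using hy
    exact hy2.2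
  have hKadj : ∀ a ∈ W, a ≠ u → a ≠ u' → ∀ b, K.Adj a b ↔ F.Adj a b ∧ b ≠ u' := by
    intro a ha hau hau' b
    have hne := hWne a ha
    simp [hK, addStar_adj, delV_adj, hau, hau', hne]
  have hKadj2 : ∀ a ∈ W, a ≠ u → a ≠ u' → a ≠ v' → ∀ b, K.Adj a b ↔ F.Adj a b := by
    intro a ha hau hau' hav' b
    rw [hKadj a ha hau hau' b]
    refine ⟨fun hb => hb.1, fun hb => ⟨hb, ?_⟩⟩
    rintro rfl
    exact hav' (huniq a hb.symm)
  have E2 : InvEx G w (insert w W) K := by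
    refine exceptW h huW hu1 huv hv hout hKtree ?_ ?_ ?_
    · intro a b ha hb hab
      have : F.Adj a b ∧ ¬ a = u' ∧ ¬ b = u' := by simpa [hK, addStar_adj, delV_adj, ha, hb] using hab
      exact this.1
    · intro a ha hau hd
      by_cases hau' : a = u'
      · rw [hau']
        exact hKu'
      · exact (gdeg_mono fun y hy => ((hKadj a ha hau hau' y).1 hy).1).trans hd
    · intro a ha hau hB
      by_cases hau' : a = u'
      · subst hau'
        have := hB.1
        omega
      by_cases hav' : a = v'
      · rw [hav']
        exact hv'
      exact ⟨(gdeg_congr (hKadj2 a ha hau hau' hav')) ▸ hB.1, hB.2⟩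
  have hru : r ≠ u := by
    rintro rfl
    have := h.rdeg
    omega
  have hru' : r ≠ u' := by
    rintro rfl
    have := h.rdeg
    omega
  have hrv' : r ≠ v' := by
    rintro rfl
    have := h.rdeg
    have := hv'.1
    omega
  refine ⟨_, _, expand (r := r) E2 (Or.inl rfl) (Or.inr h.root)
    (h.rdeg.trans (gdeg_mono fun y hy =>
      Or.inl ((hKadj2 r h.root hru hru' hrv' y).2 hy))) (Or.inl ?_), hss _⟩
  intro hB
  have h3 : 3 ≤ gdeg (addStar K w X2) w := by
    refine three_le_gdeg (v := u) (w := u') (y := w2) (Ne.symm hu'u) ?_ ?_ ?_ ?_ ?_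
    · rintro rfl
      exact hw2.1 (Or.inr huW)
    · rintro rfl
      exact hw2.1 (Or.inr hu'W)
    · exact Or.inl (Or.inl (Or.inr ⟨huwG.ne', Or.inr ⟨rfl, rfl⟩⟩))
    · exact Or.inl (Or.inr ⟨hwu'.ne, Or.inl ⟨rfl, rfl⟩⟩)
    · exact Or.inr ⟨hw2.2.ne, Or.inl ⟨rfl, hw2⟩⟩
  have h2 : gdeg (addStar K w X2) w = 2 := hB.1
  omega

lemma start {V : Type} [Fintype V] {G : SimpleGraph V} {r : V} (hr : 3 ≤ gdeg G r) :
    ∃ W F, GInv G r W F := by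
  have hex : InvEx G r {r} (⊥ : SimpleGraph V) := by
    refine ⟨⟨?_, ?_, ?_, isAcyclic_bot⟩, ?_, ?_, ?_⟩
    · intro x y hxy
      exact absurd hxy (by simp)
    · intro x y hxy
      exact absurd hxy (by simp)
    · rintro x rfl y rfl
      exact Reachable.refl _
    · intro x hx hxr
      exact absurd hx hxr
    · intro a b c _ _ _ _ hab
      exact absurd hab (by simp)
    · intro x hx hxr
      exact absurd hx hxr
  have hd : 3 ≤ gdeg (addStar ⊥ r (outN G {r} r)) r :=
    hr.trans (gdeg_mono fun y hy => Or.inr ⟨hy.ne, Or.inl ⟨rfl, hy.ne', hy⟩⟩)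
  exact ⟨_, _, expand hex rfl rfl hd (Or.inr fun b hb => absurd hb (by simp))⟩

/-- Every finite simple connected graph `G` has a spanning tree `T` such that there is no
path of length 2 in `T` all of whose three vertices have degree 2 in `T` and degree at
least 3 in `G`. -/
theorem stmt_6 (V : Type) [Fintype V] (G : SimpleGraph V) (hconn : G.Connected) :
    ∃ T : SimpleGraph V, T ≤ G ∧ T.IsTree ∧
      ¬∃ a b c : V, a ≠ c ∧ T.Adj a b ∧ T.Adj b c ∧
        gdeg T a = 2 ∧ gdeg T b = 2 ∧ gdeg T c = 2 ∧
        3 ≤ gdeg G a ∧ 3 ≤ gdeg G b ∧ 3 ≤ gdeg G c := by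
  classical
  by_cases hS : ∃ r, 3 ≤ gdeg G r
  swap
  · obtain ⟨T, hle, hT⟩ := hconn.exists_isTree_le
    refine ⟨T, hle, hT, ?_⟩
    rintro ⟨a, b, c, -, -, -, -, -, -, ha, -, -⟩
    exact hS ⟨a, ha⟩
  obtain ⟨r, hr⟩ := hS
  have key : ∀ n : ℕ, ∀ W F, GInv G r W F → (Wᶜ).ncard = n →
      ∃ F', GInv G r Set.univ F' := by
    intro n
    induction n using Nat.strong_induction_on with
    | _ n ih =>
      intro W F h hn
      by_cases hz : ∃ z, z ∉ W
      · obtain ⟨W', F', h', hss⟩ := step hconn h hz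
        refine ih _ ?_ W' F' h' rfl
        rw [← hn]
        exact Set.ncard_lt_ncard (compl_lt_compl_iff_lt.2 hss) (Set.toFinite _)
      · push Not at hz
        have : W = Set.univ := Set.eq_univ_of_forall hz
        subst this
        exact ⟨F, h⟩
  obtain ⟨W, F, h⟩ := start hr
  obtain ⟨T, hT⟩ := key _ W F h rfl
  refine ⟨T, fun x y hxy => hT.tree.sub x y hxy, ⟨?_, hT.tree.acyc⟩, ?_⟩
  · have : Nonempty V := ⟨r⟩
    exact Connected.mk fun x y => hT.tree.conn x (Set.mem_univ _) y (Set.mem_univ _)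
  · rintro ⟨a, b, c, hac, hab, hbc, ha, hb, hc, ha', hb', hc'⟩
    exact hT.trip a b c hac hab hbc ⟨ha, ha'⟩ ⟨hb, hb'⟩ ⟨hc, hc'⟩
end

section
/- Let G be a finite simple connected graph of minimum degree at least 3, and let S be a set of vertices of G containing all vertices of degree greater than 3 (and possibly some vertices of degree 3). Then at least one of the following holds: (C) there exists an induced cycle C of G containing no vertex of S such that G − E(C) is connected; (P) there exists an induced path P of G with both endvertices in S such that G − E(P) is connected; (W) there exists a W_a-configuration or a W_{a,b}-configuration in G whose centre is contained in S. -/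
open SimpleGraph

/-- The vertex set of a `W_a`-configuration with path `p`, centre `v` and connectors `x, y`. -/
def waVerts {V : Type} {n : ℕ} (p : Fin (n + 1) → V) (v x y : V) : Set V :=
  {v, x, y} ∪ Set.range p

/-- The vertex set of a `W_{a,b}`-configuration with paths `p, q`, centre `v` and
connectors `x, y`. -/
def wabVerts {V : Type} {n m : ℕ} (p : Fin (n + 1) → V) (q : Fin (m + 1) → V)
    (v x y : V) : Set V :=
  {v, x, y} ∪ Set.range p ∪ Set.range q

/-- A `W_a`-configuration in `G` (here the path `p` has `n + 1` vertices, so `a = n + 1`):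
an induced subgraph consisting of a path `p 0, …, p n` and three further distinct vertices
`v, x, y` not on the path, such that `v` is adjacent to all vertices of the path and to `x`
and `y`, with edges `x–p 0` and `y–p n`; every vertex of the configuration other than `v`
has degree 3 in `G`; `G` minus the vertices of the configuration is connected; both `x` and
`y` have precisely one neighbour outside the configuration, and no other vertex of the
configuration has a neighbour outside it. `v` is the centre, `x, y` are the connectors. -/
def IsWaConfig {V : Type} [Fintype V] (G : SimpleGraph V) (n : ℕ)
    (p : Fin (n + 1) → V) (v x y : V) : Prop :=
  Function.Injective p ∧
  v ∉ Set.range p ∧ x ∉ Set.range p ∧ y ∉ Set.range p ∧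
  v ≠ x ∧ v ≠ y ∧ x ≠ y ∧
  (∀ i : Fin n, G.Adj (p i.castSucc) (p i.succ)) ∧
  (∀ i, G.Adj v (p i)) ∧ G.Adj v x ∧ G.Adj v y ∧
  G.Adj x (p 0) ∧ G.Adj y (p (Fin.last n)) ∧
  (∀ z ∈ waVerts p v x y, z ≠ v → gdeg G z = 3) ∧
  (G.induce (waVerts p v x y)ᶜ).Connected ∧
  (∃! w, w ∉ waVerts p v x y ∧ G.Adj x w) ∧
  (∃! w, w ∉ waVerts p v x y ∧ G.Adj y w) ∧
  (∀ z ∈ waVerts p v x y, z ≠ x → z ≠ y →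
    ∀ w, w ∉ waVerts p v x y → ¬G.Adj z w)

/-- A `W_{a,b}`-configuration in `G` (the paths `p` and `q` have `n + 1` and `m + 1`
vertices respectively, so `a = n + 1`, `b = m + 1`): an induced subgraph consisting of two
disjoint paths `p 0, …, p n` and `q 0, …, q m` and three further distinct vertices
`v, x, y` not on the paths, such that `v` is adjacent to all vertices of both paths, with
edges `x–p 0`, `x–q 0`, `y–p n` and `y–q m`; every vertex of the configuration other than
`v` has degree 3 in `G`; `G` minus the vertices of the configuration is connected; both `x`
and `y` have precisely one neighbour outside the configuration, and no other vertex of the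
configuration has a neighbour outside it. `v` is the centre, `x, y` are the connectors. -/
def IsWabConfig {V : Type} [Fintype V] (G : SimpleGraph V) (n m : ℕ)
    (p : Fin (n + 1) → V) (q : Fin (m + 1) → V) (v x y : V) : Prop :=
  Function.Injective p ∧ Function.Injective q ∧
  Disjoint (Set.range p) (Set.range q) ∧
  v ∉ Set.range p ∧ x ∉ Set.range p ∧ y ∉ Set.range p ∧
  v ∉ Set.range q ∧ x ∉ Set.range q ∧ y ∉ Set.range q ∧
  v ≠ x ∧ v ≠ y ∧ x ≠ y ∧
  (∀ i : Fin n, G.Adj (p i.castSucc) (p i.succ)) ∧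
  (∀ i : Fin m, G.Adj (q i.castSucc) (q i.succ)) ∧
  (∀ i, G.Adj v (p i)) ∧ (∀ i, G.Adj v (q i)) ∧
  G.Adj x (p 0) ∧ G.Adj x (q 0) ∧
  G.Adj y (p (Fin.last n)) ∧ G.Adj y (q (Fin.last m)) ∧
  (∀ z ∈ wabVerts p q v x y, z ≠ v → gdeg G z = 3) ∧
  (G.induce (wabVerts p q v x y)ᶜ).Connected ∧
  (∃! w, w ∉ wabVerts p q v x y ∧ G.Adj x w) ∧
  (∃! w, w ∉ wabVerts p q v x y ∧ G.Adj y w) ∧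
  (∀ z ∈ wabVerts p q v x y, z ≠ x → z ≠ y →
    ∀ w, w ∉ wabVerts p q v x y → ¬G.Adj z w)

/-! ### Restriction of a graph to a vertex set -/

/-- The graph `G` restricted to edges inside `W`. -/
def res {V : Type} (G : SimpleGraph V) (W : Set V) : SimpleGraph V where
  Adj x y := G.Adj x y ∧ x ∈ W ∧ y ∈ W
  symm := ⟨fun _ _ h => ⟨h.1.symm, h.2.2, h.2.1⟩⟩
  loopless := ⟨fun _ h => G.loopless.irrefl _ h.1⟩

/-- `W` induces a connected (or empty) graph. -/
def Cn {V : Type} (G : SimpleGraph V) (W : Set V) : Prop :=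
  ∀ x ∈ W, ∀ y ∈ W, (res G W).Reachable x y

/-- component of `x` in `W`. -/
def comp {V : Type} (G : SimpleGraph V) (W : Set V) (x : V) : Set V :=
  {y | (res G W).Reachable x y}

/-- At most one edge leaves `Y`. -/
def Cut1 {V : Type} (G : SimpleGraph V) (Y : Set V) : Prop :=
  ∀ x ∈ Y, ∀ y, y ∉ Y → ∀ x' ∈ Y, ∀ y', y' ∉ Y → G.Adj x y → G.Adj x' y' → x = x' ∧ y = y'

/-- number of neighbours in `W`. -/
noncomputable def dg {V : Type} (G : SimpleGraph V) (W : Set V) (v : V) : ℕ :=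
  (G.neighborSet v ∩ W).ncard

section basics
variable {V : Type} {G H H' : SimpleGraph V} {W W' K L : Set V} {x y z u v w : V}

theorem reach_closed (h : H.Reachable x y) (Z : Set V) (hx : x ∈ Z)
    (hZ : ∀ u v, u ∈ Z → H.Adj u v → v ∈ Z) : y ∈ Z := by
  obtain ⟨p⟩ := h
  induction p with
  | nil => exact hx
  | cons hadj p ih => exact ih (hZ _ _ hx hadj)

theorem reach_trans (h : ∀ u v, H.Adj u v → H'.Reachable u v) (hr : H.Reachable x y) :
    H'.Reachable x y :=
  reach_closed hr {y | H'.Reachable x y} (Reachable.refl _)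
    (fun u v hu hv => Reachable.trans hu (h u v hv))

theorem res_mono (h : W ⊆ W') : res G W ≤ res G W' :=
  fun _ _ hab => ⟨hab.1, h hab.2.1, h hab.2.2⟩

theorem res_le : res G W ≤ G := fun _ _ hab => hab.1

theorem reach_mono (h : W ⊆ W') (hr : (res G W).Reachable x y) : (res G W').Reachable x y :=
  hr.mono (res_mono h)

theorem reach_mem (hr : (res G W).Reachable x y) (hx : x ∈ W) : y ∈ W :=
  reach_closed hr W hx (fun _ _ _ h => h.2.2)

theorem res_adj_reach (h : G.Adj x y) (hx : x ∈ W) (hy : y ∈ W) : (res G W).Reachable x y :=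
  Adj.reachable (G := res G W) ⟨h, hx, hy⟩

theorem reach_sub (hr : (res G W).Reachable x y)
    (h : ∀ z, (res G W).Reachable x z → z ∈ W') : (res G W').Reachable x y := by
  have : y ∈ {y | (res G W).Reachable x y ∧ (res G W').Reachable x y} := by
    refine reach_closed hr _ ⟨Reachable.refl _, Reachable.refl _⟩ ?_
    rintro u v ⟨h1, h2⟩ h3
    have h4 : (res G W).Reachable x v := h1.trans h3.reachable
    exact ⟨h4, h2.trans (res_adj_reach h3.1 (h _ h1) (h _ h4))⟩
  exact this.2

theorem reach_comp (hr : (res G W).Reachable x y) : (res G (comp G W x)).Reachable x y :=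
  reach_sub hr (fun _ h => h)

theorem mem_comp_self : x ∈ comp G W x := Reachable.refl _

theorem comp_subset (hx : x ∈ W) : comp G W x ⊆ W := fun _ h => reach_mem h hx

theorem comp_con : Cn G (comp G W x) := fun _ ha _ hb => (reach_comp ha).symm.trans (reach_comp hb)

theorem comp_adj (hx : x ∈ W) (hu : u ∈ comp G W x) (hv : v ∈ W) (h : G.Adj u v) :
    v ∈ comp G W x :=
  Reachable.trans hu (res_adj_reach h (comp_subset hx hu) hv)

theorem con_union (hK : Cn G K) (hL : Cn G L) (hu : u ∈ K) (hv : v ∈ L) (h : G.Adj u v) :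
    Cn G (K ∪ L) := by
  have key : ∀ a ∈ K ∪ L, (res G (K ∪ L)).Reachable u a := by
    rintro a (ha | ha)
    · exact reach_mono Set.subset_union_left (hK u hu a ha)
    · exact (res_adj_reach h (Or.inl hu) (Or.inr hv)).trans
        (reach_mono Set.subset_union_right (hL v hv a ha))
  exact fun a ha b hb => (key a ha).symm.trans (key b hb)

theorem con_singleton : Cn G {x} := by
  rintro a rfl b rfl; exact Reachable.refl _

theorem con_insert (hK : Cn G K) (hu : u ∈ K) (h : G.Adj v u) : Cn G (insert v K) := by
  have := con_union hK (con_singleton (x := v)) hu rfl h.symm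
  rwa [Set.union_comm] at this

theorem first_step (hr : (res G W).Reachable v w) (hne : w ≠ v) :
    ∃ y, G.Adj v y ∧ y ∈ W ∧ v ∈ W ∧ (res G (W \ {v})).Reachable y w := by
  have : w ∈ {w | w = v ∨ ∃ y, G.Adj v y ∧ y ∈ W ∧ v ∈ W ∧ (res G (W \ {v})).Reachable y w} := by
    refine reach_closed hr _ (Or.inl rfl) ?_
    rintro a b ha hab
    by_cases hb : b = v
    · exact Or.inl hb
    · right
      rcases ha with rfl | ⟨y, h1, h2, h2', h3⟩
      · exact ⟨b, hab.1, hab.2.2, hab.2.1, Reachable.refl _⟩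
      · refine ⟨y, h1, h2, h2', h3.trans (res_adj_reach hab.1 (reach_mem h3 ⟨h2, ?_⟩) ⟨hab.2.2, hb⟩)⟩
        exact h1.ne'
  rcases this with h | h
  · exact absurd h hne
  · exact h

theorem reach_avoid (hr : (res G W).Reachable x y) (hv : ¬ (res G W).Reachable v x)
    (hx : x ∈ W) : (res G (W \ {v})).Reachable x y :=
  reach_sub hr (fun z hz => ⟨reach_mem hz hx, by rintro rfl; exact hv hz.symm⟩)

/-- A boundary edge. -/
theorem boundary (hr : H.Reachable x y) (Z : Set V) (hx : x ∈ Z) (hy : y ∉ Z) :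
    ∃ a ∈ Z, ∃ b, b ∉ Z ∧ H.Adj a b := by
  by_contra hcon
  push Not at hcon
  exact hy (reach_closed hr Z hx (fun u v hu huv => by
    by_contra hv
    exact hcon u hu v hv huv))

theorem con_of_connected (h : G.Connected) : Cn G Set.univ := by
  intro x _ y _
  exact reach_trans (fun u v huv => res_adj_reach huv trivial trivial) (h.preconnected x y)

theorem not_acyclic_of (h : H.Adj x y) (hr : (H.deleteEdges {s(x,y)}).Reachable x y) :
    ¬ H.IsAcyclic := by
  intro hac
  have := isAcyclic_iff_forall_adj_isBridge.1 hac h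
  rw [isBridge_iff] at this
  exact this hr

/-- An edge with both ends in `W` and endpoints connected avoiding it. -/
theorem not_acyclic_of_two (h1 : G.Adj v x) (h2 : G.Adj v y) (hxy : x ≠ y)
    (hv : v ∈ W) (hx : x ∈ W) (hy : y ∈ W)
    (hr : (res G (W \ {v})).Reachable x y) : ¬ (res G W).IsAcyclic := by
  refine not_acyclic_of (x := v) (y := x) ⟨h1, hv, hx⟩ ?_
  have e1 : ((res G W).deleteEdges {s(v,x)}).Adj v y := by
    rw [deleteEdges_adj]
    refine ⟨⟨h2, hv, hy⟩, ?_⟩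
    simp only [Set.mem_singleton_iff, Sym2.eq_iff]
    rintro (⟨_, h⟩ | ⟨h, h'⟩)
    · exact hxy h.symm
    · exact h1.ne h
  refine e1.reachable.trans (Reachable.symm ?_)
  refine hr.mono ?_
  intro a b hab
  rw [deleteEdges_adj]
  refine ⟨⟨hab.1, hab.2.1.1, hab.2.2.1⟩, ?_⟩
  simp only [Set.mem_singleton_iff, Sym2.eq_iff]
  rintro (⟨h, _⟩ | ⟨_, h⟩)
  · exact hab.2.1.2 h
  · exact hab.2.2.2 h

end basics

section counting
variable {V : Type} [Fintype V] {G : SimpleGraph V}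

theorem exists_leaf {W : Set V} (hne : W.Nonempty) (hac : (res G W).IsAcyclic) :
    ∃ v ∈ W, dg G W v ≤ 1 := by
  classical
  let P : ℕ → Prop := fun n => ∃ u ∈ W, ∃ v, ∃ p : (res G W).Walk u v, p.IsPath ∧ p.length = n
  obtain ⟨w, hw⟩ := hne
  have h0 : P 0 := ⟨w, hw, w, Walk.nil, Walk.IsPath.nil, rfl⟩
  have hspec := Nat.findGreatest_spec (P := P) (Nat.zero_le (Fintype.card V)) h0
  obtain ⟨u, hu, v, p, hp, hl⟩ := hspec
  refine ⟨u, hu, ?_⟩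
  have hsub : G.neighborSet u ∩ W ⊆ {p.snd} := by
    rintro y ⟨hy1, hy2⟩
    have hadj : (res G W).Adj u y := ⟨hy1, hu, hy2⟩
    by_cases hyp : y ∈ p.support
    · exact hac.eq_snd_of_adj_start hp hadj hyp
    · exfalso
      have hq : (Walk.cons hadj.symm p).IsPath := hp.cons hyp
      have hP : P (Nat.findGreatest P (Fintype.card V) + 1) :=
        ⟨y, hy2, v, _, hq, by rw [Walk.length_cons, hl]⟩
      have hle := hq.length_lt
      rw [Walk.length_cons, hl] at hle
      have := Nat.le_findGreatest (P := P) hle.le hP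
      omega
  calc dg G W u ≤ ({p.snd} : Set V).ncard := Set.ncard_le_ncard hsub (Set.toFinite _)
    _ = 1 := Set.ncard_singleton _

theorem not_acyclic_of_deg {W : Set V} (hne : W.Nonempty) (h : ∀ v ∈ W, 2 ≤ dg G W v) :
    ¬ (res G W).IsAcyclic := by
  intro hac
  obtain ⟨v, hv, h1⟩ := exists_leaf hne hac
  have := h v hv
  omega

open Classical in
theorem sum_erase (W : Finset V) (v : V) (hv : v ∈ W) :
    ∑ x ∈ W, dg G (W : Set V) x =
      2 * dg G (W : Set V) v + ∑ x ∈ W.erase v, dg G ((W.erase v : Finset V) : Set V) x := by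
  have h1 : ∀ x ∈ W.erase v, dg G (W : Set V) x =
      dg G ((W.erase v : Finset V) : Set V) x + if G.Adj v x then 1 else 0 := by
    intro x hx
    unfold dg
    split_ifs with hadj
    · have : G.neighborSet x ∩ (W : Set V) =
          insert v (G.neighborSet x ∩ ((W.erase v : Finset V) : Set V)) := by
        ext z
        simp only [Set.mem_inter_iff, mem_neighborSet, Finset.mem_coe, Set.mem_insert_iff,
          Finset.mem_erase]
        constructor
        · rintro ⟨a, b⟩
          by_cases hz : z = v
          · exact Or.inl hz
          · exact Or.inr ⟨a, hz, b⟩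
        · rintro (rfl | ⟨a, _, b⟩)
          · exact ⟨hadj.symm, hv⟩
          · exact ⟨a, b⟩
      rw [this, Set.ncard_insert_of_notMem (by simp) (Set.toFinite _)]
    · congr 1
      ext z
      simp only [Set.mem_inter_iff, mem_neighborSet, Finset.mem_coe, Finset.mem_erase]
      constructor
      · rintro ⟨a, b⟩
        refine ⟨a, ?_, b⟩
        rintro rfl
        exact hadj a.symm
      · rintro ⟨a, _, b⟩
        exact ⟨a, b⟩
  rw [← Finset.add_sum_erase _ _ hv, Finset.sum_congr rfl h1, Finset.sum_add_distrib]
  have h2 : (∑ x ∈ W.erase v, if G.Adj v x then 1 else 0) = dg G (W : Set V) v := by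
    rw [← Finset.sum_filter, Finset.sum_const, smul_eq_mul, mul_one]
    unfold dg
    rw [← Set.ncard_coe_finset]
    congr 1
    ext z
    simp only [Finset.coe_filter, Finset.mem_erase, Set.mem_ofPred_eq, Set.mem_inter_iff,
      mem_neighborSet, Finset.mem_coe]
    constructor
    · rintro ⟨⟨_, b⟩, c⟩; exact ⟨c, b⟩
    · rintro ⟨a, b⟩; exact ⟨⟨a.ne', b⟩, a⟩
  rw [h2]; ring

theorem acyclic_sum (n : ℕ) : ∀ (W : Finset V), W.card = n + 1 → (res G (W : Set V)).IsAcyclic →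
    ∑ x ∈ W, dg G (W : Set V) x + 2 ≤ 2 * W.card := by
  classical
  induction n with
  | zero =>
    intro W hW _
    obtain ⟨a, rfl⟩ := Finset.card_eq_one.1 hW
    have : dg G (({a} : Finset V) : Set V) a = 0 := by
      unfold dg
      rw [Set.ncard_eq_zero (Set.toFinite _)]
      ext z
      simp only [Set.mem_inter_iff, mem_neighborSet, Finset.coe_singleton, Set.mem_singleton_iff,
        Set.mem_empty_iff_false, iff_false]
      rintro ⟨h, rfl⟩
      exact h.ne rfl
    rw [Finset.sum_singleton, this]
    simp
  | succ n ih =>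
    intro W hW hac
    have hne : (W : Set V).Nonempty := by
      rw [Finset.coe_nonempty, ← Finset.card_pos]; omega
    obtain ⟨v, hv, h1⟩ := exists_leaf hne hac
    have hv' : v ∈ W := hv
    have hc : (W.erase v).card = n + 1 := by rw [Finset.card_erase_of_mem hv']; omega
    have := ih (W.erase v) hc (hac.anti (res_mono (by
      intro z hz; exact Finset.mem_of_mem_erase hz)))
    rw [sum_erase W v hv']
    omega

end counting

/-- outcome (C) -/
def SolC {V : Type} (G : SimpleGraph V) (S : Set V) : Prop :=
  ∃ (u : V) (c : G.Walk u u), c.IsCycle ∧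
        (∀ z ∈ c.support, z ∉ S) ∧
        (∀ a b : V, a ∈ c.support → b ∈ c.support → G.Adj a b → s(a, b) ∈ c.edges) ∧
        (G.deleteEdges {e | e ∈ c.edges}).Connected

/-- outcome (P) -/
def SolP {V : Type} (G : SimpleGraph V) (S : Set V) : Prop :=
  ∃ (u w : V) (P : G.Walk u w), u ≠ w ∧ u ∈ S ∧ w ∈ S ∧ P.IsPath ∧
        (∀ a b : V, a ∈ P.support → b ∈ P.support → G.Adj a b → s(a, b) ∈ P.edges) ∧
        (G.deleteEdges {e | e ∈ P.edges}).Connected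

section plemma
variable {V : Type} {G : SimpleGraph V} {S : Set V}

/-- Shortcutting a path along a chord keeps the complement connected. -/
theorem shortcut {u a b w : V} (A1 : G.Walk u a) (B : G.Walk a b) (C : G.Walk b w)
    (hP : (A1.append (B.append C)).IsPath) (hab : G.Adj a b)
    (hn : s(a, b) ∉ (A1.append (B.append C)).edges)
    (hc : (G.deleteEdges {e | e ∈ (A1.append (B.append C)).edges}).Connected) :
    (G.deleteEdges {e | e ∈ (A1.append (Walk.cons hab C)).edges}).Connected ∧
    (A1.append (Walk.cons hab C)).length < (A1.append (B.append C)).length := by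
  have hnd := hP.isTrail.edges_nodup
  simp only [Walk.edges_append, List.mem_append, not_or] at hn hnd
  constructor
  · have hab' : (G.deleteEdges {e | e ∈ (A1.append (Walk.cons hab C)).edges}).Reachable a b := by
      refine ⟨B.transfer _ ?_⟩
      intro e he
      rw [edgeSet_deleteEdges]
      refine ⟨B.edges_subset_edgeSet he, ?_⟩
      simp only [Set.mem_ofPred_eq, Walk.edges_append, Walk.edges_cons, List.mem_append,
        List.mem_cons, not_or]
      rw [List.nodup_append, List.nodup_append] at hnd
      refine ⟨fun h => hnd.2.2 e h e (List.mem_append.2 (Or.inl he)) rfl, ?_,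
        fun h => hnd.2.1.2.2 e he e h rfl⟩
      rintro rfl
      exact hn.2.1 he
    have := hc.nonempty
    refine Connected.mk (fun x y => reach_trans ?_ (hc.preconnected x y))
    intro x y hxy
    rw [deleteEdges_adj] at hxy
    by_cases hm : s(x, y) ∈ (A1.append (Walk.cons hab C)).edges
    · have hm2 := hxy.2
      simp only [Set.mem_ofPred_eq, Walk.edges_append, Walk.edges_cons, List.mem_append,
        List.mem_cons, not_or] at hm hm2
      have : s(x, y) = s(a, b) := by tauto
      rw [Sym2.eq_iff] at this
      rcases this with ⟨rfl, rfl⟩ | ⟨rfl, rfl⟩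
      · exact hab'
      · exact hab'.symm
    · refine Adj.reachable ?_
      rw [deleteEdges_adj]
      exact ⟨hxy.1, hm⟩
  · simp only [Walk.length_append, Walk.length_cons]
    have : 2 ≤ B.length := by
      by_contra hlt
      match B, hlt with
      | Walk.nil, _ => exact hab.ne rfl
      | Walk.cons h Walk.nil, _ => exact hn.2.1 (by simp)
      | Walk.cons h (Walk.cons h' p), hlt => simp at hlt
    omega

theorem P_lemma (u w : V) (huw : u ≠ w) (hu : u ∈ S) (hw : w ∈ S) (P0 : G.Walk u w)
    (hc0 : (G.deleteEdges {e | e ∈ P0.edges}).Connected) : SolP G S := by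
  classical
  have hex : ∃ n, ∃ P : G.Walk u w, P.length = n ∧ (G.deleteEdges {e | e ∈ P.edges}).Connected :=
    ⟨_, P0, rfl, hc0⟩
  obtain ⟨P1, hl1, hc1⟩ := Nat.find_spec hex
  have hmin : ∀ Q : G.Walk u w, (G.deleteEdges {e | e ∈ Q.edges}).Connected →
      Nat.find hex ≤ Q.length := fun Q hQ => Nat.find_min' hex ⟨Q, rfl, hQ⟩
  obtain ⟨P, hP, hc, hl⟩ : ∃ P : G.Walk u w, P.IsPath ∧
      (G.deleteEdges {e | e ∈ P.edges}).Connected ∧ P.length ≤ Nat.find hex :=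
    ⟨P1.bypass, P1.bypass_isPath,
      hc1.mono (deleteEdges_anti (fun e he => P1.edges_bypass_subset_edges he)),
      P1.length_bypass_le_length.trans hl1.le⟩
  refine ⟨u, w, P, huw, hu, hw, hP, ?_, hc⟩
  have core : ∀ a b : V, ∀ (A1 : G.Walk u a) (B : G.Walk a b) (C : G.Walk b w),
      P = A1.append (B.append C) → G.Adj a b → s(a, b) ∈ P.edges := by
    intro a b A1 B C hPe hab
    by_contra hn
    rw [hPe] at hn hP hc
    obtain ⟨h1, h2⟩ := shortcut A1 B C hP hab hn hc
    have := hmin _ h1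
    rw [hPe] at hl
    omega
  intro a b ha hb hab
  by_cases hbd : b ∈ (P.dropUntil a ha).support
  · refine core a b (P.takeUntil a ha) ((P.dropUntil a ha).takeUntil b hbd)
      ((P.dropUntil a ha).dropUntil b hbd) ?_ hab
    rw [Walk.take_spec, Walk.take_spec]
  · have hbt : b ∈ (P.takeUntil a ha).support := by
      have : b ∈ ((P.takeUntil a ha).append (P.dropUntil a ha)).support := by
        rw [Walk.take_spec]; exact hb
      rw [Walk.mem_support_append_iff] at this
      tauto
    rw [Sym2.eq_swap]
    refine core b a ((P.takeUntil a ha).takeUntil b hbt) ((P.takeUntil a ha).dropUntil b hbt)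
      (P.dropUntil a ha) ?_ hab.symm
    rw [Walk.append_assoc, Walk.take_spec, Walk.take_spec]

end plemma

section degrees
variable {V : Type} [Fintype V] {G : SimpleGraph V} {v a b c d : V}

theorem deg3_mem (hd : gdeg G v = 3) (ha : G.Adj v a) (hb : G.Adj v b) (hc : G.Adj v c)
    (hab : a ≠ b) (hac : a ≠ c) (hbc : b ≠ c) (h : G.Adj v d) : d = a ∨ d = b ∨ d = c := by
  have h3 : ({a, b, c} : Set V).ncard = 3 := Set.ncard_eq_three.2 ⟨a, b, c, hab, hac, hbc, rfl⟩
  have hsub : ({a, b, c} : Set V) ⊆ G.neighborSet v := by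
    rintro x (rfl | rfl | rfl) <;> assumption
  have := Set.eq_of_subset_of_ncard_le hsub (by rw [h3]; exact hd.le) (Set.toFinite _)
  have hm : d ∈ ({a, b, c} : Set V) := by rw [this]; exact h
  simpa using hm

theorem exists_third (hd : 3 ≤ gdeg G v) (a b : V) : ∃ y, G.Adj v y ∧ y ≠ a ∧ y ≠ b := by
  by_contra hcon
  push Not at hcon
  have hsub : G.neighborSet v ⊆ {a, b} := by
    intro y hy
    by_cases h : y = a
    · exact Or.inl h
    · exact Or.inr (hcon y hy h)
  have h1 := Set.ncard_le_ncard hsub (Set.toFinite _)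
  have h2 := Set.ncard_insert_le a {b}
  rw [Set.ncard_singleton] at h2
  have : gdeg G v = (G.neighborSet v).ncard := rfl
  omega

/-- If all neighbours of `v` lie in `W` apart from possibly one, ... -/
theorem dg_ge_of (W : Set V) (u : V) (hn : ∀ y, G.Adj v y → y ∈ W ∨ y = u) :
    gdeg G v ≤ dg G W v + 1 := by
  have hsub : G.neighborSet v ⊆ insert u (G.neighborSet v ∩ W) := by
    intro y hy
    rcases hn y hy with h | h
    · exact Or.inr ⟨hy, h⟩
    · exact Or.inl h
  exact (Set.ncard_le_ncard hsub (Set.toFinite _)).trans (Set.ncard_insert_le _ _)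

theorem dg_lt_of {W : Set V} {u : V} (h : G.Adj v u) (hu : u ∉ W) :
    dg G W v + 1 ≤ gdeg G v := by
  have : (insert u (G.neighborSet v ∩ W)).ncard = dg G W v + 1 :=
    Set.ncard_insert_of_notMem (fun h => hu h.2) (Set.toFinite _)
  rw [← this]
  refine Set.ncard_le_ncard ?_ (Set.toFinite _)
  rintro y (rfl | hy)
  · exact h
  · exact hy.1

theorem cyc_lemma (K M : Set V) (s v0 u0 : V) (hKM : Disjoint K M)
    (hd3 : ∀ v ∈ M, gdeg G v = 3)
    (hnb : ∀ v ∈ M, ∀ y, G.Adj v y → y ∈ K ∨ y ∈ M ∨ y = s)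
    (hnac : ¬ (res G M).IsAcyclic)
    (hmax : ∀ v ∈ M, (∃ u ∈ K, G.Adj v u) → (res G (M \ {v})).IsAcyclic)
    (hv0 : v0 ∈ M) (hu0 : u0 ∈ K) (hvu : G.Adj v0 u0) :
    (∀ v ∈ M, dg G M v = 2) ∧
    ∀ b ∈ M, ∃ c : G.Walk b b, c.IsCycle ∧ (∀ z, z ∈ c.support ↔ z ∈ M) ∧
      (∀ x ∈ M, ∀ y ∈ M, G.Adj x y → s(x, y) ∈ c.edges) := by
  classical
  have hcyc : ∃ (r : V) (c : (res G M).Walk r r), c.IsCycle := by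
    by_contra hcon
    push Not at hcon
    exact hnac (fun r c => hcon r c)
  obtain ⟨r, c, hc⟩ := hcyc
  have hon : ∀ v ∈ M, (∃ u ∈ K, G.Adj v u) → v ∈ c.support := by
    intro v hv hK
    by_contra hvs
    have ht : ∀ e ∈ c.edges, e ∈ (res G (M \ {v})).edgeSet := by
      intro e he
      induction e with
      | _ x y =>
        have hadj := c.adj_of_mem_edges he
        have hx := c.fst_mem_support_of_mem_edges he
        have hy := c.snd_mem_support_of_mem_edges he
        refine ⟨hadj.1, ⟨hadj.2.1, ?_⟩, ⟨hadj.2.2, ?_⟩⟩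
        · rintro rfl; exact hvs hx
        · rintro rfl; exact hvs hy
    exact hmax v hv hK _ (hc.transfer ht)
  have hsubN : ∀ v, c.toSubgraph.neighborSet v ⊆ G.neighborSet v ∩ M := by
    intro v y hy
    have : (res G M).Adj v y := c.toSubgraph.adj_sub hy
    exact ⟨this.1, this.2.2⟩
  have hge : ∀ v ∈ M, 2 ≤ dg G M v := by
    intro v hv
    by_cases hK : ∃ u ∈ K, G.Adj v u
    · have h2 := hc.ncard_neighborSet_toSubgraph_eq_two (hon v hv hK)
      rw [← h2]
      exact Set.ncard_le_ncard (hsubN v) (Set.toFinite _)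
    · push Not at hK
      have := dg_ge_of (G := G) (v := v) M s (by
        intro y hy
        rcases hnb v hv y hy with h | h | h
        · exact absurd hy (hK y h)
        · exact Or.inl h
        · exact Or.inr h)
      rw [hd3 v hv] at this
      omega
  have hv02 : dg G M v0 ≤ 2 := by
    have := dg_lt_of (G := G) (W := M) hvu (fun h => Set.disjoint_left.1 hKM hu0 h)
    rw [hd3 v0 hv0] at this
    omega
  have hall : ∀ v ∈ M, dg G M v = 2 := by
    have hMF : ((M.toFinset : Finset V) : Set V) = M := Set.coe_toFinset M
    have hv0' : v0 ∈ M.toFinset := by simpa using hv0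
    have hs := sum_erase (G := G) M.toFinset v0 hv0'
    have hcardpos : (M.toFinset.erase v0).Nonempty := by
      have : (G.neighborSet v0 ∩ M).Nonempty := by
        rw [← Set.ncard_pos (Set.toFinite _)]
        have := hge v0 hv0
        unfold dg at this
        omega
      obtain ⟨y, hy1, hy2⟩ := this
      exact ⟨y, by simp [hy2, (show G.Adj v0 y from hy1).ne']⟩
    have hE : ((M.toFinset.erase v0 : Finset V) : Set V) = M \ {v0} := by
      rw [Finset.coe_erase, hMF]
    have ha := acyclic_sum (G := G) ((M.toFinset.erase v0).card - 1) (M.toFinset.erase v0)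
      (by have := hcardpos.card_pos; omega) (by rw [hE]; exact hmax v0 hv0 ⟨u0, hu0, hvu⟩)
    have hce : (M.toFinset.erase v0).card = M.toFinset.card - 1 := Finset.card_erase_of_mem hv0'
    have hcp : 0 < M.toFinset.card := Finset.card_pos.2 ⟨v0, hv0'⟩
    rw [hMF] at hs
    have htot : ∑ x ∈ M.toFinset, dg G M x ≤ ∑ x ∈ M.toFinset, 2 := by
      rw [Finset.sum_const, smul_eq_mul]
      omega
    have hge' : ∀ x ∈ M.toFinset, 2 ≤ dg G M x := fun x hx => hge x (by simpa using hx)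
    have heq := (Finset.sum_eq_sum_iff_of_le hge').1 (le_antisymm (Finset.sum_le_sum hge') htot)
    intro v hv
    exact (heq v (by simpa using hv)).symm
  refine ⟨hall, ?_⟩
  have hsM : ∀ z ∈ c.support, z ∈ M := by
    intro z hz
    have h2 := hc.ncard_neighborSet_toSubgraph_eq_two hz
    have : (c.toSubgraph.neighborSet z).Nonempty := by
      rw [← Set.ncard_pos (Set.toFinite _)]; omega
    obtain ⟨y, hy⟩ := this
    have : (res G M).Adj z y := c.toSubgraph.adj_sub hy
    exact this.2.1
  have hN : ∀ z ∈ c.support, c.toSubgraph.neighborSet z = G.neighborSet z ∩ M := by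
    intro z hz
    refine Set.eq_of_subset_of_ncard_le (hsubN z) ?_ (Set.toFinite _)
    rw [hc.ncard_neighborSet_toSubgraph_eq_two hz]
    exact (hall z (hsM z hz)).le
  have hMs : ∀ z ∈ M, z ∈ c.support := by
    by_contra hcon
    push Not at hcon
    obtain ⟨z, hz, hzs⟩ := hcon
    let Z : Set V := {z | z ∈ M ∧ z ∉ c.support}
    have hna : ¬ (res G Z).IsAcyclic := by
      refine not_acyclic_of_deg ⟨z, hz, hzs⟩ ?_
      rintro x ⟨hx, hxs⟩
      rw [← hall x hx]
      refine Set.ncard_le_ncard ?_ (Set.toFinite _)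
      rintro y ⟨hy1, hy2⟩
      refine ⟨hy1, hy2, fun hys => hxs ?_⟩
      have : x ∈ c.toSubgraph.neighborSet y := by
        rw [hN y hys]
        exact ⟨hy1.symm, hx⟩
      exact Walk.mem_support_of_adj_toSubgraph this.symm
    refine hna ((hmax v0 hv0 ⟨u0, hu0, hvu⟩).anti (res_mono ?_))
    rintro x ⟨hx, hxs⟩
    refine ⟨hx, ?_⟩
    rintro rfl
    exact hxs (hon _ hv0 ⟨u0, hu0, hvu⟩)
  intro b hb
  refine ⟨(c.rotate b (hMs b hb)).mapLe res_le, ?_, ?_, ?_⟩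
  · rw [Walk.isCycle_mapLe, Walk.isCycle_rotate]; exact hc
  · intro z
    rw [Walk.support_mapLe_eq_support, Walk.mem_support_rotate_iff]
    exact ⟨hsM z, hMs z⟩
  · intro x hx y hy hxy
    rw [Walk.edges_mapLe_eq_edges, (c.rotate_edges b (hMs b hb)).mem_iff]
    have : y ∈ c.toSubgraph.neighborSet x := by
      rw [hN x (hMs x hx)]
      exact ⟨hxy, hy⟩
    exact Walk.adj_toSubgraph_iff_mem_edges.1 this

end degrees

set_option linter.unusedSectionVars false

section lemma1a
variable {V : Type} [Fintype V] {G : SimpleGraph V} {S : Set V}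

theorem nonempty_of_not_acyclic {W : Set V} (h : ¬ (res G W).IsAcyclic) : W.Nonempty := by
  by_contra hne
  rw [Set.not_nonempty_iff_eq_empty] at hne
  subst hne
  exact h (isAcyclic_iff_forall_adj_isBridge.2 (fun _ _ h => absurd h.2.1 (Set.notMem_empty _)))

theorem connected_of_center {H : SimpleGraph V} (k : V) (h : ∀ x, H.Reachable x k) :
    H.Connected :=
  have : Nonempty V := ⟨k⟩
  Connected.mk (fun x y => (h x).trans (h y).symm)

theorem deg_three (hdeg : ∀ v, 3 ≤ gdeg G v) (hS : ∀ v, 3 < gdeg G v → v ∈ S) {v : V}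
    (hv : v ∉ S) : gdeg G v = 3 := by
  have h1 := hdeg v
  have h2 : ¬ 3 < gdeg G v := fun h => hv (hS v h)
  omega

theorem lemma1a (hconn : G.Connected) (hdeg : ∀ v, 3 ≤ gdeg G v)
    (hS : ∀ v, 3 < gdeg G v → v ∈ S) (K0 : Set V) (hne : K0.Nonempty) (hcon : Cn G K0)
    (hSK : S ⊆ K0) (hnac : ¬ (res G K0ᶜ).IsAcyclic) : SolC G S := by
  obtain ⟨K, hK0, hK⟩ := Finite.exists_le_maximal
    (p := fun K : Set V => K0 ⊆ K ∧ Cn G K ∧ ¬ (res G Kᶜ).IsAcyclic)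
    (a := K0) ⟨le_refl _, hcon, hnac⟩
  obtain ⟨⟨hK0K, hKcon, hKnac⟩, hmaxK⟩ := hK
  obtain ⟨k0, hk0⟩ := hne
  have hk0K := hK0K hk0
  obtain ⟨m, hm⟩ := nonempty_of_not_acyclic hKnac
  obtain ⟨u0, hu0, v0, hv0, huv⟩ := boundary (hconn.preconnected k0 m) K hk0K hm
  have hcyc := cyc_lemma (G := G) K Kᶜ k0 v0 u0 disjoint_compl_right
    (fun v hv => deg_three hdeg hS (fun h => hv (hK0K (hSK h))))
    (fun v hv y _ => by
      by_cases h : y ∈ K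
      · exact Or.inl h
      · exact Or.inr (Or.inl h))
    hKnac
    (by
      rintro v hv ⟨u, hu, hvu⟩
      by_contra hna
      have heq : Kᶜ \ {v} = (insert v K)ᶜ := by
        ext z; simp only [Set.mem_sdiff, Set.mem_compl_iff, Set.mem_singleton_iff,
          Set.mem_insert_iff]; tauto
      rw [heq] at hna
      exact hv (hmaxK ⟨hK0K.trans (Set.subset_insert _ _), con_insert hKcon hu hvu, hna⟩
        (Set.subset_insert _ _) (Set.mem_insert _ _)))
    hv0 hu0 huv.symm
  obtain ⟨hall, hc⟩ := hcyc
  obtain ⟨c, hcy, hsup, hind⟩ := hc v0 hv0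
  refine ⟨v0, c, hcy, ?_, ?_, ?_⟩
  · intro z hz hzS
    exact (hsup z).1 hz (hK0K (hSK hzS))
  · intro a b ha hb hab
    exact hind a ((hsup a).1 ha) b ((hsup b).1 hb) hab
  · have hKr : ∀ x ∈ K, (G.deleteEdges {e | e ∈ c.edges}).Reachable x k0 := by
      intro x hx
      refine (hKcon x hx k0 hk0K).mono ?_
      intro a b hab
      rw [deleteEdges_adj]
      refine ⟨hab.1, fun he => ?_⟩
      exact (hsup a).1 (c.fst_mem_support_of_mem_edges he) hab.2.1
    refine connected_of_center k0 ?_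
    intro x
    by_cases hx : x ∈ K
    · exact hKr x hx
    · have : ∃ y ∈ K, G.Adj x y := by
        by_contra hcon
        push Not at hcon
        have h2 := hall x hx
        have : G.neighborSet x ∩ Kᶜ = G.neighborSet x := by
          refine Set.inter_eq_left.2 ?_
          intro y hy hyK
          exact hcon y hyK hy
        unfold dg at h2
        rw [this] at h2
        have h3 := hdeg x
        unfold gdeg at h3
        have : Nat.card (G.neighborSet x) = (G.neighborSet x).ncard := rfl
        omega
      obtain ⟨y, hy, hxy⟩ := this
      refine Reachable.trans (Adj.reachable ?_) (hKr y hy)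
      rw [deleteEdges_adj]
      refine ⟨hxy, fun he => ?_⟩
      exact (hsup y).1 (c.snd_mem_support_of_mem_edges he) hy

theorem lemma1a' (hconn : G.Connected) (hdeg : ∀ v, 3 ≤ gdeg G v)
    (hS : ∀ v, 3 < gdeg G v → v ∈ S) (K : Set V) (hne : K.Nonempty) (hcon : Cn G K)
    (hSK : S ⊆ K) (hne' : Kᶜ.Nonempty)
    (h1 : ∀ v, v ∉ K → ∀ y ∈ K, ∀ y' ∈ K, G.Adj v y → G.Adj v y' → y = y') : SolC G S := by
  refine lemma1a hconn hdeg hS K hne hcon hSK (not_acyclic_of_deg hne' ?_)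
  intro v hv
  have hd := hdeg v
  obtain ⟨u, hu⟩ : ∃ u, ∀ y, G.Adj v y → y ∈ Kᶜ ∨ y = u := by
    by_cases h : ∃ u ∈ K, G.Adj v u
    · obtain ⟨u, hu, hvu⟩ := h
      refine ⟨u, fun y hy => ?_⟩
      by_cases hyK : y ∈ K
      · exact Or.inr (h1 v hv y hyK u hu hy hvu)
      · exact Or.inl hyK
    · push Not at h
      exact ⟨v, fun y hy => Or.inl (fun hyK => h y hyK hy)⟩
  have := dg_ge_of _ u hu
  omega

/-- The minimal set with at most one leaving edge. -/
theorem exists_A (G : SimpleGraph V) (hconn : G.Connected) : ∃ A : Set V, A.Nonempty ∧ Cut1 G A ∧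
    (∀ Y : Set V, Y.Nonempty → Y ⊂ A → ¬ Cut1 G Y) ∧ Cn G A ∧ Cn G Aᶜ := by
  have hne := hconn.nonempty
  obtain ⟨A, -, hA⟩ := Finite.exists_le_minimal
    (p := fun Y : Set V => Y.Nonempty ∧ Cut1 G Y) (a := Set.univ)
    ⟨Set.univ_nonempty, fun x _ y hy => absurd trivial hy⟩
  obtain ⟨⟨hAne, hAc⟩, hmin⟩ := hA
  have hminY : ∀ Y : Set V, Y.Nonempty → Y ⊂ A → ¬ Cut1 G Y := by
    intro Y hY hYA hc
    exact hYA.2 (hmin ⟨hY, hc⟩ hYA.1)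
  have hAcon : Cn G A := by
    intro x hx y hy
    by_contra hr
    -- the component of `x` and that of `y` are both proper subsets; one has no leaving edges
    have hpx : comp G A x ⊂ A := ⟨comp_subset hx, fun h => hr (h hy)⟩
    have hpy : comp G A y ⊂ A := ⟨comp_subset hy, fun h => hr (Reachable.symm (h hx))⟩
    have h1 : ∀ w ∈ A, comp G A w ⊂ A → ∃ p ∈ comp G A w, ∃ q, q ∉ A ∧ G.Adj p q := by
      intro w hw hpw
      by_contra hcon
      push Not at hcon
      refine hminY _ ⟨w, mem_comp_self⟩ hpw ?_
      intro p hp q hq p' _ q' _ hpq _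
      by_cases hqA : q ∈ A
      · exact absurd (comp_adj hw hp hqA hpq) hq
      · exact absurd hpq (hcon p hp q hqA)
    obtain ⟨p, hp, q, hq, hpq⟩ := h1 x hx hpx
    obtain ⟨p', hp', q', hq', hpq'⟩ := h1 y hy hpy
    have := hAc p (comp_subset hx hp) q hq p' (comp_subset hy hp') q' hq' hpq hpq'
    rw [← this.1] at hp'
    exact hr (Reachable.trans hp (Reachable.symm hp'))
  refine ⟨A, hAne, hAc, hminY, hAcon, ?_⟩
  intro x hx y hy
  obtain ⟨a0, ha0⟩ := hAne
  have hb : ∀ w ∈ Aᶜ, ∃ p ∈ comp G Aᶜ w, ∃ q ∈ A, G.Adj p q := by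
    intro w hw
    obtain ⟨p, hp, q, hq, hpq⟩ := boundary (hconn.preconnected w a0) (comp G Aᶜ w) mem_comp_self
      (fun h => comp_subset hw h ha0)
    refine ⟨p, hp, q, ?_, hpq⟩
    by_contra hqA
    exact hq (comp_adj hw hp hqA hpq)
  obtain ⟨p, hp, q, hq, hpq⟩ := hb x hx
  obtain ⟨p', hp', q', hq', hpq'⟩ := hb y hy
  have := hAc q hq p (comp_subset hx hp) q' hq' p' (comp_subset hy hp') hpq.symm hpq'.symm
  rw [← this.2] at hp'
  exact Reachable.trans hp (Reachable.symm hp')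

end lemma1a

set_option linter.unusedSectionVars false

/-- anchors -/
def Anc {V : Type} (G : SimpleGraph V) (K : Set V) (s w : V) : Prop :=
  w ∉ K ∧ (s = w ∨ (s ∈ K ∧ G.Adj s w))

/-- The objects maximised in Case I. -/
def Ob2 {V : Type} (G : SimpleGraph V) (S R K : Set V) : Prop :=
  Cn G K ∧ K.Nonempty ∧ R ⊆ K ∧ ∃ s ∈ S, ∃ t ∈ S, s ≠ t ∧ ∃ w w', Anc G K s w ∧ Anc G K t w' ∧
    (res G Kᶜ).Reachable w w'

section caseI
variable {V : Type} [Fintype V] {G : SimpleGraph V} {S : Set V}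

theorem ins_compl (K : Set V) (v : V) : (insert v K)ᶜ = Kᶜ \ {v} := by
  ext z; simp only [Set.mem_sdiff, Set.mem_compl_iff, Set.mem_singleton_iff,
          Set.mem_insert_iff]; tauto

theorem two_edges {Y : Set V} (h : ¬ Cut1 G Y) : ∃ x ∈ Y, ∃ y, y ∉ Y ∧ ∃ x' ∈ Y, ∃ y', y' ∉ Y ∧
    G.Adj x y ∧ G.Adj x' y' ∧ ¬ (x = x' ∧ y = y') := by
  by_contra hcon
  apply h
  intro x hx y hy x' hx' y' hy' h1 h2
  by_contra h3
  exact hcon ⟨x, hx, y, hy, x', hx', y', hy', h1, h2, h3⟩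

theorem caseI_1 (hconn : G.Connected) (hdeg : ∀ v, 3 ≤ gdeg G v)
    (hS : ∀ v, 3 < gdeg G v → v ∈ S) (A : Set V)
    (hmin : ∀ Y : Set V, Y.Nonempty → Y ⊂ A → ¬ Cut1 G Y)
    (K : Set V) (hKc : Cn G K) (hKn : K.Nonempty) (hRK : Aᶜ ⊆ K)
    (hmax : ∀ v, v ∉ K → ¬ Ob2 G S Aᶜ (insert v K))
    (x0 s t w : V) (hx0 : x0 ∉ K) (hs : s ∈ S) (ht : t ∈ S) (hst : s ≠ t)
    (htQ : t ∈ comp G Kᶜ x0) (hwQ : w ∈ comp G Kᶜ x0) (hanc : Anc G K s w)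
    (hQA : w = s ∨ comp G Kᶜ x0 ≠ A) : SolP G S := by
  set Q := comp G Kᶜ x0 with hQ
  have hQK : ∀ z ∈ Q, z ∉ K := fun z hz => comp_subset (W := Kᶜ) hx0 hz
  have hQsubA : Q ⊆ A := fun z hz => by
    by_contra h; exact hQK z hz (hRK h)
  have hleave : ∀ x ∈ Q, ∀ y, y ∉ Q → G.Adj x y → y ∈ K := by
    intro x hx y hy hxy
    by_contra hyK
    exact hy (comp_adj (W := Kᶜ) hx0 hx hyK hxy)
  have hQr : ∀ a ∈ Q, ∀ b ∈ Q, (res G Kᶜ).Reachable a b :=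
    fun a ha b hb => Reachable.trans (Reachable.symm ha) hb
  have step1 : ∀ t' ∈ Q, t' ∈ S → (∃ u ∈ K, G.Adj t' u) → ∀ s' ∈ S, s' ≠ t' → ∀ w' ∈ Q,
      Anc G K s' w' → w' = t' := by
    rintro t' ht' ht'S ⟨u, hu, htu⟩ s' hs' hst' w' hw' hanc'
    by_contra hne
    obtain ⟨y, h1, h2, -, h4⟩ := first_step (hQr t' ht' w' hw') hne
    refine hmax t' (hQK t' ht') ⟨con_insert hKc hu htu, Set.insert_nonempty _ _,
      hRK.trans (Set.subset_insert _ _), t', ht'S, s', hs', hst'.symm, y, w', ?_, ?_, ?_⟩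
    · refine ⟨?_, Or.inr ⟨Set.mem_insert _ _, h1⟩⟩
      rintro (h | h)
      · exact h1.ne h.symm
      · exact h2 h
    · refine ⟨?_, ?_⟩
      · rintro (h | h)
        · exact hne h
        · exact hanc'.1 h
      · rcases hanc'.2 with h | h
        · exact Or.inl h
        · exact Or.inr ⟨Set.mem_insert_of_mem _ h.1, h.2⟩
    · rw [ins_compl]; exact h4
  by_cases htK : ∃ u ∈ K, G.Adj t u
  · have hwt : w = t := step1 t htQ ht htK s hs hst w hwQ hanc
    subst hwt
    have hsK : s ∈ K ∧ G.Adj s w := by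
      rcases hanc.2 with h | h
      · exact absurd h hst
      · exact h
    have hQA' : Q ⊂ A := by
      refine hQsubA.ssubset_of_ne ?_
      rcases hQA with h | h
      · exact absurd h.symm hst
      · exact h
    obtain ⟨x, hx, y, hy, x', hx', y', hy', h1, h2, h3⟩ := two_edges (hmin Q ⟨w, hwQ⟩ hQA')
    obtain ⟨x, hx, y, hy, hxy, hne⟩ : ∃ x ∈ Q, ∃ y, y ∉ Q ∧ G.Adj x y ∧ ¬ (x = w ∧ y = s) := by
      by_cases h : x = w ∧ y = s
      · refine ⟨x', hx', y', hy', h2, ?_⟩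
        rintro ⟨h4, h5⟩
        exact h3 ⟨h.1.trans h4.symm, h.2.trans h5.symm⟩
      · exact ⟨x, hx, y, hy, h1, h⟩
    have hyK := hleave x hx y hy hxy
    have hsQ : s ∉ Q := fun h => hQK s h hsK.1
    refine P_lemma s w hst hs ht (Walk.cons hsK.2 Walk.nil) ?_
    have key : (G.deleteEdges {e | e ∈ (Walk.cons hsK.2 Walk.nil : G.Walk s w).edges}).Reachable
        s w := by
      have e1 : (G.deleteEdges {e | e ∈ (Walk.cons hsK.2 Walk.nil : G.Walk s w).edges}).Reachable
        s y := by
        refine (hKc s hsK.1 y hyK).mono ?_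
        intro a b hab
        rw [deleteEdges_adj]
        refine ⟨hab.1, ?_⟩
        simp only [Walk.edges_cons, Walk.edges_nil, List.mem_singleton, Set.mem_ofPred_eq,
          Sym2.eq_iff]
        rintro (⟨_, h⟩ | ⟨h, _⟩)
        · exact hQK w hwQ (h ▸ hab.2.2)
        · exact hQK w hwQ (h ▸ hab.2.1)
      have e2 : (G.deleteEdges {e | e ∈ (Walk.cons hsK.2 Walk.nil : G.Walk s w).edges}).Reachable
        x w := by
        refine (comp_con x hx w hwQ).mono ?_
        intro a b hab
        rw [deleteEdges_adj]
        refine ⟨hab.1, ?_⟩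
        simp only [Walk.edges_cons, Walk.edges_nil, List.mem_singleton, Set.mem_ofPred_eq,
          Sym2.eq_iff]
        rintro (⟨h, _⟩ | ⟨_, h⟩)
        · exact hsQ (h ▸ hab.2.1)
        · exact hsQ (h ▸ hab.2.2)
      refine e1.trans (Reachable.trans (Adj.reachable ?_) e2)
      rw [deleteEdges_adj]
      refine ⟨hxy.symm, ?_⟩
      simp only [Walk.edges_cons, Walk.edges_nil, List.mem_singleton, Set.mem_ofPred_eq,
          Sym2.eq_iff]
      rintro (⟨h, h'⟩ | ⟨_, h⟩)
      · exact hne ⟨h', h⟩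
      · exact hsQ (h ▸ hx)
    have := hconn.nonempty
    refine Connected.mk (fun x y => reach_trans ?_ (hconn.preconnected x y))
    intro a b hab
    by_cases h : s(a, b) = s(s, w)
    · rw [Sym2.eq_iff] at h
      rcases h with ⟨rfl, rfl⟩ | ⟨rfl, rfl⟩
      · exact key
      · exact key.symm
    · refine Adj.reachable ?_
      rw [deleteEdges_adj]
      exact ⟨hab, by simpa using h⟩
  · exfalso
    have hvS : ∀ v ∈ Q, (∃ u ∈ K, G.Adj v u) → v ∉ S := by
      intro v hv hvu hvS
      have htv : t ≠ v := by rintro rfl; exact htK hvu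
      exact htv (step1 v hv hvS hvu t ht htv t htQ ⟨hQK t htQ, Or.inl rfl⟩)
    let Q1 : V → Set V := fun v => comp G (insert v K)ᶜ t
    have htv : ∀ v, (∃ u ∈ K, G.Adj v u) → t ∈ (insert v K)ᶜ := by
      intro v hvu
      rintro (h | h)
      · rw [h] at htK; exact htK hvu
      · exact hQK t htQ h
    have hQ1sub : ∀ v, Q1 v ⊆ Q := by
      intro v z hz
      have hz' : (res G (insert v K)ᶜ).Reachable t z := hz
      exact Reachable.trans htQ (reach_mono (Set.compl_subset_compl.2 (Set.subset_insert _ _)) hz')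
    have hvQ1 : ∀ v, (∃ u ∈ K, G.Adj v u) → v ∉ Q1 v := by
      intro v hvu hv
      exact (comp_subset (htv v hvu) hv) (Set.mem_insert _ _)
    have hwQ1 : ∀ v ∈ Q, (∃ u ∈ K, G.Adj v u) → w ∉ Q1 v := by
      rintro v hv hvu hw
      have h1 := htv v hvu
      have h2 := comp_subset h1 hw
      obtain ⟨u, hu, hvu'⟩ := hvu
      refine hmax v (hQK v hv) ⟨con_insert hKc hu hvu', Set.insert_nonempty _ _,
        hRK.trans (Set.subset_insert _ _), t, ht, s, hs, hst.symm, t, w, ⟨h1, Or.inl rfl⟩,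
        ⟨h2, ?_⟩, hw⟩
      rcases hanc.2 with h | h
      · exact Or.inl h
      · exact Or.inr ⟨Set.mem_insert_of_mem _ h.1, h.2⟩
    have hexv : {v | v ∈ Q ∧ ∃ u ∈ K, G.Adj v u}.Nonempty := by
      obtain ⟨k, hk⟩ := hKn
      obtain ⟨a, ha, b, hb, hab⟩ := boundary (hconn.preconnected t k) Q htQ (fun h => hQK k h hk)
      exact ⟨a, ha, b, hleave a ha b hb hab, hab⟩
    obtain ⟨v, ⟨hvQ, hvK⟩, hvmin⟩ := Set.exists_min_image {v | v ∈ Q ∧ ∃ u ∈ K, G.Adj v u}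
      (fun v => (Q1 v).ncard) (Set.toFinite _) hexv
    have claim : ∀ v1 ∈ Q1 v, ¬ ∃ u ∈ K, G.Adj v1 u := by
      intro v1 hv1 hv1K
      have hv1Q := hQ1sub v hv1
      by_cases hvv : v ∈ Q1 v1
      · apply hwQ1 v1 hv1Q hv1K
        by_cases hwv : w = v
        · rw [hwv]; exact hvv
        · obtain ⟨y, h1, h2, h3, h4⟩ := first_step (hQr v hvQ w hwQ) hwv
          rw [← ins_compl] at h4
          have hyn : ¬ (res G (insert v K)ᶜ).Reachable v1 y := by
            intro h
            exact hwQ1 v hvQ hvK (Reachable.trans hv1 (h.trans h4))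
          have hy1 : y ≠ v1 := by rintro rfl; exact hyn (Reachable.refl _)
          have hyc : y ∈ (insert v K)ᶜ := by
            rintro (h | h)
            · exact h1.ne h.symm
            · exact h2 h
          have h5 := reach_avoid h4 hyn hyc
          have h6 : (res G (insert v1 K)ᶜ).Reachable y w := by
            refine reach_mono ?_ h5
            intro z hz
            rw [ins_compl] at hz ⊢
            exact ⟨hz.1.1, hz.2⟩
          have h7 : (res G (insert v1 K)ᶜ).Reachable v y := by
            refine res_adj_reach h1 (comp_subset (htv v1 hv1K) hvv) ?_
            rw [ins_compl]
            exact ⟨h2, hy1⟩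
          exact Reachable.trans hvv (h7.trans h6)
      · have hsub : Q1 v1 ⊂ Q1 v := by
          refine ⟨?_, fun h => hvQ1 v1 hv1K (h hv1)⟩
          intro z hz
          refine reach_sub hz ?_
          intro z' hz'
          have h1 := comp_subset (htv v1 hv1K) hz'
          rw [ins_compl] at h1 ⊢
          refine ⟨h1.1, ?_⟩
          rintro rfl
          exact hvv hz'
        have h1 := Set.ncard_lt_ncard hsub (Set.toFinite _)
        have h2 := hvmin v1 ⟨hv1Q, hv1K⟩
        omega
    have hedge : ∀ x ∈ Q1 v, ∀ y, y ∉ Q1 v → G.Adj x y → y = v := by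
      intro x hx y hy hxy
      by_cases hyc : y ∈ (insert v K)ᶜ
      · exact absurd (comp_adj (htv v hvK) hx hyc hxy) hy
      · rw [Set.mem_compl_iff, not_not] at hyc
        rcases hyc with h | h
        · exact h
        · exact absurd ⟨y, h, hxy⟩ (claim x hx)
    have hss : Q1 v ⊂ A :=
      ⟨(hQ1sub v).trans hQsubA, fun h => hvQ1 v hvK (h (hQsubA hvQ))⟩
    obtain ⟨x, hx, y, hy, x', hx', y', hy', h1, h2, h3⟩ :=
      two_edges (hmin (Q1 v) ⟨t, mem_comp_self⟩ hss)
    have hyv := hedge x hx y hy h1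
    have hyv' := hedge x' hx' y' hy' h2
    subst hyv
    subst hyv'
    have hxx : x ≠ x' := fun h => h3 ⟨h, rfl⟩
    have hvnS := hvS _ hvQ hvK
    obtain ⟨u, hu, hvu⟩ := hvK
    have hQ1K : ∀ z ∈ Q1 y', z ∉ K := fun z hz => hQK z (hQ1sub _ hz)
    have hnb : ∀ z, G.Adj y' z → z = x ∨ z = x' ∨ z = u := fun z hz =>
      deg3_mem (deg_three hdeg hS hvnS) h1.symm h2.symm hvu hxx
        (by rintro rfl; exact hQ1K _ hx hu) (by rintro rfl; exact hQ1K _ hx' hu) hz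
    have hall : ∀ z ∈ Q, z ≠ y' → z ∈ Q1 y' := by
      intro z hz hzv
      obtain ⟨q, g1, g2, g3, g4⟩ := first_step (hQr _ hvQ z hz) hzv
      rw [← ins_compl] at g4
      have hq : q ∈ Q1 y' := by
        rcases hnb q g1 with rfl | rfl | rfl
        · exact hx
        · exact hx'
        · exact absurd hu g2
      exact Reachable.trans hq g4
    have hwv : w = y' := by
      by_contra h
      exact hwQ1 _ hvQ ⟨u, hu, hvu⟩ (hall w hwQ h)
    have hQA' : Q ⊂ A := by
      refine hQsubA.ssubset_of_ne ?_
      rcases hQA with h | h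
      · rw [hwv] at h; rw [h] at hvnS; exact absurd hs hvnS
      · exact h
    refine hmin Q ⟨w, hwQ⟩ hQA' ?_
    have hq : ∀ p ∈ Q, ∀ q, q ∉ Q → G.Adj p q → p = y' ∧ q = u := by
      intro p hp q hq hpq
      have hqK := hleave p hp q hq hpq
      have hpv : p = y' := by
        by_contra h
        exact claim p (hall p hp h) ⟨q, hqK, hpq⟩
      subst hpv
      refine ⟨rfl, ?_⟩
      rcases hnb q hpq with rfl | rfl | h
      · exact absurd hqK (hQ1K _ hx)
      · exact absurd hqK (hQ1K _ hx')
      · exact h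
    intro p hp q hq' p' hp' q' hq'' e1 e2
    have a1 := hq p hp q hq' e1
    have a2 := hq p' hp' q' hq'' e2
    exact ⟨a1.1.trans a2.1.symm, a1.2.trans a2.2.symm⟩

end caseI

set_option linter.unusedSectionVars false

section caseI2
variable {V : Type} [Fintype V] {G : SimpleGraph V} {S : Set V}

theorem cn_support {Q : Set V} {a b : V} (p : (res G Q).Walk a b) : Cn G {z | z ∈ p.support} := by
  induction p with
  | @nil r =>
    have : {z | z ∈ (Walk.nil : (res G Q).Walk r r).support} = {r} := by
      ext z; simp
    rw [this]
    exact con_singleton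
  | @cons u v w h p ih =>
    have : {z | z ∈ (Walk.cons h p).support} = insert u {z | z ∈ p.support} := by
      ext z; simp
    rw [this]
    exact con_insert ih (u := v) p.start_mem_support h.1

theorem not_acyclic_two_sets {Q Z T : Set V} {x y x' y' : V} (hZ : Cn G Z) (hT : Cn G T)
    (hdis : Disjoint Z T) (hZQ : Z ⊆ Q) (hTQ : T ⊆ Q) (hx : x ∈ Z) (hx' : x' ∈ Z) (hy : y ∈ T)
    (hy' : y' ∈ T) (h : G.Adj x y) (h' : G.Adj x' y') (hne : ¬ (x = x' ∧ y = y')) :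
    ¬ (res G Q).IsAcyclic := by
  have hyZ : y ∉ Z := fun h => Set.disjoint_left.1 hdis h hy
  have hxT : x ∉ T := fun h => Set.disjoint_left.1 hdis hx h
  refine not_acyclic_of (x := x) (y := y) ⟨h, hZQ hx, hTQ hy⟩ ?_
  have e1 : ((res G Q).deleteEdges {s(x, y)}).Reachable x x' := by
    refine (hZ x hx x' hx').mono ?_
    intro a b hab
    rw [deleteEdges_adj]
    refine ⟨res_mono hZQ hab, ?_⟩
    simp only [Set.mem_singleton_iff, Sym2.eq_iff]
    rintro (⟨_, h⟩ | ⟨h, _⟩)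
    · exact hyZ (h ▸ hab.2.2)
    · exact hyZ (h ▸ hab.2.1)
  have e2 : ((res G Q).deleteEdges {s(x, y)}).Reachable y' y := by
    refine (hT y' hy' y hy).mono ?_
    intro a b hab
    rw [deleteEdges_adj]
    refine ⟨res_mono hTQ hab, ?_⟩
    simp only [Set.mem_singleton_iff, Sym2.eq_iff]
    rintro (⟨h, _⟩ | ⟨_, h⟩)
    · exact hxT (h ▸ hab.2.1)
    · exact hxT (h ▸ hab.2.2)
  refine e1.trans (Reachable.trans (Adj.reachable ?_) e2)
  rw [deleteEdges_adj]
  refine ⟨⟨h', hZQ hx', hTQ hy'⟩, ?_⟩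
  simp only [Set.mem_singleton_iff, Sym2.eq_iff]
  rintro (⟨h1, h2⟩ | ⟨h1, _⟩)
  · exact hne ⟨h1.symm, h2.symm⟩
  · exact hyZ (h1 ▸ hx')

theorem con_compl_comp (hconn : G.Connected) {K : Set V} (hKc : Cn G K) (hKn : K.Nonempty) {x : V}
    (hx : x ∉ K) : Cn G (comp G Kᶜ x)ᶜ := by
  obtain ⟨k, hk⟩ := hKn
  have hKsub : K ⊆ (comp G Kᶜ x)ᶜ := fun z hz h => comp_subset (W := Kᶜ) hx h hz
  have key : ∀ z ∈ (comp G Kᶜ x)ᶜ, (res G (comp G Kᶜ x)ᶜ).Reachable z k := by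
    intro z hz
    by_cases hzK : z ∈ K
    · exact reach_mono hKsub (hKc z hzK k hk)
    · obtain ⟨p, hp, q, hq, hpq⟩ := boundary (hconn.preconnected z k) (comp G Kᶜ z) mem_comp_self
        (fun h => comp_subset (W := Kᶜ) hzK h hk)
      have hqK : q ∈ K := by
        by_contra h
        exact hq (comp_adj (W := Kᶜ) hzK hp h hpq)
      have hsub : comp G Kᶜ z ⊆ (comp G Kᶜ x)ᶜ := by
        intro y hy hy'
        exact hz (Reachable.trans hy' (Reachable.symm hy))
      exact (reach_mono hsub (reach_comp hp)).trans
        ((res_adj_reach hpq (hsub hp) (hKsub hqK)).trans (reach_mono hKsub (hKc q hqK k hk)))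
  exact fun a ha b hb => (key a ha).trans (key b hb).symm

theorem path_third {u w v : V} (P : G.Walk u w) (hP : P.IsPath) (hv : v ∈ P.support) (hvu : v ≠ u)
    (hvw : v ≠ w) (hd : 3 ≤ gdeg G v) : ∃ y, G.Adj v y ∧ s(v, y) ∉ P.edges := by
  by_contra hcon
  push Not at hcon
  obtain ⟨i, hi, hil⟩ := Walk.mem_support_iff_exists_getVert.1 hv
  have h0 : i ≠ 0 := by
    rintro rfl
    exact hvu (by rw [← hi, Walk.getVert_zero])
  have h1 : i < P.length := by
    refine lt_of_le_of_ne hil ?_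
    rintro rfl
    exact hvw (by rw [← hi, Walk.getVert_length])
  have h2 := hP.ncard_neighborSet_toSubgraph_internal_eq_two h0 h1
  rw [hi] at h2
  have : G.neighborSet v ⊆ P.toSubgraph.neighborSet v := by
    intro y hy
    exact Walk.adj_toSubgraph_iff_mem_edges.2 (hcon y hy)
  have h3 := Set.ncard_le_ncard this (Set.toFinite _)
  have h4 : gdeg G v = (G.neighborSet v).ncard := rfl
  omega

theorem caseI_2 (hconn : G.Connected) (hdeg : ∀ v, 3 ≤ gdeg G v)
    (hS : ∀ v, 3 < gdeg G v → v ∈ S) (A : Set V)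
    (hmin : ∀ Y : Set V, Y.Nonempty → Y ⊂ A → ¬ Cut1 G Y)
    (K : Set V) (hKc : Cn G K) (hKn : K.Nonempty) (hRK : Aᶜ ⊆ K)
    (s t w w' : V) (hs : s ∈ S) (ht : t ∈ S) (hst : s ≠ t) (hwK : w ∉ K)
    (hsK : s ∈ K) (htK : t ∈ K) (hsw : G.Adj s w) (htw : G.Adj t w')
    (hww : (res G Kᶜ).Reachable w w') (hQS : ∀ z ∈ comp G Kᶜ w, z ∉ S) :
    SolC G S ∨ SolP G S := by
  classical
  have hK2 := con_compl_comp hconn hKc hKn hwK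
  have hw'Q : w' ∈ comp G Kᶜ w := hww
  have hQK : ∀ z ∈ comp G Kᶜ w, z ∉ K := fun z hz => comp_subset (W := Kᶜ) hwK hz
  have hreach : (res G (comp G Kᶜ w)).Reachable w w' := reach_comp hww
  have hwQ : w ∈ comp G Kᶜ w := mem_comp_self
  revert hK2 hw'Q hQK hreach hwQ hQS
  generalize comp G Kᶜ w = Q
  intro hQS hK2 hw'Q hQK hreach hwQ
  have hQsubA : Q ⊆ A := fun z hz => by
    by_contra h; exact hQK z hz (hRK h)
  by_cases hac : (res G Q).IsAcyclic
  swap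
  · left
    refine lemma1a hconn hdeg hS Qᶜ ⟨s, fun h => hQK s h hsK⟩ hK2 (fun z hz h => hQS z h hz) ?_
    rw [compl_compl]; exact hac
  right
  obtain ⟨p, hp⟩ := hreach.exists_isPath
  have hpQ : ∀ z ∈ p.support, z ∈ Q := by
    intro z hz
    exact reach_mem (p.takeUntil z hz).reachable hwQ
  have hsp : s ∉ p.support := fun h => hQK s (hpQ s h) hsK
  have htp : t ∉ p.support := fun h => hQK t (hpQ t h) htK
  let p' := (p.mapLe (res_le (G := G))).concat htw.symm
  have hp' : p'.IsPath := by
    refine Walk.IsPath.concat ((Walk.isPath_mapLe _).2 hp) ?_ _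
    rw [Walk.support_mapLe_eq_support]; exact htp
  have hp's : ∀ z, z ∈ p'.support ↔ z ∈ p.support ∨ z = t := by
    intro z
    simp only [p', Walk.support_concat, List.concat_eq_append, List.mem_append,
      Walk.support_mapLe_eq_support, List.mem_singleton]
  let P := Walk.cons hsw p'
  have hP : P.IsPath := by
    refine hp'.cons ?_
    rw [hp's]
    rintro (h | h)
    · exact hsp h
    · exact hst h
  have hPe : ∀ e, e ∈ P.edges ↔ e = s(s, w) ∨ e ∈ p.edges ∨ e = s(w', t) := by
    intro e
    simp only [P, p', Walk.edges_cons, Walk.edges_concat, List.concat_eq_append, List.mem_append,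
      Walk.edges_mapLe_eq_edges, List.mem_cons, List.not_mem_nil, or_false]
  have hE : ∀ a b, s(a, b) ∈ P.edges → a ∈ p.support ∨ b ∈ p.support := by
    intro a b hab
    rcases (hPe _).1 hab with h | h | h
    · rw [Sym2.eq_iff] at h
      rcases h with ⟨_, rfl⟩ | ⟨rfl, _⟩
      · exact Or.inr p.start_mem_support
      · exact Or.inl p.start_mem_support
    · exact Or.inl (p.fst_mem_support_of_mem_edges h)
    · rw [Sym2.eq_iff] at h
      rcases h with ⟨rfl, _⟩ | ⟨_, rfl⟩
      · exact Or.inl p.end_mem_support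
      · exact Or.inr p.end_mem_support
  refine P_lemma s t hst hs ht P ?_
  have hadjH : ∀ a b, G.Adj a b → a ∉ p.support → b ∉ p.support →
      (G.deleteEdges {e | e ∈ P.edges}).Adj a b := by
    intro a b hab ha hb
    rw [deleteEdges_adj]
    refine ⟨hab, fun h => ?_⟩
    rcases hE a b h with h | h
    · exact ha h
    · exact hb h
  have ha : ∀ z, z ∉ Q → (G.deleteEdges {e | e ∈ P.edges}).Reachable z s := by
    intro z hz
    refine (hK2 z hz s (fun h => hQK s h hsK)).mono ?_
    intro a b hab
    exact hadjH a b hab.1 (fun h => hab.2.1 (hpQ _ h)) (fun h => hab.2.2 (hpQ _ h))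
  have hb : ∀ z ∈ Q, z ∉ p.support → (G.deleteEdges {e | e ∈ P.edges}).Reachable z s := by
    intro z hz hzp
    let D : Set V := {x | x ∈ Q ∧ x ∉ p.support}
    have hzD : z ∈ D := ⟨hz, hzp⟩
    have hsub : comp G D z ⊆ D := comp_subset hzD
    have hss : comp G D z ⊂ A := by
      refine ⟨fun x hx => hQsubA (hsub hx).1, fun h => ?_⟩
      exact (hsub (h (hQsubA hwQ))).2 p.start_mem_support
    have fin : ∀ x ∈ comp G D z, ∀ y, y ∉ Q → G.Adj x y →
        (G.deleteEdges {e | e ∈ P.edges}).Reachable z s := by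
      intro x hx y hy hxy
      have e1 : (G.deleteEdges {e | e ∈ P.edges}).Reachable z x :=
        Reachable.mono (G := res G D) (fun a b hab => hadjH a b hab.1 hab.2.1.2 hab.2.2.2) hx
      have e2 := hadjH x y hxy (hsub hx).2 (fun h => hy (hpQ _ h))
      exact e1.trans (e2.reachable.trans (ha y hy))
    obtain ⟨x, hx, y, hy, x', hx', y', hy', h1, h2, h3⟩ :=
      two_edges (hmin _ ⟨z, mem_comp_self⟩ hss)
    by_cases hyQ : y ∈ Q
    swap
    · exact fin x hx y hyQ h1
    by_cases hyQ' : y' ∈ Q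
    swap
    · exact fin x' hx' y' hyQ' h2
    have hyp : y ∈ p.support := by
      by_contra h
      exact hy (comp_adj hzD hx ⟨hyQ, h⟩ h1)
    have hyp' : y' ∈ p.support := by
      by_contra h
      exact hy' (comp_adj hzD hx' ⟨hyQ', h⟩ h2)
    refine absurd hac (not_acyclic_two_sets comp_con (cn_support p) ?_ (fun q hq => (hsub hq).1)
      (fun q hq => hpQ q hq) hx hx' hyp hyp' h1 h2 h3)
    rw [Set.disjoint_left]
    intro q hq hq'
    exact (hsub hq).2 hq'
  refine connected_of_center s ?_
  intro v
  by_cases hvQ : v ∈ Q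
  swap
  · exact ha v hvQ
  by_cases hvp : v ∈ p.support
  swap
  · exact hb v hvQ hvp
  have hvP : v ∈ P.support := by
    simp only [P, Walk.support_cons, List.mem_cons]
    exact Or.inr ((hp's v).2 (Or.inl hvp))
  obtain ⟨y, hy, hye⟩ := path_third P hP hvP (by rintro rfl; exact hsp hvp)
    (by rintro rfl; exact htp hvp) (hdeg v)
  have hadj : (G.deleteEdges {e | e ∈ P.edges}).Adj v y := by
    rw [deleteEdges_adj]; exact ⟨hy, hye⟩
  refine hadj.reachable.trans ?_
  by_cases hyQ : y ∈ Q
  swap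
  · exact ha y hyQ
  by_cases hyp : y ∈ p.support
  swap
  · exact hb y hyQ hyp
  exfalso
  refine not_acyclic_of (H := res G Q) (x := v) (y := y) ⟨hy, hvQ, hyQ⟩ ?_ hac
  have htr : ∀ e ∈ p.edges, e ∈ ((res G Q).deleteEdges {s(v, y)}).edgeSet := by
    intro e he
    rw [edgeSet_deleteEdges]
    refine ⟨p.edges_subset_edgeSet he, ?_⟩
    rintro rfl
    exact hye ((hPe _).2 (Or.inr (Or.inl he)))
  have hr : ∀ z ∈ p.support, ((res G Q).deleteEdges {s(v, y)}).Reachable w z := by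
    intro z hz
    have hz' : z ∈ (p.transfer _ htr).support := by rw [Walk.support_transfer]; exact hz
    exact ((p.transfer _ htr).takeUntil z hz').reachable
  exact (hr v hvp).symm.trans (hr y hyp)

theorem caseI (hconn : G.Connected) (hdeg : ∀ v, 3 ≤ gdeg G v)
    (hS : ∀ v, 3 < gdeg G v → v ∈ S) (A : Set V) (hAc : Cn G A) (hRc : Cn G Aᶜ)
    (hmin : ∀ Y : Set V, Y.Nonempty → Y ⊂ A → ¬ Cut1 G Y)
    (s0 t0 : V) (hs0 : s0 ∈ S) (ht0 : t0 ∈ S) (hs0A : s0 ∈ A) (ht0A : t0 ∈ A) (hne : s0 ≠ t0) :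
    SolC G S ∨ SolP G S := by
  have hstart : ∃ K, Ob2 G S Aᶜ K := by
    by_cases hR : (Aᶜ).Nonempty
    · refine ⟨Aᶜ, hRc, hR, le_refl _, s0, hs0, t0, ht0, hne, s0, t0, ⟨fun h => h hs0A, Or.inl rfl⟩,
        ⟨fun h => h ht0A, Or.inl rfl⟩, ?_⟩
      rw [compl_compl]
      exact hAc s0 hs0A t0 ht0A
    · rw [Set.not_nonempty_iff_eq_empty] at hR
      obtain ⟨y, h1, -, -, h4⟩ := first_step
        (con_of_connected hconn s0 trivial t0 trivial) hne.symm
      refine ⟨{s0}, con_singleton, Set.singleton_nonempty _, by rw [hR]; exact Set.empty_subset _,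
        s0, hs0, t0, ht0, hne, y, t0, ⟨?_, Or.inr ⟨rfl, h1⟩⟩, ⟨?_, Or.inl rfl⟩, ?_⟩
      · exact h1.ne'
      · exact hne.symm
      · rw [Set.compl_eq_univ_sdiff]; exact h4
  obtain ⟨K1, hK1⟩ := hstart
  obtain ⟨K, -, hK⟩ := Finite.exists_le_maximal (p := fun K => Ob2 G S Aᶜ K) hK1
  obtain ⟨⟨hKc, hKn, hRK, s, hs, t, ht, hst, w, w', ha, ha', hww⟩, hmaxK⟩ := hK
  have hmax : ∀ v, v ∉ K → ¬ Ob2 G S Aᶜ (insert v K) := by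
    intro v hv h
    exact hv (hmaxK h (Set.subset_insert _ _) (Set.mem_insert _ _))
  have hwQ : w ∈ comp G Kᶜ w := mem_comp_self
  have hw'Q : w' ∈ comp G Kᶜ w := hww
  by_cases hQS : ∃ r ∈ comp G Kᶜ w, r ∈ S
  · right
    obtain ⟨r, hrQ, hrS⟩ := hQS
    have hrK : r ∉ K := comp_subset (W := Kᶜ) ha.1 hrQ
    by_cases h2 : ∃ r' ∈ comp G Kᶜ w, r' ∈ S ∧ r' ≠ r
    · obtain ⟨r', hr'Q, hr'S, hr'⟩ := h2
      exact caseI_1 hconn hdeg hS A hmin K hKc hKn hRK hmax w r' r r' ha.1 hr'S hrS hr' hrQ hr'Q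
        ⟨comp_subset (W := Kᶜ) ha.1 hr'Q, Or.inl rfl⟩ (Or.inl rfl)
    · push Not at h2
      have hQA : comp G Kᶜ w ≠ A := by
        intro h
        have e1 := h2 s0 (h ▸ hs0A) hs0
        have e2 := h2 t0 (h ▸ ht0A) ht0
        exact hne (e1.trans e2.symm)
      by_cases hsr : s = r
      · exact caseI_1 hconn hdeg hS A hmin K hKc hKn hRK hmax w t r w' ha.1 ht hrS
          (fun h => hst (hsr.trans h.symm)) hrQ hw'Q ha' (Or.inr hQA)
      · exact caseI_1 hconn hdeg hS A hmin K hKc hKn hRK hmax w s r w ha.1 hs hrS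
          hsr hrQ hwQ ha (Or.inr hQA)
  · push Not at hQS
    have h1 : s ∈ K ∧ G.Adj s w := by
      rcases ha.2 with h | h
      · exact absurd (h ▸ hs) (hQS w hwQ)
      · exact h
    have h2 : t ∈ K ∧ G.Adj t w' := by
      rcases ha'.2 with h | h
      · exact absurd (h ▸ ht) (hQS w' hw'Q)
      · exact h
    exact caseI_2 hconn hdeg hS A hmin K hKc hKn hRK s t w w' hs ht hst ha.1 h1.1 h2.1 h1.2 h2.2
      hww hQS

end caseI2

set_option linter.unusedSectionVars false

/-- A cyclic enumeration of the vertex set `M`. -/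
structure Cyc {V : Type} (G : SimpleGraph V) (M : Set V) (L : ℕ) (f : ℕ → V) : Prop where
  mem : ∀ i, f i ∈ M
  surj : ∀ z ∈ M, ∃ i < L, f i = z
  adj : ∀ i, G.Adj (f i) (f (i + 1))
  per : ∀ i, f (i + L) = f i
  inj : ∀ i < L, ∀ j < L, f i = f j → i = j
  three : 3 ≤ L

/-- The wheel-like situation. -/
structure Whl {V : Type} [Fintype V] (G : SimpleGraph V) (S A K M : Set V) (s : V) : Prop where
  cut : Cut1 G A
  Kc : Cn G K
  Rc : Cn G Aᶜ
  Rn : (Aᶜ).Nonempty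
  RK : Aᶜ ⊆ K
  sS : s ∈ S
  sA : s ∈ A
  Ssub : S ⊆ insert s Aᶜ
  sK : s ∉ K
  sn : ∀ u ∈ K, ¬ G.Adj s u
  Mc : M = (insert s K)ᶜ
  d3 : ∀ v ∈ M, gdeg G v = 3
  d2 : ∀ v ∈ M, dg G M v = 2

section caseII
variable {V : Type} [Fintype V] {G : SimpleGraph V} {S : Set V}

theorem Cyc.shift1 {M : Set V} {L : ℕ} {f : ℕ → V} (h : Cyc G M L f) :
    Cyc G M L (fun i => f (i + 1)) where
  mem i := h.mem _
  surj z hz := by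
    obtain ⟨i, hi, rfl⟩ := h.surj z hz
    rcases i with _ | i
    · refine ⟨L - 1, by have := h.three; omega, ?_⟩
      have h1 : L - 1 + 1 = 0 + L := by have := h.three; omega
      simp only [h1]
      exact h.per 0
    · exact ⟨i, by omega, rfl⟩
  adj i := h.adj _
  per i := by
    have := h.per (i + 1)
    rw [← this]
    congr 1
    omega
  inj i hi j hj hij := by
    have h0 : f L = f 0 := by have := h.per 0; rwa [Nat.zero_add] at this
    by_cases h1 : i + 1 = L
    · by_cases h2 : j + 1 = L
      · omega
      · simp only [h1, h0] at hij
        have := h.inj 0 (by omega) (j + 1) (by omega) hij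
        omega
    · by_cases h2 : j + 1 = L
      · simp only [h2, h0] at hij
        have := h.inj (i + 1) (by omega) 0 (by omega) hij
        omega
      · have := h.inj (i + 1) (by omega) (j + 1) (by omega) hij
        omega
  three := h.three

theorem Cyc.shift {M : Set V} {L : ℕ} {f : ℕ → V} (h : Cyc G M L f) (t : ℕ) :
    Cyc G M L (fun i => f (i + t)) := by
  induction t with
  | zero => exact h
  | succ t ih =>
    have := ih.shift1
    have e : (fun i => f (i + (t + 1))) = fun i => (fun i => f (i + t)) (i + 1) := by
      funext i
      show f (i + (t + 1)) = f (i + 1 + t)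
      congr 1
      omega
    rw [e]
    exact this

theorem cyc_of_walk {M : Set V} {b : V} (c : G.Walk b b) (hc : c.IsCycle)
    (hsup : ∀ z, z ∈ c.support ↔ z ∈ M) : ∃ L f, Cyc G M L f := by
  have h3 := hc.three_le_length
  refine ⟨c.length, fun i => c.getVert (i % c.length), ?_, ?_, ?_, ?_, ?_, h3⟩
  · intro i
    exact (hsup _).1 (c.getVert_mem_support _)
  · intro z hz
    obtain ⟨i, hi, hil⟩ := Walk.mem_support_iff_exists_getVert.1 ((hsup z).2 hz)
    by_cases h : i = c.length
    · refine ⟨0, by omega, ?_⟩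
      rw [Nat.zero_mod, c.getVert_zero, ← hi, h, c.getVert_length]
    · refine ⟨i, by omega, ?_⟩
      rw [Nat.mod_eq_of_lt (by omega), hi]
  · intro i
    have hlt : i % c.length < c.length := Nat.mod_lt _ (by omega)
    have h1 := c.adj_getVert_succ hlt
    by_cases h : i % c.length + 1 = c.length
    · rw [h, c.getVert_length] at h1
      have : (i + 1) % c.length = 0 := by
        rw [Nat.add_mod, Nat.mod_eq_of_lt (by omega : 1 < c.length), h, Nat.mod_self]
      simp only [this, c.getVert_zero]
      exact h1
    · have : (i + 1) % c.length = i % c.length + 1 := by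
        rw [Nat.add_mod, Nat.mod_eq_of_lt (by omega : 1 < c.length), Nat.mod_eq_of_lt (by omega)]
      simp only [this]
      exact h1
  · intro i
    simp
  · intro i hi j hj hij
    simp only [Nat.mod_eq_of_lt hi, Nat.mod_eq_of_lt hj] at hij
    exact hc.getVert_injOn' (by rw [Set.mem_ofPred_eq]; omega) (by rw [Set.mem_ofPred_eq]; omega) hij

/-- The main reduction: either an induced cycle exists or we are in the wheel situation. -/
theorem caseII_red (hconn : G.Connected) (hdeg : ∀ v, 3 ≤ gdeg G v)
    (hS : ∀ v, 3 < gdeg G v → v ∈ S) (A : Set V) (hAn : A.Nonempty) (hcut : Cut1 G A)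
    (hRc : Cn G Aᶜ)
    (hone : ∀ x ∈ A, ∀ y ∈ A, x ∈ S → y ∈ S → x = y) :
    SolC G S ∨ ∃ K M s L f, Whl G S A K M s ∧ Cyc G M L f ∧
      ∃ v ∈ M, ∃ u ∈ K, G.Adj v u := by
  classical
  by_cases hRn : (Aᶜ).Nonempty
  swap
  · left
    have hA : ∀ x, x ∈ A := fun x => by
      by_contra h; exact hRn ⟨x, h⟩
    obtain ⟨r, hr⟩ : ∃ r, S ⊆ {r} := by
      by_cases hSn : S.Nonempty
      · obtain ⟨r, hr⟩ := hSn
        exact ⟨r, fun x hx => hone x (hA x) r (hA r) hx hr⟩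
      · obtain ⟨r, _⟩ := hAn
        exact ⟨r, fun x hx => absurd ⟨x, hx⟩ hSn⟩
    obtain ⟨y, hy, -, -⟩ := exists_third (hdeg r) r r
    refine lemma1a' hconn hdeg hS {r} (Set.singleton_nonempty _) con_singleton hr
      ⟨y, hy.ne'⟩ ?_
    intro v _ a ha b hb _ _
    rw [Set.mem_singleton_iff] at ha hb
    rw [ha, hb]
  by_cases hSA : ∃ s ∈ A, s ∈ S
  swap
  · left
    push Not at hSA
    refine lemma1a' hconn hdeg hS Aᶜ hRn hRc (fun x hx h => hSA x h hx) (by rwa [compl_compl]) ?_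
    intro v hv y hy y' hy' h1 h2
    rw [Set.mem_compl_iff, not_not] at hv
    exact (hcut v hv y hy v hv y' hy' h1 h2).2
  obtain ⟨s, hsA, hsS⟩ := hSA
  have hSsub : S ⊆ insert s Aᶜ := by
    intro x hx
    by_cases hxA : x ∈ A
    · exact Or.inl (hone x hxA s hsA hx hsS)
    · exact Or.inr hxA
  by_cases hsR : ∃ r ∈ Aᶜ, G.Adj s r
  · left
    obtain ⟨r, hr, hsr⟩ := hsR
    obtain ⟨y, hy, hyr, -⟩ := exists_third (hdeg s) r r
    refine lemma1a' hconn hdeg hS (insert s Aᶜ) (Set.insert_nonempty _ _) (con_insert hRc hr hsr)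
      hSsub ⟨y, ?_⟩ ?_
    · rintro (h | h)
      · exact hy.ne h.symm
      · exact hyr (hcut s hsA y h s hsA r hr hy hsr).2
    · have : ∀ v, v ∉ insert s Aᶜ → ∀ y ∈ insert s Aᶜ, G.Adj v y → y = s := by
        rintro v hv y (h | h) hvy
        · exact h
        · have hvA : v ∈ A := by
            by_contra h'; exact hv (Or.inr h')
          exact absurd (hcut v hvA y h s hsA r hr hvy hsr).1 (fun h => hv (Or.inl h))
      intro v hv y hy y' hy' h1 h2
      rw [this v hv y hy h1, this v hv y' hy' h2]
  push Not at hsR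
  have hW0 : ¬ (res G (insert s Aᶜ)ᶜ).IsAcyclic := by
    intro hac
    obtain ⟨r0, hr0⟩ := hRn
    obtain ⟨a, ha, a', ha', haa⟩ := boundary (hconn.preconnected s r0) A hsA hr0
    have has : a ≠ s := by rintro rfl; exact hsR a' ha' haa
    generalize hW : (insert s Aᶜ)ᶜ = W at hac
    have hmemW : ∀ z, z ∈ W ↔ z ≠ s ∧ z ∈ A := by
      intro z
      rw [← hW, ins_compl, compl_compl]
      simp only [Set.mem_sdiff, Set.mem_singleton_iff]
      tauto
    have haW : a ∈ W := (hmemW a).2 ⟨has, ha⟩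
    have h2 : ∀ v ∈ W, v ≠ a → 2 ≤ dg G W v := by
      intro v hv hva
      have hvA := ((hmemW v).1 hv).2
      have := dg_ge_of (G := G) (v := v) W s (by
        intro y hy
        by_cases hys : y = s
        · exact Or.inr hys
        · left
          refine (hmemW y).2 ⟨hys, ?_⟩
          by_contra hyA
          exact hva (hcut v hvA y hyA a ha a' ha' hy haa).1)
      have := hdeg v
      omega
    have h1 : 1 ≤ dg G W a := by
      obtain ⟨y, hy, hys, hya⟩ := exists_third (hdeg a) s a'
      have : y ∈ G.neighborSet a ∩ W := by
        refine ⟨hy, (hmemW y).2 ⟨hys, ?_⟩⟩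
        by_contra hyA
        exact hya (hcut a ha y hyA a ha a' ha' hy haa).2
      have : 0 < (G.neighborSet a ∩ W).ncard := (Set.ncard_pos (Set.toFinite _)).2 ⟨y, this⟩
      exact this
    have hWF : ((W.toFinset : Finset V) : Set V) = W := Set.coe_toFinset W
    have haF : a ∈ W.toFinset := by simpa using haW
    have hcp : 0 < W.toFinset.card := Finset.card_pos.2 ⟨a, haF⟩
    have hsum := acyclic_sum (G := G) (W.toFinset.card - 1) W.toFinset (by omega)
      (by rw [hWF]; exact hac)
    rw [hWF, ← Finset.add_sum_erase _ _ haF] at hsum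
    have hle : ∑ x ∈ W.toFinset.erase a, 2 ≤ ∑ x ∈ W.toFinset.erase a, dg G W x := by
      refine Finset.sum_le_sum ?_
      intro x hx
      rw [Finset.mem_erase] at hx
      exact h2 x (by simpa using hx.2) hx.1
    rw [Finset.sum_const, smul_eq_mul, Finset.card_erase_of_mem haF] at hle
    omega
  obtain ⟨K, -, hK⟩ := Finite.exists_le_maximal
    (p := fun K : Set V => Aᶜ ⊆ K ∧ Cn G K ∧ ¬ (res G (insert s K)ᶜ).IsAcyclic)
    (a := Aᶜ) ⟨le_refl _, hRc, hW0⟩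
  obtain ⟨⟨hRK, hKc, hKna⟩, hmaxK⟩ := hK
  have hKn : K.Nonempty := hRn.mono hRK
  have hSK : S ⊆ insert s K := hSsub.trans (Set.insert_subset_insert hRK)
  by_cases hsK : s ∈ K
  · left
    rw [Set.insert_eq_of_mem hsK] at hKna hSK
    exact lemma1a hconn hdeg hS K hKn hKc hSK hKna
  by_cases hsn : ∃ u ∈ K, G.Adj s u
  · left
    obtain ⟨u, hu, hsu⟩ := hsn
    exact lemma1a hconn hdeg hS (insert s K) (Set.insert_nonempty _ _) (con_insert hKc hu hsu)
      hSK hKna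
  push Not at hsn
  right
  obtain ⟨k0, hk0⟩ := hKn
  obtain ⟨u0, hu0, v0, hv0, huv⟩ := boundary (hconn.preconnected k0 s) K hk0 hsK
  have hv0M : v0 ∈ (insert s K)ᶜ := by
    rintro (h | h)
    · rw [h] at huv; exact hsn u0 hu0 huv.symm
    · exact hv0 h
  have hd3 : ∀ v ∈ (insert s K)ᶜ, gdeg G v = 3 := fun v hv =>
    deg_three hdeg hS (fun h => hv (hSK h))
  obtain ⟨hall, hc⟩ := cyc_lemma (G := G) K (insert s K)ᶜ s v0 u0
    (by
      rw [Set.disjoint_left]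
      intro z hz hz'
      exact hz' (Or.inr hz))
    hd3
    (fun v hv y _ => by
      by_cases h : y ∈ K
      · exact Or.inl h
      · by_cases h' : y = s
        · exact Or.inr (Or.inr h')
        · refine Or.inr (Or.inl ?_)
          rintro (g | g)
          · exact h' g
          · exact h g)
    hKna
    (by
      rintro v hv ⟨u, hu, hvu⟩
      by_contra hna
      rw [← ins_compl, Set.insert_comm] at hna
      exact hv (Or.inr (hmaxK ⟨hRK.trans (Set.subset_insert _ _), con_insert hKc hu hvu, hna⟩
        (Set.subset_insert _ _) (Set.mem_insert _ _))))
    hv0M hu0 huv.symm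
  obtain ⟨c, hcc, hsup, -⟩ := hc v0 hv0M
  obtain ⟨L, f, hf⟩ := cyc_of_walk c hcc hsup
  exact ⟨K, (insert s K)ᶜ, s, L, f,
    ⟨hcut, hKc, hRc, hRn, hRK, hsS, hsA, hSsub, hsK, hsn, rfl, hd3, hall⟩, hf, v0, hv0M, u0, hu0,
    huv.symm⟩

end caseII

set_option linter.unusedSectionVars false

section wheel
variable {V : Type} [Fintype V] {G : SimpleGraph V} {S A K M : Set V} {s : V} {L : ℕ} {f : ℕ → V}

theorem Whl.outer (W : Whl G S A K M s) {v : V} (hv : v ∈ M) :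
    ∃ o, G.Adj v o ∧ o ∉ M ∧ ∀ z, G.Adj v z → z ∉ M → z = o := by
  have h3 : (G.neighborSet v).ncard = 3 := W.d3 v hv
  have h2 : (G.neighborSet v ∩ M).ncard = 2 := W.d2 v hv
  have h := Set.ncard_inter_add_ncard_sdiff_eq_ncard (G.neighborSet v) M (Set.toFinite _)
  have h1 : (G.neighborSet v \ M).ncard = 1 := by omega
  obtain ⟨o, ho⟩ := Set.ncard_eq_one.1 h1
  have hm : o ∈ G.neighborSet v \ M := by rw [ho]; rfl
  refine ⟨o, hm.1, hm.2, fun z hz hzM => ?_⟩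
  have : z ∈ G.neighborSet v \ M := ⟨hz, hzM⟩
  rw [ho] at this
  exact this

theorem Whl.mem_iff (W : Whl G S A K M s) {v : V} : v ∈ M ↔ v ≠ s ∧ v ∉ K := by
  rw [W.Mc]; simp

theorem Whl.sM (W : Whl G S A K M s) : s ∉ M := fun h => (W.mem_iff.1 h).1 rfl

theorem Whl.KM (W : Whl G S A K M s) {v : V} (hv : v ∈ K) : v ∉ M := fun h => (W.mem_iff.1 h).2 hv

theorem Whl.NT (W : Whl G S A K M s) {v : V} (hv : v ∈ M) : (∃ u ∈ K, G.Adj v u) ∨ G.Adj v s := by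
  obtain ⟨o, h1, h2, -⟩ := W.outer hv
  by_cases h : o = s
  · subst h; exact Or.inr h1
  · left
    refine ⟨o, ?_, h1⟩
    by_contra hK
    exact h2 (W.mem_iff.2 ⟨h, hK⟩)

theorem Whl.NTx (W : Whl G S A K M s) {v u : V} (hv : v ∈ M) (hu : u ∈ K) (h : G.Adj v u) :
    ¬ G.Adj v s := by
  intro h'
  obtain ⟨o, h1, h2, h3⟩ := W.outer hv
  have e1 := h3 u h (W.KM hu)
  have e2 := h3 s h' W.sM
  exact W.sK (by rw [e2, ← e1]; exact hu)

theorem Whl.sT (W : Whl G S A K M s) {v : V} (h : G.Adj s v) : v ∈ M :=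
  W.mem_iff.2 ⟨h.ne', fun hK => W.sn v hK h⟩

theorem Whl.MA (W : Whl G S A K M s) {v : V} (h : v ∈ M) : v ∈ A := by
  by_contra hA
  exact (W.mem_iff.1 h).2 (W.RK hA)

theorem Whl.MS (W : Whl G S A K M s) {v : V} (h : v ∈ M) : v ∉ S := by
  intro hS
  rcases W.Ssub hS with rfl | h'
  · exact W.sM h
  · exact h' (W.MA h)

theorem Cyc.ne2 (C : Cyc G M L f) (i : ℕ) : f i ≠ f (i + 2) := by
  intro h
  have C' := C.shift i
  have := C.three
  have := C'.inj 0 (by omega) 2 (by omega) (by simpa [Nat.add_comm] using h)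
  omega

theorem Cyc.nbr (W : Whl G S A K M s) (C : Cyc G M L f) (i : ℕ) {z : V} (hz : z ∈ M)
    (h : G.Adj (f (i + 1)) z) : z = f i ∨ z = f (i + 2) := by
  have h2 : (G.neighborSet (f (i + 1)) ∩ M).ncard = 2 := W.d2 _ (C.mem _)
  have hs : ({f i, f (i + 2)} : Set V) ⊆ G.neighborSet (f (i + 1)) ∩ M := by
    rintro x (rfl | rfl)
    · exact ⟨(C.adj i).symm, C.mem _⟩
    · exact ⟨C.adj (i + 1), C.mem _⟩
  have e := Set.eq_of_subset_of_ncard_le hs (by rw [h2, Set.ncard_pair (C.ne2 i)]) (Set.toFinite _)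
  have : z ∈ ({f i, f (i + 2)} : Set V) := by rw [e]; exact ⟨h, hz⟩
  simpa using this

theorem arc_con (hadj : ∀ i, G.Adj (f i) (f (i + 1))) (a n : ℕ) :
    Cn G {z | ∃ i, a ≤ i ∧ i ≤ a + n ∧ f i = z} := by
  induction n with
  | zero =>
    have : {z | ∃ i, a ≤ i ∧ i ≤ a + 0 ∧ f i = z} = {f a} := by
      ext z
      constructor
      · rintro ⟨i, h1, h2, rfl⟩
        have : i = a := by omega
        rw [this]; rfl
      · rintro rfl
        exact ⟨a, le_refl _, le_refl _, rfl⟩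
    rw [this]
    exact con_singleton
  | succ n ih =>
    have : {z | ∃ i, a ≤ i ∧ i ≤ a + (n + 1) ∧ f i = z} =
        insert (f (a + n + 1)) {z | ∃ i, a ≤ i ∧ i ≤ a + n ∧ f i = z} := by
      ext z
      constructor
      · rintro ⟨i, h1, h2, rfl⟩
        by_cases h : i = a + n + 1
        · left; rw [h]
        · exact Or.inr ⟨i, h1, by omega, rfl⟩
      · rintro (rfl | ⟨i, h1, h2, rfl⟩)
        · exact ⟨a + n + 1, by omega, by omega, rfl⟩
        · exact ⟨i, h1, by omega, rfl⟩
    rw [this]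
    exact con_insert ih (u := f (a + n)) ⟨a + n, by omega, by omega, rfl⟩ (hadj _).symm

theorem Cyc.z (C : Cyc G M L f) : f L = f 0 := by
  have := C.per 0
  rwa [Nat.zero_add] at this

/-- Injectivity on `1..L`. -/
theorem Cyc.inj' (C : Cyc G M L f) {i j : ℕ} (hi : 1 ≤ i) (hiL : i ≤ L) (hj : 1 ≤ j) (hjL : j ≤ L)
    (h : f i = f j) : i = j := by
  have C' := C.shift 1
  have := C'.inj (i - 1) (by omega) (j - 1) (by omega)
    (by simpa [Nat.sub_add_cancel hi, Nat.sub_add_cancel hj] using h)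
  omega

theorem lemmaX (hconn : G.Connected) (hdeg : ∀ v, 3 ≤ gdeg G v)
    (hS : ∀ v, 3 < gdeg G v → v ∈ S) (W : Whl G S A K M s) (C : Cyc G M L f) {d e t : ℕ}
    (hd : 0 < d) (hde : d < e) (heL : e < L) (ht : 0 < t) (hte : t < e) (hT : G.Adj (f t) s)
    {U : Set V} (hU : Aᶜ ⊆ U) (hUK : U ⊆ K) (hUc : Cn G U) {k0 kd ke : V}
    (hkd : kd ∈ U) (hk0 : k0 ∈ K \ U)
    (a0 : G.Adj (f 0) k0) (ad : G.Adj (f d) kd) (ae : G.Adj (f e) ke)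
    (hr : (res G (K \ U)).Reachable k0 ke) : SolC G S := by
  have hB := arc_con C.adj 1 (e - 2)
  set B : Set V := {z | ∃ i, 1 ≤ i ∧ i ≤ 1 + (e - 2) ∧ f i = z} with hBdef
  have hT' := arc_con C.adj e (L - e)
  set T : Set V := {z | ∃ i, e ≤ i ∧ i ≤ e + (L - e) ∧ f i = z} with hTdef
  have h1 : Cn G (U ∪ B) := con_union hUc hB hkd (v := f d) ⟨d, by omega, by omega, rfl⟩ ad.symm
  have h2 : Cn G (insert s (U ∪ B)) :=
    con_insert h1 (u := f t) (Or.inr ⟨t, by omega, by omega, rfl⟩) hT.symm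
  refine lemma1a hconn hdeg hS _ ⟨s, Or.inl rfl⟩ h2 ?_ ?_
  · intro z hz
    rcases W.Ssub hz with rfl | h
    · exact Or.inl rfl
    · exact Or.inr (Or.inl (hU h))
  · have hTM : ∀ z ∈ T, z ∈ M := by
      rintro z ⟨i, -, -, rfl⟩
      exact C.mem _
    have hBM : ∀ z ∈ B, z ∈ M := by
      rintro z ⟨i, -, -, rfl⟩
      exact C.mem _
    have hZs : comp G (K \ U) k0 ⊆ K \ U := comp_subset hk0
    refine not_acyclic_two_sets (Z := comp G (K \ U) k0) (T := T) (x := k0) (y := f L) (x' := ke)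
      (y' := f e) comp_con hT' ?_ ?_ ?_ mem_comp_self hr ⟨L, by omega, by omega, rfl⟩
      ⟨e, by omega, by omega, rfl⟩ ?_ ae.symm ?_
    · exact Set.disjoint_left.2 fun z hz hzT => W.KM (hZs hz).1 (hTM z hzT)
    · intro z hz
      have hz' := hZs hz
      rintro (rfl | h | h)
      · exact W.sK hz'.1
      · exact hz'.2 h
      · exact W.KM hz'.1 (hBM z h)
    · intro z hz
      have hzM := hTM z hz
      rintro (rfl | h | h)
      · exact W.sM hzM
      · exact W.KM (hUK h) hzM
      · obtain ⟨i, hi1, hi2, hi3⟩ := h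
        obtain ⟨j, hj1, hj2, hj3⟩ := hz
        have := C.inj' (by omega) (by omega) (by omega) (by omega) (hi3.trans hj3.symm)
        omega
    · rw [C.z]; exact a0.symm
    · rintro ⟨-, h⟩
      have := C.inj' (by omega) (by omega) (by omega) (by omega) h
      omega

/-- Choosing the set `U`. -/
theorem lemmaY (hdeg : ∀ v, 3 ≤ gdeg G v)
    (hS : ∀ v, 3 < gdeg G v → v ∈ S) (W : Whl G S A K M s) (n κ : Fin 3 → V)
    (hn : ∀ i, n i ∈ M) (hinj : Function.Injective n) (hκ : ∀ i, κ i ∈ K)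
    (hadj : ∀ i, G.Adj (n i) (κ i)) :
    ∃ U : Set V, Aᶜ ⊆ U ∧ U ⊆ K ∧ Cn G U ∧ ∃ i, κ i ∈ U ∧
      ∀ j l, j ≠ i → l ≠ i → κ j ∈ K \ U ∧ κ l ∈ K \ U ∧
        (res G (K \ U)).Reachable (κ j) (κ l) := by
  -- at least one of the three has its outer neighbour in `A`
  have hA0 : ∃ i, κ i ∈ A := by
    by_contra h
    push Not at h
    have := W.cut (n 0) (W.MA (hn 0)) _ (h 0) (n 1) (W.MA (hn 1)) _ (h 1) (hadj 0) (hadj 1)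
    exact absurd (hinj this.1) (by decide)
  obtain ⟨i0, hi0⟩ := hA0
  obtain ⟨r, hr⟩ := W.Rn
  obtain ⟨a, ha, b, hb, hab⟩ := boundary (W.Kc (κ i0) (hκ i0) r (W.RK hr)) A hi0 hr
  have hκA : ∀ i, κ i ∈ A := by
    intro i
    by_contra h
    have := W.cut _ (W.MA (hn i)) _ h a ha b hb (hadj i) hab.1
    exact W.KM hab.2.1 (this.1 ▸ hn i)
  have hconnA : ∀ z ∈ K, z ∈ A → (res G (K \ Aᶜ)).Reachable z a := by
    intro z hz hzA
    obtain ⟨a', ha', b', hb', hab'⟩ := boundary (W.Kc z hz r (W.RK hr)) (comp G (K \ Aᶜ) z)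
      mem_comp_self (fun h => (comp_subset (W := K \ Aᶜ) ⟨hz, fun h => h hzA⟩ h).2 hr)
    have ha'' := comp_subset (W := K \ Aᶜ) ⟨hz, fun h => h hzA⟩ ha'
    have hb'' : b' ∉ A := fun h => hb' (comp_adj (W := K \ Aᶜ) ⟨hz, fun h => h hzA⟩ ha'
      ⟨hab'.2.2, fun h' => h' h⟩ hab'.1)
    have := W.cut a' (not_not.1 ha''.2) b' hb'' a ha b hb hab'.1 hab.1
    rw [← this.1]
    exact ha'
  obtain ⟨U, -, hU⟩ := Finite.exists_le_maximal
    (p := fun U : Set V => Aᶜ ⊆ U ∧ U ⊆ K ∧ Cn G U ∧ ∃ i j, i ≠ j ∧ κ i ∈ K \ U ∧ κ j ∈ K \ U ∧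
      (res G (K \ U)).Reachable (κ i) (κ j))
    (a := Aᶜ) ⟨le_refl _, W.RK, W.Rc, 0, 1, by decide, ⟨hκ 0, fun h => h (hκA 0)⟩,
      ⟨hκ 1, fun h => h (hκA 1)⟩,
      (hconnA _ (hκ 0) (hκA 0)).trans (hconnA _ (hκ 1) (hκA 1)).symm⟩
  obtain ⟨⟨hAU, hUK, hUc, i, j, hij, hi, hj, hrij⟩, hmax⟩ := hU
  have hmax' : ∀ U', U ⊂ U' → U' ⊆ K → Cn G U' → ∀ i j, i ≠ j → κ i ∈ K \ U' → κ j ∈ K \ U' →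
      ¬ (res G (K \ U')).Reachable (κ i) (κ j) := by
    intro U' h1 h2 h3 i j h4 h5 h6 h7
    exact h1.2 (hmax (y := U') ⟨hAU.trans h1.1, h2, h3, i, j, h4, h5, h6, h7⟩ h1.1)
  obtain ⟨k, hki, hkj⟩ : ∃ k : Fin 3, k ≠ i ∧ k ≠ j :=
    (by decide : ∀ i j : Fin 3, ∃ k : Fin 3, k ≠ i ∧ k ≠ j) i j
  have hall : ∀ l, l ≠ k → l = i ∨ l = j :=
    (by decide : ∀ i j k : Fin 3, i ≠ j → k ≠ i → k ≠ j → ∀ l, l ≠ k → l = i ∨ l = j)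
      i j k hij hki hkj
  have hdone : κ k ∈ U → ∃ U : Set V, Aᶜ ⊆ U ∧ U ⊆ K ∧ Cn G U ∧ ∃ i, κ i ∈ U ∧
      ∀ j l, j ≠ i → l ≠ i → κ j ∈ K \ U ∧ κ l ∈ K \ U ∧
        (res G (K \ U)).Reachable (κ j) (κ l) := by
    intro hkU
    refine ⟨U, hAU, hUK, hUc, k, hkU, ?_⟩
    intro p q hp hq
    rcases hall p hp with rfl | rfl <;> rcases hall q hq with rfl | rfl
    · exact ⟨hi, hi, Reachable.refl _⟩
    · exact ⟨hi, hj, hrij⟩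
    · exact ⟨hj, hi, hrij.symm⟩
    · exact ⟨hj, hj, Reachable.refl _⟩
  by_contra hcon
  have hkU : κ k ∉ U := fun h => hcon (hdone h)
  have hk : κ k ∈ K \ U := ⟨hκ k, hkU⟩
  have hrU : r ∈ U := hAU hr
  -- an edge from the component of a vertex to `U`
  have hedge : ∀ z ∈ K \ U, ∃ v ∈ comp G (K \ U) z, ∃ u ∈ U, G.Adj v u := by
    intro z hz
    obtain ⟨a', ha', b', hb', hab'⟩ := boundary (W.Kc z hz.1 r (W.RK hr)) (comp G (K \ U) z)
      mem_comp_self (fun h => (comp_subset (W := K \ U) hz h).2 hrU)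
    refine ⟨a', ha', b', ?_, hab'.1⟩
    by_contra h
    exact hb' (comp_adj (W := K \ U) hz ha' ⟨hab'.2.2, h⟩ hab'.1)
  by_cases hrk : (res G (K \ U)).Reachable (κ i) (κ k)
  · -- all in the same component
    obtain ⟨v, hv, u, hu, hvu⟩ := hedge _ hi
    have hvKU := comp_subset hi hv
    have hrall : ∀ l, κ l ∈ K \ U ∧ (res G (K \ U)).Reachable v (κ l) := by
      intro l
      by_cases hl : l = k
      · subst hl; exact ⟨hk, Reachable.trans (Reachable.symm hv) hrk⟩
      · rcases hall l hl with rfl | rfl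
        · exact ⟨hi, Reachable.symm hv⟩
        · exact ⟨hj, Reachable.trans (Reachable.symm hv) hrij⟩
    have hvS : v ∉ S := by
      intro h
      rcases W.Ssub h with rfl | h'
      · exact W.sK hvKU.1
      · exact hvKU.2 (hAU h')
    have hv3 := deg_three hdeg hS hvS
    have hy : ∀ l, ∃ y, G.Adj v y ∧ y ≠ u ∧ ((y = n l ∧ κ l = v) ∨ (κ l ≠ v ∧ y ∈ K \ U ∧
        (res G ((K \ U) \ {v})).Reachable y (κ l))) := by
      intro l
      by_cases h : κ l = v
      · refine ⟨n l, ?_, ?_, Or.inl ⟨rfl, h⟩⟩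
        · rw [← h]; exact (hadj l).symm
        · intro h'
          exact W.KM (hUK hu) (h' ▸ hn l)
      · obtain ⟨y, h1, h2, -, h3⟩ := first_step (hrall l).2 h
        exact ⟨y, h1, fun h' => h2.2 (h' ▸ hu), Or.inr ⟨h, h2, h3⟩⟩
    choose y hy1 hy2 hy3 using hy
    have hpig : ∃ p q, p ≠ q ∧ y p = y q := by
      by_contra hc
      push Not at hc
      have h01 := hc 0 1 (by decide)
      have h02 := hc 0 2 (by decide)
      have h12 := hc 1 2 (by decide)
      rcases deg3_mem hv3 (hy1 0) (hy1 1) (hy1 2) h01 h02 h12 hvu with h | h | h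
      · exact hy2 _ h.symm
      · exact hy2 _ h.symm
      · exact hy2 _ h.symm
    obtain ⟨p, q, hpq, hypq⟩ := hpig
    rcases hy3 p with ⟨e1, e2⟩ | ⟨e1, e2, e3⟩
    · rcases hy3 q with ⟨g1, g2⟩ | ⟨g1, g2, g3⟩
      · exact hpq (hinj (by rw [← e1, ← g1, hypq]))
      · rw [← hypq, e1] at g2
        exact W.KM g2.1 (hn p)
    · rcases hy3 q with ⟨g1, g2⟩ | ⟨g1, g2, g3⟩
      · rw [hypq, g1] at e2
        exact W.KM e2.1 (hn q)
      · have hset : K \ insert v U = (K \ U) \ {v} := by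
          ext z; simp only [Set.mem_sdiff, Set.mem_insert_iff, Set.mem_singleton_iff]; tauto
        refine hmax' (insert v U) (Set.ssubset_insert hvKU.2)
          (Set.insert_subset hvKU.1 hUK) (con_insert hUc hu hvu) p q hpq ?_ ?_ ?_
        · rw [hset]; exact ⟨(hrall p).1, e1⟩
        · rw [hset]; exact ⟨(hrall q).1, g1⟩
        · rw [hset]
          rw [← hypq] at g3
          exact e3.symm.trans g3
  · obtain ⟨v, hv, u, hu, hvu⟩ := hedge _ hk
    have hcs := comp_subset (G := G) hk
    have hni : κ i ∉ comp G (K \ U) (κ k) := fun h => hrk (Reachable.symm h)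
    have hnj : κ j ∉ comp G (K \ U) (κ k) := fun h => hrk (Reachable.trans hrij (Reachable.symm h))
    refine hmax' (U ∪ comp G (K \ U) (κ k)) ⟨Set.subset_union_left, fun h => ?_⟩
      (Set.union_subset hUK fun z hz => (hcs hz).1) (con_union hUc comp_con hu hv hvu.symm) i j hij
      ⟨hi.1, ?_⟩ ⟨hj.1, ?_⟩ ?_
    · exact hkU (h (Or.inr mem_comp_self))
    · rintro (h | h)
      · exact hi.2 h
      · exact hni h
    · rintro (h | h)
      · exact hj.2 h
      · exact hnj h
    · refine reach_sub hrij fun z hz => ?_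
      have hz' := reach_mem hz hi
      refine ⟨hz'.1, ?_⟩
      rintro (h | h)
      · exact hz'.2 h
      · exact hrk (Reachable.trans hz (Reachable.symm h))

end wheel

set_option linter.unusedSectionVars false

section wheel2
variable {V : Type} [Fintype V] {G : SimpleGraph V} {S A K M : Set V} {s : V} {L : ℕ} {f : ℕ → V}

theorem con_of_attach {X : Set V} (hK : Cn G K) (hKX : K ⊆ X)
    (h : ∀ z ∈ X, z ∈ K ∨ ∃ u ∈ K, G.Adj z u) : Cn G X := by
  have key : ∀ z ∈ X, ∃ u ∈ K, (res G X).Reachable z u := by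
    intro z hz
    rcases h z hz with h | ⟨u, hu, ha⟩
    · exact ⟨z, h, Reachable.refl _⟩
    · exact ⟨u, hu, res_adj_reach ha hz (hKX hu)⟩
  intro a ha b hb
  obtain ⟨u, hu, hau⟩ := key a ha
  obtain ⟨w, hw, hbw⟩ := key b hb
  exact (hau.trans (reach_mono hKX (hK u hu w hw))).trans hbw.symm

theorem induce_connected {X : Set V} (hX : Cn G X) (hn : X.Nonempty) : (G.induce X).Connected := by
  obtain ⟨x0, hx0⟩ := hn
  have : Nonempty X := ⟨⟨x0, hx0⟩⟩
  refine Connected.mk ?_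
  rintro ⟨x, hx⟩ ⟨y, hy⟩
  have : y ∈ {y | ∃ hy : y ∈ X, (G.induce X).Reachable ⟨x, hx⟩ ⟨y, hy⟩} := by
    refine reach_closed (hX x hx y hy) _ ⟨hx, Reachable.refl _⟩ ?_
    rintro u v ⟨hu, hr⟩ huv
    refine ⟨huv.2.2, hr.trans (Adj.reachable ?_)⟩
    exact huv.1
  exact this.2

theorem three_N (hconn : G.Connected) (hdeg : ∀ v, 3 ≤ gdeg G v)
    (hS : ∀ v, 3 < gdeg G v → v ∈ S) (W : Whl G S A K M s) (C : Cyc G M L f) {q r t : ℕ}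
    (h0 : ∃ u ∈ K, G.Adj (f 0) u) (h1 : G.Adj (f 1) s) (hq : 1 < q)
    (hNq : ∃ u ∈ K, G.Adj (f q) u) (hqr : q < r) (hr : r < L) (hNr : ∃ u ∈ K, G.Adj (f r) u)
    (hqt : q < t) (htL : t < L) (hTt : G.Adj (f t) s) : SolC G S := by
  obtain ⟨k0, hk0, a0⟩ := h0
  obtain ⟨kq, hkq, aq⟩ := hNq
  obtain ⟨kr, hkr, ar⟩ := hNr
  have i1 : f 0 ≠ f q := fun h => by have := C.inj 0 (by omega) q (by omega) h; omega
  have i2 : f 0 ≠ f r := fun h => by have := C.inj 0 (by omega) r (by omega) h; omega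
  have i3 : f q ≠ f r := fun h => by have := C.inj q (by omega) r (by omega) h; omega
  obtain ⟨U, hAU, hUK, hUc, i, hiU, hrest⟩ := lemmaY hdeg hS W ![f 0, f q, f r] ![k0, kq, kr]
    (by intro i; fin_cases i <;> exact C.mem _)
    (by
      intro i j hij
      fin_cases i <;> fin_cases j <;> simp_all)
    (by intro i; fin_cases i <;> assumption)
    (by intro i; fin_cases i <;> assumption)
  have eL : f L = f 0 := C.z
  fin_cases i
  · obtain ⟨b1, b2, b3⟩ := hrest 2 1 (by decide) (by decide)
    have C' := C.shift r
    have e1 : L - r + r = L := by omega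
    have e2 : L - r + q + r = q + L := by omega
    have e3 : L - r + 1 + r = 1 + L := by omega
    refine lemmaX hconn hdeg hS W C' (d := L - r) (e := L - r + q) (t := L - r + 1) (by omega)
      (by omega) (by omega) (by omega) (by omega) ?_ hAU hUK hUc (k0 := kr) (kd := k0) (ke := kq)
      hiU b1 ?_ ?_ ?_ b3
    · show G.Adj (f (L - r + 1 + r)) s
      rw [e3, C.per]; exact h1
    · show G.Adj (f (0 + r)) kr
      rw [Nat.zero_add]; exact ar
    · show G.Adj (f (L - r + r)) k0
      rw [e1, eL]; exact a0
    · show G.Adj (f (L - r + q + r)) kq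
      rw [e2, C.per]; exact aq
  · obtain ⟨b1, b2, b3⟩ := hrest 0 2 (by decide) (by decide)
    exact lemmaX hconn hdeg hS W C (d := q) (e := r) (t := 1) (by omega)
      (by omega) (by omega) (by omega) (by omega) h1 hAU hUK hUc (k0 := k0) (kd := kq) (ke := kr)
      hiU b1 a0 aq ar b3
  · obtain ⟨b1, b2, b3⟩ := hrest 1 0 (by decide) (by decide)
    have C' := C.shift q
    have e1 : r - q + q = r := by omega
    have e2 : L - q + q = L := by omega
    have e3 : t - q + q = t := by omega
    refine lemmaX hconn hdeg hS W C' (d := r - q) (e := L - q) (t := t - q) (by omega)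
      (by omega) (by omega) (by omega) (by omega) ?_ hAU hUK hUc (k0 := kq) (kd := kr) (ke := k0)
      hiU b1 ?_ ?_ ?_ b3
    · show G.Adj (f (t - q + q)) s
      rw [e3]; exact hTt
    · show G.Adj (f (0 + q)) kq
      rw [Nat.zero_add]; exact aq
    · show G.Adj (f (r - q + q)) kr
      rw [e1]; exact ar
    · show G.Adj (f (L - q + q)) k0
      rw [e2, eL]; exact a0

/-- A vertex of the rim adjacent to the hub: its neighbours. -/
theorem T_nbr (W : Whl G S A K M s) (C : Cyc G M L f) (i : ℕ) (h : G.Adj (f (i + 1)) s) {z : V}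
    (hz : G.Adj (f (i + 1)) z) : z = s ∨ z = f i ∨ z = f (i + 2) := by
  by_cases hM : z ∈ M
  · exact Or.inr (C.nbr W i hM hz)
  · left
    obtain ⟨o, -, -, h3⟩ := W.outer (C.mem (i + 1))
    rw [h3 z hz hM, h3 s h W.sM]

theorem wa_case (hdeg : ∀ v, 3 ≤ gdeg G v) (W : Whl G S A K M s) (C : Cyc G M L f) {q : ℕ}
    (h0 : ∃ u ∈ K, G.Adj (f 0) u) (hq1 : 1 < q) (hqL : q ≤ L) (hNq : ∃ u ∈ K, G.Adj (f q) u)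
    (hT : ∀ i, 1 ≤ i → i < q → G.Adj (f i) s)
    (hN : ∀ i, q ≤ i → i < L → ∃ u ∈ K, G.Adj (f i) u) :
    ∃ (n : ℕ) (p : Fin (n + 1) → V) (v x y : V), v ∈ S ∧ IsWaConfig G n p v x y := by
  have hsN : ∀ z, G.Adj s z → ∃ i, 1 ≤ i ∧ i < q ∧ f i = z := by
    intro z hz
    obtain ⟨i, hi, rfl⟩ := C.surj z (W.sT hz)
    by_cases h1 : i = 0
    · subst h1
      obtain ⟨u, hu, ha⟩ := h0
      exact absurd hz.symm (W.NTx (C.mem 0) hu ha)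
    · by_cases h2 : i < q
      · exact ⟨i, by omega, h2, rfl⟩
      · obtain ⟨u, hu, ha⟩ := hN i (by omega) hi
        exact absurd hz.symm (W.NTx (C.mem i) hu ha)
  have hq4 : 4 ≤ q := by
    have h3 : 3 ≤ (G.neighborSet s).ncard := hdeg s
    have hsub : G.neighborSet s ⊆ f '' (Set.Ico 1 q) := by
      intro z hz
      obtain ⟨i, h1, h2, h3⟩ := hsN z hz
      exact ⟨i, ⟨h1, h2⟩, h3⟩
    have h4 := Set.ncard_le_ncard hsub (Set.toFinite _)
    have h5 := Set.ncard_image_le (f := f) (Set.finite_Ico 1 q)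
    have h6 : (Set.Ico 1 q).ncard = q - 1 := by
      rw [← Finset.coe_Ico, Set.ncard_coe_finset, Nat.card_Ico]
    omega
  obtain ⟨n, rfl⟩ : ∃ n, q = n + 4 := ⟨q - 4, by omega⟩
  set p : Fin (n + 1) → V := fun i => f (i.1 + 2) with hp
  have hfs : ∀ i, f i ≠ s := fun i h => W.sM (h ▸ C.mem i)
  have hne : ∀ i j, 1 ≤ i → i ≤ L → 1 ≤ j → j ≤ L → i ≠ j → f i ≠ f j :=
    fun i j h1 h2 h3 h4 h5 h6 => h5 (C.inj' h1 h2 h3 h4 h6)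
  have hH : ∀ z, z ∈ waVerts p s (f 1) (f (n + 3)) ↔ z = s ∨ ∃ i, 1 ≤ i ∧ i < n + 4 ∧ f i = z := by
    intro z
    constructor
    · rintro ((rfl | rfl | rfl) | ⟨i, rfl⟩)
      · exact Or.inl rfl
      · exact Or.inr ⟨1, by omega, by omega, rfl⟩
      · exact Or.inr ⟨n + 3, by omega, by omega, rfl⟩
      · exact Or.inr ⟨i.1 + 2, by omega, by omega, rfl⟩
    · rintro (rfl | ⟨i, h1, h2, rfl⟩)
      · exact Or.inl (Or.inl rfl)
      · by_cases e1 : i = 1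
        · subst e1; exact Or.inl (Or.inr (Or.inl rfl))
        · by_cases e2 : i = n + 3
          · subst e2; exact Or.inl (Or.inr (Or.inr rfl))
          · refine Or.inr ⟨⟨i - 2, by omega⟩, ?_⟩
            show f (i - 2 + 2) = f i
            congr 1; omega
  have hKH : ∀ z, z ∈ K → z ∉ waVerts p s (f 1) (f (n + 3)) := by
    intro z hz h
    rcases (hH z).1 h with rfl | ⟨i, -, -, rfl⟩
    · exact W.sK hz
    · exact W.KM hz (C.mem i)
  have hNH : ∀ z, z ∈ M → (∃ u ∈ K, G.Adj z u) → z ∉ waVerts p s (f 1) (f (n + 3)) := by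
    rintro z hzM ⟨u, hu, ha⟩ h
    rcases (hH z).1 h with rfl | ⟨i, h1, h2, rfl⟩
    · exact W.sM hzM
    · exact W.NTx hzM hu ha (hT i h1 h2)
  refine ⟨n, p, s, f 1, f (n + 3), W.sS, ?_, ?_, ?_, ?_, ?_, ?_, ?_, ?_, ?_, ?_, ?_, ?_, ?_, ?_,
    ?_, ?_, ?_, ?_⟩
  · intro i j hij
    have := C.inj' (i := i.1 + 2) (j := j.1 + 2) (by omega) (by omega) (by omega) (by omega) hij
    exact Fin.ext (by omega)
  · rintro ⟨i, hi⟩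
    exact hfs _ hi
  · rintro ⟨i, hi⟩
    exact hne (i.1 + 2) 1 (by omega) (by omega) (by omega) (by omega) (by omega) hi
  · rintro ⟨i, hi⟩
    exact hne (i.1 + 2) (n + 3) (by omega) (by omega) (by omega) (by omega) (by omega) hi
  · exact (hfs _).symm
  · exact (hfs _).symm
  · exact hne _ _ (by omega) (by omega) (by omega) (by omega) (by omega)
  · intro i
    show G.Adj (f (i.1 + 2)) (f (i.1 + 1 + 2))
    exact C.adj _
  · intro i
    exact (hT (i.1 + 2) (by omega) (by omega)).symm
  · exact (hT 1 (by omega) (by omega)).symm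
  · exact (hT (n + 3) (by omega) (by omega)).symm
  · exact C.adj 1
  · exact (C.adj (n + 2)).symm
  · intro z hz hzs
    rcases (hH z).1 hz with rfl | ⟨i, h1, h2, rfl⟩
    · exact absurd rfl hzs
    · exact W.d3 _ (C.mem i)
  · obtain ⟨r, hr⟩ := W.Rn
    refine induce_connected (con_of_attach W.Kc (fun z hz => hKH z hz) ?_) ⟨r, hKH r (W.RK hr)⟩
    intro z hz
    by_cases hzK : z ∈ K
    · exact Or.inl hzK
    · right
      have hzs : z ≠ s := fun h => hz ((hH z).2 (Or.inl h))
      have hzM : z ∈ M := W.mem_iff.2 ⟨hzs, hzK⟩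
      rcases W.NT hzM with h | h
      · exact h
      · exact absurd ((hH z).2 (Or.inr (hsN z h.symm))) hz
  · refine ⟨f 0, ⟨hNH _ (C.mem 0) h0, (C.adj 0).symm⟩, ?_⟩
    rintro w ⟨hw, ha⟩
    rcases T_nbr W C 0 (hT 1 (by omega) (by omega)) ha with rfl | h | h
    · exact absurd ((hH _).2 (Or.inl rfl)) hw
    · exact h
    · exact absurd ((hH _).2 (Or.inr ⟨2, by omega, by omega, h.symm⟩)) hw
  · refine ⟨f (n + 4), ⟨hNH _ (C.mem _) hNq, C.adj (n + 3)⟩, ?_⟩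
    rintro w ⟨hw, ha⟩
    rcases T_nbr W C (n + 2) (hT (n + 3) (by omega) (by omega)) ha with rfl | h | h
    · exact absurd ((hH _).2 (Or.inl rfl)) hw
    · exact absurd ((hH _).2 (Or.inr ⟨n + 2, by omega, by omega, h.symm⟩)) hw
    · exact h
  · intro z hz hzx hzy w hw ha
    rcases (hH z).1 hz with rfl | ⟨i, h1, h2, rfl⟩
    · exact hw ((hH w).2 (Or.inr (hsN w ha)))
    · have e1 : i ≠ 1 := by rintro rfl; exact hzx rfl
      have e2 : i ≠ n + 3 := by rintro rfl; exact hzy rfl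
      obtain ⟨j, rfl⟩ : ∃ j, i = j + 1 := ⟨i - 1, by omega⟩
      rcases T_nbr W C j (hT _ h1 h2) ha with rfl | h | h
      · exact hw ((hH _).2 (Or.inl rfl))
      · exact hw ((hH _).2 (Or.inr ⟨j, by omega, by omega, h.symm⟩))
      · exact hw ((hH _).2 (Or.inr ⟨j + 2, by omega, by omega, h.symm⟩))

theorem wab_case (W : Whl G S A K M s) (C : Cyc G M L f) {q : ℕ}
    (h0 : ∃ u ∈ K, G.Adj (f 0) u) (hq1 : 1 < q) (hqL : q + 2 ≤ L)
    (hNq : ∃ u ∈ K, G.Adj (f q) u)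
    (hT : ∀ i, 1 ≤ i → i < q → G.Adj (f i) s)
    (hT' : ∀ i, q < i → i < L → G.Adj (f i) s) :
    ∃ (n m : ℕ) (p : Fin (n + 1) → V) (q : Fin (m + 1) → V) (v x y : V),
        v ∈ S ∧ IsWabConfig G n m p q v x y := by
  obtain ⟨n, rfl⟩ : ∃ n, q = n + 2 := ⟨q - 2, by omega⟩
  obtain ⟨m, rfl⟩ : ∃ m, L = n + 4 + m := ⟨L - (n + 4), by omega⟩
  set p : Fin (n + 1) → V := fun i => f (i.1 + 1) with hp
  set q : Fin (m + 1) → V := fun j => f (n + 3 + m - j.1) with hq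
  have eL : f (n + 4 + m) = f 0 := C.z
  have hfs : ∀ i, f i ≠ s := fun i h => W.sM (h ▸ C.mem i)
  have hne : ∀ i j, i < n + 4 + m → j < n + 4 + m → i ≠ j → f i ≠ f j :=
    fun i j h2 h4 h5 h6 => h5 (C.inj i h2 j h4 h6)
  have hH : ∀ z, z ∈ wabVerts p q s (f 0) (f (n + 2)) ↔ z ∉ K := by
    intro z
    constructor
    · rintro (((rfl | rfl | rfl) | ⟨i, rfl⟩) | ⟨i, rfl⟩) hK
      · exact W.sK hK
      · exact W.KM hK (C.mem _)
      · exact W.KM hK (C.mem _)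
      · exact W.KM hK (C.mem _)
      · exact W.KM hK (C.mem _)
    · intro hzK
      by_cases hzs : z = s
      · subst hzs; exact Or.inl (Or.inl (Or.inl rfl))
      obtain ⟨i, hi, rfl⟩ := C.surj z (W.mem_iff.2 ⟨hzs, hzK⟩)
      by_cases e1 : i = 0
      · subst e1; exact Or.inl (Or.inl (Or.inr (Or.inl rfl)))
      by_cases e2 : i = n + 2
      · subst e2; exact Or.inl (Or.inl (Or.inr (Or.inr rfl)))
      by_cases e3 : i < n + 2
      · refine Or.inl (Or.inr ⟨⟨i - 1, by omega⟩, ?_⟩)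
        show f (i - 1 + 1) = f i
        congr 1; omega
      · refine Or.inr ⟨⟨n + 3 + m - i, by omega⟩, ?_⟩
        show f (n + 3 + m - (n + 3 + m - i)) = f i
        congr 1; omega
  have huniq : ∀ i, (∃ u ∈ K, G.Adj (f i) u) →
      ∃! w, w ∉ wabVerts p q s (f 0) (f (n + 2)) ∧ G.Adj (f i) w := by
    rintro i ⟨u, hu, ha⟩
    obtain ⟨o, -, -, h3⟩ := W.outer (C.mem i)
    refine ⟨u, ⟨fun h => (hH u).1 h hu, ha⟩, ?_⟩
    rintro w ⟨hw, hwa⟩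
    have hwK : w ∈ K := by
      by_contra h
      exact hw ((hH w).2 h)
    rw [h3 w hwa (W.KM hwK), h3 u ha (W.KM hu)]
  refine ⟨n, m, p, q, s, f 0, f (n + 2), W.sS, ?_, ?_, ?_, ?_, ?_, ?_, ?_, ?_, ?_, ?_, ?_, ?_, ?_,
    ?_, ?_, ?_, ?_, ?_, ?_, ?_, ?_, ?_, ?_, ?_, ?_⟩
  · intro i j hij
    have := C.inj (i.1 + 1) (by omega) (j.1 + 1) (by omega) hij
    exact Fin.ext (by omega)
  · intro i j hij
    have := C.inj (n + 3 + m - i.1) (by omega) (n + 3 + m - j.1) (by omega) hij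
    exact Fin.ext (by omega)
  · refine Set.disjoint_left.2 ?_
    rintro z ⟨i, rfl⟩ ⟨j, hj⟩
    exact hne (n + 3 + m - j.1) (i.1 + 1) (by omega) (by omega) (by omega) hj
  · rintro ⟨i, hi⟩
    exact hfs _ hi
  · rintro ⟨i, hi⟩
    exact hne (i.1 + 1) 0 (by omega) (by omega) (by omega) hi
  · rintro ⟨i, hi⟩
    exact hne (i.1 + 1) (n + 2) (by omega) (by omega) (by omega) hi
  · rintro ⟨i, hi⟩
    exact hfs _ hi
  · rintro ⟨i, hi⟩
    exact hne (n + 3 + m - i.1) 0 (by omega) (by omega) (by omega) hi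
  · rintro ⟨i, hi⟩
    exact hne (n + 3 + m - i.1) (n + 2) (by omega) (by omega) (by omega) hi
  · exact (hfs _).symm
  · exact (hfs _).symm
  · exact hne _ _ (by omega) (by omega) (by omega)
  · intro i
    show G.Adj (f (i.1 + 1)) (f (i.1 + 1 + 1))
    exact C.adj _
  · intro i
    show G.Adj (f (n + 3 + m - i.1)) (f (n + 3 + m - (i.1 + 1)))
    have h := (C.adj (n + 3 + m - (i.1 + 1))).symm
    have e : n + 3 + m - (i.1 + 1) + 1 = n + 3 + m - i.1 := by omega
    rwa [e] at h
  · intro i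
    exact (hT (i.1 + 1) (by omega) (by omega)).symm
  · intro i
    exact (hT' (n + 3 + m - i.1) (by omega) (by omega)).symm
  · exact C.adj 0
  · have h := (C.adj (n + 3 + m)).symm
    have e : n + 3 + m + 1 = n + 4 + m := by omega
    rw [e, eL] at h
    exact h
  · exact (C.adj (n + 1)).symm
  · show G.Adj (f (n + 2)) (f (n + 3 + m - m))
    have e : n + 3 + m - m = n + 2 + 1 := by omega
    rw [e]
    exact C.adj (n + 2)
  · intro z hz hzs
    exact W.d3 _ (W.mem_iff.2 ⟨hzs, (hH z).1 hz⟩)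
  · have e : (wabVerts p q s (f 0) (f (n + 2)))ᶜ = K := by
      ext z
      rw [Set.mem_compl_iff, hH z, not_not]
    rw [e]
    obtain ⟨r, hr⟩ := W.Rn
    exact induce_connected W.Kc ⟨r, W.RK hr⟩
  · exact huniq 0 h0
  · exact huniq _ hNq
  · intro z hz hzx hzy w hw ha
    have hwK : w ∈ K := by
      by_contra h
      exact hw ((hH w).2 h)
    by_cases hzs : z = s
    · subst hzs
      exact W.sn w hwK ha
    · obtain ⟨i, hi, rfl⟩ := C.surj z (W.mem_iff.2 ⟨hzs, (hH z).1 hz⟩)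
      have e1 : i ≠ 0 := by rintro rfl; exact hzx rfl
      have e2 : i ≠ n + 2 := by rintro rfl; exact hzy rfl
      refine W.NTx (C.mem i) hwK ha ?_
      by_cases e3 : i < n + 2
      · exact hT i (by omega) e3
      · exact hT' i (by omega) hi

theorem wheel_start (hdeg : ∀ v, 3 ≤ gdeg G v) (W : Whl G S A K M s) (C : Cyc G M L f)
    (hN : ∃ v ∈ M, ∃ u ∈ K, G.Adj v u) :
    ∃ g, Cyc G M L g ∧ (∃ u ∈ K, G.Adj (g 0) u) ∧ G.Adj (g 1) s := by
  obtain ⟨v, hv, hvN⟩ := hN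
  obtain ⟨i, hi, rfl⟩ := C.surj v hv
  by_contra hcon
  push Not at hcon
  have step : ∀ j, (∃ u ∈ K, G.Adj (f j) u) → ∃ u ∈ K, G.Adj (f (j + 1)) u := by
    intro j hj
    rcases W.NT (C.mem (j + 1)) with h | h
    · exact h
    · refine absurd ?_ (hcon _ (C.shift j) ?_)
      · show G.Adj (f (1 + j)) s
        rw [Nat.add_comm]; exact h
      · simpa using hj
  have hall : ∀ k, ∃ u ∈ K, G.Adj (f (i + k)) u := by
    intro k
    induction k with
    | zero => exact hvN
    | succ k ih => exact step _ ih
  obtain ⟨z, hz, -, -⟩ := exists_third (hdeg s) s s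
  have hzM := W.sT hz
  obtain ⟨j, hj, rfl⟩ := C.surj z hzM
  have e : i + (j + L - i) = j + L := by omega
  have h := hall (j + L - i)
  rw [e, C.per] at h
  obtain ⟨u, hu, ha⟩ := h
  exact W.NTx hzM hu ha hz.symm

theorem wheel_done (hconn : G.Connected) (hdeg : ∀ v, 3 ≤ gdeg G v)
    (hS : ∀ v, 3 < gdeg G v → v ∈ S) (W : Whl G S A K M s) (C : Cyc G M L f)
    (hN : ∃ v ∈ M, ∃ u ∈ K, G.Adj v u) :
    SolC G S ∨
    (∃ (n : ℕ) (p : Fin (n + 1) → V) (v x y : V), v ∈ S ∧ IsWaConfig G n p v x y) ∨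
    (∃ (n m : ℕ) (p : Fin (n + 1) → V) (q : Fin (m + 1) → V) (v x y : V),
        v ∈ S ∧ IsWabConfig G n m p q v x y) := by
  classical
  obtain ⟨g, C, h0, h1⟩ := wheel_start hdeg W C hN
  have hL3 := C.three
  have hex : ∃ m, 1 ≤ m ∧ ∃ u ∈ K, G.Adj (g m) u := ⟨L, by omega, by rw [C.z]; exact h0⟩
  obtain ⟨q, hq⟩ : ∃ q, q = Nat.find hex := ⟨_, rfl⟩
  have hqs : 1 ≤ q ∧ ∃ u ∈ K, G.Adj (g q) u := by rw [hq]; exact Nat.find_spec hex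
  have hqm : ∀ m, 1 ≤ m → m < q → G.Adj (g m) s := by
    intro m hm1 hm2
    rw [hq] at hm2
    rcases W.NT (C.mem m) with h | h
    · exact absurd ⟨hm1, h⟩ (Nat.find_min hex hm2)
    · exact h
  have hqL : q ≤ L := by
    rw [hq]
    exact Nat.find_min' hex ⟨by omega, by rw [C.z]; exact h0⟩
  have hq1 : 1 < q := by
    rcases Nat.lt_or_ge 1 q with h | h
    · exact h
    · have e : q = 1 := by omega
      rw [e] at hqs
      obtain ⟨-, u, hu, ha⟩ := hqs
      exact absurd h1 (W.NTx (C.mem 1) hu ha)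
  by_cases hi : ∀ i, q ≤ i → i < L → ∃ u ∈ K, G.Adj (g i) u
  · exact Or.inr (Or.inl (wa_case hdeg W C h0 hq1 hqL hqs.2 hqm hi))
  · have hi' : ∃ t, q ≤ t ∧ t < L ∧ ¬ ∃ u ∈ K, G.Adj (g t) u := by
      by_contra hc
      refine hi fun i h1 h2 => ?_
      by_contra h3
      exact hc ⟨i, h1, h2, h3⟩
    obtain ⟨t, ht1, ht2, ht3⟩ := hi'
    have htT : G.Adj (g t) s := (W.NT (C.mem t)).resolve_left ht3
    have hqt : q < t := by
      rcases Nat.lt_or_ge q t with h | h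
      · exact h
      · have e : t = q := by omega
        rw [e] at ht3
        exact absurd hqs.2 ht3
    by_cases hj : ∀ i, q < i → i < L → G.Adj (g i) s
    · exact Or.inr (Or.inr (wab_case W C h0 hq1 (by omega) hqs.2 hqm hj))
    · left
      push Not at hj
      obtain ⟨r, hr1, hr2, hr3⟩ := hj
      exact three_N hconn hdeg hS W C h0 h1 hq1 hqs.2 hr1 hr2
        ((W.NT (C.mem r)).resolve_right hr3) hqt ht2 htT

end wheel2

/-- Let `G` be a finite simple connected graph of minimum degree at least 3 and let `S` be
a set of vertices containing all vertices of degree greater than 3. Then (C) there is an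
induced non-edge-separating cycle avoiding `S`, or (P) an induced non-edge-separating path
with both (distinct) endvertices in `S`, or (W) a `W_a`- or `W_{a,b}`-configuration with
centre in `S`. -/
theorem stmt_8 (V : Type) [Fintype V] (G : SimpleGraph V) (hconn : G.Connected)
    (hdeg : ∀ v, 3 ≤ gdeg G v) (S : Set V) (hS : ∀ v, 3 < gdeg G v → v ∈ S) :
    (∃ (u : V) (c : G.Walk u u), c.IsCycle ∧
        (∀ z ∈ c.support, z ∉ S) ∧
        (∀ a b : V, a ∈ c.support → b ∈ c.support → G.Adj a b → s(a, b) ∈ c.edges) ∧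
        (G.deleteEdges {e | e ∈ c.edges}).Connected) ∨
    (∃ (u w : V) (P : G.Walk u w), u ≠ w ∧ u ∈ S ∧ w ∈ S ∧ P.IsPath ∧
        (∀ a b : V, a ∈ P.support → b ∈ P.support → G.Adj a b → s(a, b) ∈ P.edges) ∧
        (G.deleteEdges {e | e ∈ P.edges}).Connected) ∨
    (∃ (n : ℕ) (p : Fin (n + 1) → V) (v x y : V),
        v ∈ S ∧ IsWaConfig G n p v x y) ∨
    (∃ (n m : ℕ) (p : Fin (n + 1) → V) (q : Fin (m + 1) → V) (v x y : V),
        v ∈ S ∧ IsWabConfig G n m p q v x y) := by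
  classical
  obtain ⟨A, hAn, hcut, hmin, hAc, hRc⟩ := exists_A G hconn
  by_cases hone : ∀ x ∈ A, ∀ y ∈ A, x ∈ S → y ∈ S → x = y
  · rcases caseII_red hconn hdeg hS A hAn hcut hRc hone with h | ⟨K, M, s, L, f, W, C, hN⟩
    · exact Or.inl h
    · rcases wheel_done hconn hdeg hS W C hN with h | h | h
      · exact Or.inl h
      · exact Or.inr (Or.inr (Or.inl h))
      · exact Or.inr (Or.inr (Or.inr h))
  · push Not at hone
    obtain ⟨x, hx, y, hy, hxS, hyS, hne⟩ := hone
    rcases caseI hconn hdeg hS A hAc hRc hmin x y hxS hyS hx hy hne with h | h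
    · exact Or.inl h
    · exact Or.inr (Or.inl h)
end
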